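/- Let G with list assignment L and precolored path P be a minimal counterexample configuration for the precolored-path 5-choosability theorem, and let F be the cycle bounding the outer face of G. Then P has length exactly two, say P = p0 p1 p2, the vertices p0, p1 and p2 have no common neighbor in G, and F has length at least 6. -/

import Mathlib

open Set

noncomputable section

/-- A drawing of a simple graph in the plane: vertices are mapped to distinct points,
each edge is realized by a simple arc joining the images of its endpoints, arcs do not
pass through vertex points, any two arcs realizing distinct edges meet in at most one
point, and no point of the plane that is not a vertex point lies on three or more arcs. -/
structure Drawing {V : Type} (G : SimpleGraph V) where
  pos : V → ℝ × ℝ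
  pos_inj : Function.Injective pos
  arc : ∀ ⦃u v : V⦄, G.Adj u v → Path (pos u) (pos v)
  arc_symm : ∀ ⦃u v : V⦄ (h : G.Adj u v), arc h.symm = (arc h).symm
  arc_inj : ∀ ⦃u v : V⦄ (h : G.Adj u v), Function.Injective ⇑(arc h)
  arc_vertex : ∀ ⦃u v : V⦄ (h : G.Adj u v) (t : unitInterval) (w : V),
    arc h t = pos w → t = 0 ∨ t = 1
  arc_meet_once : ∀ ⦃u v x y : V⦄ (h₁ : G.Adj u v) (h₂ : G.Adj x y),
    s(u, v) ≠ s(x, y) → (Set.range ⇑(arc h₁) ∩ Set.range ⇑(arc h₂)).Subsingleton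
  arc_no_triple : ∀ ⦃u₁ v₁ u₂ v₂ u₃ v₃ : V⦄ (h₁ : G.Adj u₁ v₁) (h₂ : G.Adj u₂ v₂)
    (h₃ : G.Adj u₃ v₃), s(u₁, v₁) ≠ s(u₂, v₂) → s(u₁, v₁) ≠ s(u₃, v₃) →
    s(u₂, v₂) ≠ s(u₃, v₃) →
    ∀ p ∈ Set.range ⇑(arc h₁) ∩ Set.range ⇑(arc h₂) ∩ Set.range ⇑(arc h₃),
      ∃ w : V, p = pos w

namespace Drawing

variable {V : Type} {G : SimpleGraph V} (D : Drawing G)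

/-- The set of points used by the arc of an edge. -/
def arcSet ⦃u v : V⦄ (h : G.Adj u v) : Set (ℝ × ℝ) :=
  Set.range ⇑(D.arc h)

/-- The set of interior points of the arc of an edge. -/
def arcInterior ⦃u v : V⦄ (h : G.Adj u v) : Set (ℝ × ℝ) :=
  ⇑(D.arc h) '' {t : unitInterval | t ≠ 0 ∧ t ≠ 1}

/-- All points of the plane used by the drawing. -/
def graphSet : Set (ℝ × ℝ) :=
  Set.range D.pos ∪ ⋃ (u : V) (v : V) (h : G.Adj u v), D.arcSet h

/-- A crossing of a drawing: a point interior to the arcs of two distinct edges. -/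
def IsCrossing (p : ℝ × ℝ) : Prop :=
  ∃ (u v x y : V) (h₁ : G.Adj u v) (h₂ : G.Adj x y),
    s(u, v) ≠ s(x, y) ∧ p ∈ D.arcInterior h₁ ∧ p ∈ D.arcInterior h₂

/-- A drawing is plane if it has no crossings. -/
def IsPlane : Prop := ∀ p : ℝ × ℝ, ¬ D.IsCrossing p

/-- The faces of a drawing are the connected components of the complement
of the drawing. -/
def IsFace (f : Set (ℝ × ℝ)) : Prop :=
  ∃ q : ℝ × ℝ, q ∉ D.graphSet ∧ f = connectedComponentIn D.graphSetᶜ q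

/-- The outer (unbounded) face of a drawing. -/
def outerFace : Set (ℝ × ℝ) :=
  {p : ℝ × ℝ | p ∉ D.graphSet ∧
    ¬ Bornology.IsBounded (connectedComponentIn D.graphSetᶜ p)}

/-- A vertex lies on the outer face if its point is on the boundary of the outer face. -/
def OnOuter (v : V) : Prop := D.pos v ∈ frontier D.outerFace

/-- The set of points of the plane used by the drawing of a walk. -/
def walkSet {a b : V} (W : G.Walk a b) : Set (ℝ × ℝ) :=
  D.pos '' {v : V | v ∈ W.support} ∪ ⋃ d ∈ W.darts, D.arcSet d.adj

/-- A closed walk bounds the outer face if the boundary of the outer face is exactly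
the drawing of the walk. -/
def BoundsOuter {a : V} (W : G.Walk a a) : Prop :=
  frontier D.outerFace = D.walkSet W

end Drawing

/-- The open region enclosed by a set `S` (typically the drawing of a cycle):
all points outside `S` whose connected component in the complement of `S` is bounded. -/
def enclosed (S : Set (ℝ × ℝ)) : Set (ℝ × ℝ) :=
  {p : ℝ × ℝ | p ∉ S ∧ Bornology.IsBounded (connectedComponentIn Sᶜ p)}

namespace Drawing

variable {V : Type} {G : SimpleGraph V} (D : Drawing G)

/-- The closed disc bounded by (the drawing of) a closed walk. -/
def closedDisc {a : V} (W : G.Walk a a) : Set (ℝ × ℝ) :=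
  D.walkSet W ∪ enclosed (D.walkSet W)

/-- The endpoints of the (two) edges incident with a crossing point `p`. -/
def crossingEnds (p : ℝ × ℝ) : Set V :=
  {w : V | ∃ (z : V) (h : G.Adj w z), p ∈ D.arcInterior h}

end Drawing

/-- A proper colouring of `G` from the lists `L`. -/
def IsListColoring {V : Type} (G : SimpleGraph V) (L : V → Finset ℕ) (c : V → ℕ) : Prop :=
  (∀ v, c v ∈ L v) ∧ ∀ ⦃u v : V⦄, G.Adj u v → c u ≠ c v

/-- `G` is colourable from the lists `L`. -/
def ListColorable {V : Type} (G : SimpleGraph V) (L : V → Finset ℕ) : Prop :=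
  ∃ c : V → ℕ, IsListColoring G L c


/-- A counterexample configuration for the precolored-path 5-choosability theorem:
a plane graph `G` (on vertex set `Fin n`), a path `P` of length at most two contained in
the boundary of the outer face, and a list assignment `L` satisfying conditions
(i)–(vi) of the theorem, such that `G` is not `L`-colorable. -/
structure Config where
  n : ℕ
  G : SimpleGraph (Fin n)
  D : Drawing G
  plane : D.IsPlane
  a : Fin n
  b : Fin n
  P : G.Walk a b
  P_path : P.IsPath
  P_len : P.length ≤ 2
  P_boundary : D.walkSet P ⊆ frontier D.outerFace
  L : Fin n → Finset ℕ
  size5 : ∀ v, ¬ D.OnOuter v → 5 ≤ (L v).card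
  size3 : ∀ v, D.OnOuter v → v ∉ P.support → 3 ≤ (L v).card
  size1 : ∀ v ∈ P.support, (L v).card = 1
  no_adjacent_3 : ∀ u v, G.Adj u v → (L u).card = 3 → (L v).card ≠ 3
  proper_on_P : ∀ u ∈ P.support, ∀ v ∈ P.support, G.Adj u v → L u ≠ L v
  common_neighbor : ∀ p₀ p₁ p₂ : Fin n, P.support = [p₀, p₁, p₂] →
    ∀ x, G.Adj x p₀ → G.Adj x p₁ → G.Adj x p₂ → L x ≠ L p₀ ∪ L p₁ ∪ L p₂
  not_colorable : ¬ ListColorable G L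

/-- The number of vertices plus the number of edges of a configuration. -/
def Config.size (C : Config) : ℕ := C.n + C.G.edgeSet.ncard

/-- The length of the precolored path of a configuration. -/
def Config.plen (C : Config) : ℕ := C.P.length

/-- The total size of the lists of a configuration. -/
def Config.lsize (C : Config) : ℕ := ∑ v : Fin C.n, (C.L v).card

/-- A minimal counterexample configuration: `|V(G)| + |E(G)|` is minimum, subject to
that the precolored path is as long as possible, and subject to that the total size of
the lists is minimum. -/
def Config.Minimal (C : Config) : Prop :=
  (∀ C' : Config, C.size ≤ C'.size) ∧
  (∀ C' : Config, C'.size = C.size → C'.plen ≤ C.plen) ∧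
  (∀ C' : Config, C'.size = C.size → C'.plen = C.plen → C.lsize ≤ C'.lsize)

section
/-! Part I: continuous logarithms and separation in the plane -/

/-- The identification of the plane with the complex numbers. -/
def toC (z : ℝ × ℝ) : ℂ := Complex.equivRealProdCLM.symm z

lemma toC_continuous : Continuous toC := Complex.equivRealProdCLM.symm.continuous

lemma toC_injective : Function.Injective toC := Complex.equivRealProdCLM.symm.injective

/-- `p` and `q` lie in a common connected subset of the complement of `K`. -/
def SC (K : Set (ℝ × ℝ)) (p q : ℝ × ℝ) : Prop :=
  ∃ S : Set (ℝ × ℝ), IsPreconnected S ∧ S ⊆ Kᶜ ∧ p ∈ S ∧ q ∈ S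

lemma SC.symm {K : Set (ℝ × ℝ)} {p q : ℝ × ℝ} (h : SC K p q) : SC K q p := by
  obtain ⟨S, h1, h2, h3, h4⟩ := h
  exact ⟨S, h1, h2, h4, h3⟩

lemma SC.trans {K : Set (ℝ × ℝ)} {p q r : ℝ × ℝ} (h : SC K p q) (h' : SC K q r) : SC K p r := by
  obtain ⟨S, h1, h2, h3, h4⟩ := h
  obtain ⟨T, k1, k2, k3, k4⟩ := h'
  exact ⟨S ∪ T, IsPreconnected.union q h4 k3 h1 k1, union_subset h2 k2, Or.inl h3, Or.inr k4⟩

lemma SC.mono {K K' : Set (ℝ × ℝ)} {p q : ℝ × ℝ} (h : SC K p q) (hK : K' ⊆ K) : SC K' p q := by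
  obtain ⟨S, h1, h2, h3, h4⟩ := h
  exact ⟨S, h1, h2.trans (compl_subset_compl.2 hK), h3, h4⟩

lemma SC.refl {K : Set (ℝ × ℝ)} {p : ℝ × ℝ} (h : p ∉ K) : SC K p p :=
  ⟨{p}, isPreconnected_singleton, by simpa using h, rfl, rfl⟩

lemma SC.left {K : Set (ℝ × ℝ)} {p q : ℝ × ℝ} (h : SC K p q) : p ∉ K := by
  obtain ⟨S, h1, h2, h3, h4⟩ := h
  exact h2 h3

lemma SC.right {K : Set (ℝ × ℝ)} {p q : ℝ × ℝ} (h : SC K p q) : q ∉ K := h.symm.left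

lemma SC_iff {K : Set (ℝ × ℝ)} {p q : ℝ × ℝ} : SC K p q ↔ q ∈ connectedComponentIn Kᶜ p := by
  constructor
  · rintro ⟨S, h1, h2, h3, h4⟩
    exact h1.subset_connectedComponentIn h3 h2 h4
  · intro h
    have hp : p ∈ Kᶜ := by
      by_contra hp
      rw [connectedComponentIn_eq_empty hp] at h
      exact h
    exact ⟨_, isPreconnected_connectedComponentIn, connectedComponentIn_subset _ _,
      mem_connectedComponentIn hp, h⟩

/-- Nonvanishing functions on compact star-shaped sets have logarithms. -/
lemma exists_log_star {E : Type*} [NormedAddCommGroup E] [NormedSpace ℝ E] (S : Set E)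
    (hS : IsCompact S) (hstar : ∀ z ∈ S, ∀ t : ℝ, 0 ≤ t → t ≤ 1 → t • z ∈ S)
    (f : E → ℂ) (hf : ContinuousOn f S) (h0 : ∀ z ∈ S, f z ≠ 0) :
    ∃ g : E → ℂ, ContinuousOn g S ∧ ∀ z ∈ S, f z = Complex.exp (g z) := by
  rcases S.eq_empty_or_nonempty with rfl | hne
  · exact ⟨fun _ => 0, by simp, by simp⟩
  -- lower bound
  obtain ⟨z0, hz0, hmin⟩ := hS.exists_isMinOn hne hf.norm
  set ε := ‖f z0‖ with hε
  have hεpos : 0 < ε := norm_pos_iff.2 (h0 z0 hz0)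
  have huc := hS.uniformContinuousOn_of_continuous hf
  rw [Metric.uniformContinuousOn_iff] at huc
  obtain ⟨δ, hδ, huc⟩ := huc ε hεpos
  obtain ⟨M, hM⟩ := hS.isBounded.exists_norm_le
  obtain ⟨n, hn⟩ := exists_nat_gt (M / δ)
  have hM0 : 0 ≤ M := (norm_nonneg _).trans (hM z0 hz0)
  have hnpos : (0 : ℝ) < n := lt_of_le_of_lt (div_nonneg hM0 hδ.le) hn
  have hnn : n ≠ 0 := by rintro rfl; simp at hnpos
  have hmem : ∀ z ∈ S, ∀ k : ℕ, k ≤ n → ((k : ℝ) / n) • z ∈ S := by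
    intro z hz k hk
    apply hstar z hz
    · positivity
    · rw [div_le_one hnpos]; exact_mod_cast hk
  have hcont : ∀ k : ℕ, k ≤ n → ContinuousOn (fun z => f (((k : ℝ) / n) • z)) S := by
    intro k hk
    exact hf.comp (by fun_prop) (fun z hz => hmem z hz k hk)
  have hslit : ∀ z ∈ S, ∀ k : ℕ, k < n →
      f ((((k + 1 : ℕ) : ℝ) / n) • z) / f (((k : ℝ) / n) • z) ∈ Complex.slitPlane := by
    intro z hz k hk
    have m1 := hmem z hz (k + 1) hk
    have m0 := hmem z hz k hk.le
    have hd : dist (f ((((k + 1 : ℕ) : ℝ) / n) • z)) (f (((k : ℝ) / n) • z)) < ε := by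
      apply huc _ m1 _ m0
      rw [dist_eq_norm, ← sub_smul, norm_smul]
      have : (((k + 1 : ℕ) : ℝ) / n) - (k : ℝ) / n = 1 / n := by push_cast; ring
      rw [this, Real.norm_of_nonneg (by positivity)]
      have h1 := hM z hz
      rw [div_lt_iff₀ hδ] at hn
      rw [one_div, inv_mul_lt_iff₀ hnpos]
      linarith
    have hle : ε ≤ ‖f (((k : ℝ) / n) • z)‖ := hmin m0
    have hne0 := h0 _ m0
    have : ‖f ((((k + 1 : ℕ) : ℝ) / n) • z) / f (((k : ℝ) / n) • z) - 1‖ < 1 := by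
      rw [div_sub_one hne0, norm_div, div_lt_one (norm_pos_iff.2 hne0), ← dist_eq_norm]
      exact lt_of_lt_of_le hd hle
    have h2 := Complex.mem_slitPlane_of_norm_lt_one this
    simpa using h2
  have key : ∀ m : ℕ, m ≤ n → ∃ g : E → ℂ, ContinuousOn g S ∧
      ∀ z ∈ S, f (((m : ℝ) / n) • z) = Complex.exp (g z) := by
    intro m
    induction m with
    | zero =>
      intro _
      have h00 : (0 : E) ∈ S := by simpa using hmem z0 hz0 0 (Nat.zero_le _)
      refine ⟨fun _ => Complex.log (f 0), continuousOn_const, ?_⟩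
      intro z hz
      simp [Complex.exp_log (h0 _ h00)]
    | succ m ih =>
      intro hm
      obtain ⟨g, hg, hgf⟩ := ih (Nat.le_of_succ_le hm)
      refine ⟨fun z => g z + Complex.log (f ((((m + 1 : ℕ) : ℝ) / n) • z) / f (((m : ℝ) / n) • z)),
        ?_, ?_⟩
      · apply hg.add
        apply ContinuousOn.clog
        · exact (hcont _ hm).div (hcont _ (Nat.le_of_succ_le hm))
            (fun z hz => h0 _ (hmem z hz _ (Nat.le_of_succ_le hm)))
        · intro z hz; exact hslit z hz m hm
      · intro z hz
        rw [Complex.exp_add, ← hgf z hz, Complex.exp_log (Complex.slitPlane_ne_zero (hslit z hz m hm)),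
          mul_div_cancel₀ _ (h0 _ (hmem z hz _ (Nat.le_of_succ_le hm)))]
  obtain ⟨g, hg, hgf⟩ := key n le_rfl
  refine ⟨g, hg, fun z hz => ?_⟩
  have := hgf z hz
  rwa [div_self hnpos.ne', one_smul] at this

/-- Two logarithms of the same function on a preconnected set differ by a constant. -/
lemma log_diff_const {X : Type*} [TopologicalSpace X] (S : Set X) (hS : IsPreconnected S)
    (g₁ g₂ : X → ℂ) (h1 : ContinuousOn g₁ S) (h2 : ContinuousOn g₂ S)
    (h : ∀ z ∈ S, Complex.exp (g₁ z) = Complex.exp (g₂ z)) :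
    ∃ c : ℂ, Complex.exp c = 1 ∧ ∀ z ∈ S, g₁ z = g₂ z + c := by
  rcases S.eq_empty_or_nonempty with rfl | ⟨z0, hz0⟩
  · exact ⟨0, by simp, by simp⟩
  have hinter : ∀ z ∈ S, ∃ n : ℤ, g₁ z = g₂ z + n * (2 * Real.pi * Complex.I) := fun z hz =>
    Complex.exp_eq_exp_iff_exists_int.1 (h z hz)
  have hc : ContinuousOn (fun z => (g₁ z - g₂ z).im / (2 * Real.pi)) S := by
    have : ContinuousOn (fun z => (g₁ z - g₂ z).im) S :=
      Complex.continuous_im.comp_continuousOn (h1.sub h2)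
    exact this.div_const _
  have hval : ∀ z (n : ℤ), g₁ z = g₂ z + n * (2 * Real.pi * Complex.I) →
      (g₁ z - g₂ z).im / (2 * Real.pi) = n := by
    intro z n hn
    rw [hn]
    have : (g₂ z + n * (2 * Real.pi * Complex.I) - g₂ z) =
      ((n * (2 * Real.pi) : ℝ) : ℂ) * Complex.I := by push_cast; ring
    rw [this, Complex.im_ofReal_mul, Complex.I_im]
    field_simp
  obtain ⟨n0, hn0⟩ := hinter z0 hz0
  refine ⟨n0 * (2 * Real.pi * Complex.I), Complex.exp_int_mul_two_pi_mul_I n0, ?_⟩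
  intro z hz
  obtain ⟨n, hn⟩ := hinter z hz
  suffices n = n0 by rw [hn, this]
  by_contra hne
  have hord := (hS.image _ hc).ordConnected
  have m0 : ((n0 : ℤ) : ℝ) ∈ (fun z => (g₁ z - g₂ z).im / (2 * Real.pi)) '' S :=
    ⟨z0, hz0, hval z0 n0 hn0⟩
  have m1 : ((n : ℤ) : ℝ) ∈ (fun z => (g₁ z - g₂ z).im / (2 * Real.pi)) '' S :=
    ⟨z, hz, hval z n hn⟩
  have hlt : ∀ a b : ℤ, a < b → (a : ℝ) ∈ (fun z => (g₁ z - g₂ z).im / (2 * Real.pi)) '' S →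
      (b : ℝ) ∈ (fun z => (g₁ z - g₂ z).im / (2 * Real.pi)) '' S → False := by
    intro a b hab ha hb
    have hab' : (a : ℝ) + 1 ≤ b := by exact_mod_cast hab
    have : (a : ℝ) + 1 / 2 ∈ (fun z => (g₁ z - g₂ z).im / (2 * Real.pi)) '' S :=
      hord.out ha hb ⟨by linarith, by linarith⟩
    obtain ⟨w, hw, hwv⟩ := this
    obtain ⟨k, hk⟩ := hinter w hw
    have := hval w k hk
    simp only at hwv
    rw [this] at hwv
    have h1 : (a : ℝ) < k := by linarith
    have h2 : (k : ℝ) < a + 1 := by linarith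
    have h3 : a < k := by exact_mod_cast h1
    have h4 : k < a + 1 := by exact_mod_cast h2
    omega
  rcases lt_or_gt_of_ne hne with hl | hl
  · exact hlt _ _ hl m1 m0
  · exact hlt _ _ hl m0 m1

/-- Gluing logarithms. -/
lemma log_glue {X : Type*} [TopologicalSpace X] (A B : Set X) (hA : IsClosed A) (hB : IsClosed B)
    (hAB : IsPreconnected (A ∩ B)) (f : X → ℂ)
    (h1 : ∃ g : X → ℂ, ContinuousOn g A ∧ ∀ z ∈ A, f z = Complex.exp (g z))
    (h2 : ∃ g : X → ℂ, ContinuousOn g B ∧ ∀ z ∈ B, f z = Complex.exp (g z)) :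
    ∃ g : X → ℂ, ContinuousOn g (A ∪ B) ∧ ∀ z ∈ A ∪ B, f z = Complex.exp (g z) := by
  classical
  obtain ⟨g₁, c1, e1⟩ := h1
  obtain ⟨g₂, c2, e2⟩ := h2
  obtain ⟨c, hc, hcc⟩ := log_diff_const (A ∩ B) hAB g₁ g₂ (c1.mono inter_subset_left)
    (c2.mono inter_subset_right) (fun z hz => by rw [← e1 z hz.1, ← e2 z hz.2])
  refine ⟨fun z => if z ∈ A then g₁ z else g₂ z + c, ?_, ?_⟩
  · apply ContinuousOn.union_of_isClosed _ _ hA hB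
    · exact c1.congr (fun z hz => by simp [hz])
    · refine (c2.add (continuousOn_const (c := c))).congr (fun z hz => ?_)
      by_cases hzA : z ∈ A
      · simp [hzA, hcc z ⟨hzA, hz⟩]
      · simp [hzA]
  · intro z hz
    by_cases hzA : z ∈ A
    · simp [hzA, e1 z hzA]
    · have hzB : z ∈ B := hz.resolve_left hzA
      simp [hzA, Complex.exp_add, hc, e2 z hzB]

/-- `z - p` has no continuous logarithm on a circle around `0` enclosing `p`. -/
lemma no_log_circle (p : ℂ) (R : ℝ) (hR : ‖p‖ < R) (g : ℂ → ℂ)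
    (hg : ContinuousOn g (Metric.closedBall 0 R))
    (h : ∀ z, ‖z‖ = R → z - p = Complex.exp (g z)) : False := by
  have hRpos : 0 < R := lt_of_le_of_lt (norm_nonneg _) hR
  -- first, compare with `z`
  let γ : ℝ → ℂ := fun t => R * Complex.exp (t * Complex.I)
  have hγ : Continuous γ := by fun_prop
  have hγn : ∀ t, ‖γ t‖ = R := by
    intro t
    simp [γ, Complex.norm_exp_ofReal_mul_I, abs_of_pos hRpos]
  have hγ0 : ∀ t, γ t ≠ 0 := by
    intro t ht
    have := hγn t
    rw [ht, norm_zero] at this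
    exact hRpos.ne this
  have hsl : ∀ t, (γ t - p) / γ t ∈ Complex.slitPlane := by
    intro t
    have : ‖(γ t - p) / γ t - 1‖ < 1 := by
      rw [div_sub_one (hγ0 t), norm_div, hγn, div_lt_one hRpos]
      simpa using hR
    simpa using Complex.mem_slitPlane_of_norm_lt_one this
  let k : ℝ → ℂ := fun t => g (γ t) - Complex.log ((γ t - p) / γ t)
  have hk : Continuous k := by
    apply Continuous.sub
    · exact hg.comp_continuous hγ (fun t => by simp [hγn])
    · exact Continuous.clog ((hγ.sub continuous_const).div hγ hγ0) hsl
  have hke : ∀ t ∈ (univ : Set ℝ), Complex.exp (k t) = Complex.exp (Complex.log R + t * Complex.I) := by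
    intro t _
    have hRc : (R : ℂ) ≠ 0 := by exact_mod_cast hRpos.ne'
    rw [Complex.exp_sub, Complex.exp_add, Complex.exp_log hRc, ← h _ (hγn t),
      Complex.exp_log (Complex.slitPlane_ne_zero (hsl t)), div_div_cancel₀]
    exact Complex.slitPlane_ne_zero (hsl t) |> fun h => (div_ne_zero_iff.1 h).1
  obtain ⟨c, _, hcc⟩ := log_diff_const univ isPreconnected_univ k
    (fun t => Complex.log R + t * Complex.I) hk.continuousOn (by fun_prop) hke
  have e0 := hcc 0 trivial
  have e1 := hcc (2 * Real.pi) trivial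
  have hγe : γ (2 * Real.pi) = γ 0 := by
    simp [γ, Complex.exp_two_pi_mul_I]
  have hkk : k (2 * Real.pi) = k 0 := by simp only [k, hγe]
  rw [hkk, e0] at e1
  have := congrArg Complex.im e1
  simp at this

end

section
/-- The unbounded part of the complement of a set. -/
def outerOf (K : Set (ℝ × ℝ)) : Set (ℝ × ℝ) :=
  {p : ℝ × ℝ | p ∉ K ∧ ¬ Bornology.IsBounded (connectedComponentIn Kᶜ p)}

lemma isPreconnected_far (R : ℝ) (hR : 0 ≤ R) :
    IsPreconnected {z : ℝ × ℝ | R < ‖z‖} := by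
  have h0 : IsPreconnected ({0}ᶜ : Set (ℝ × ℝ)) :=
    (isConnected_compl_singleton_of_one_lt_rank (by simp; norm_num) 0).isPreconnected
  have : {z : ℝ × ℝ | R < ‖z‖} = (fun z : ℝ × ℝ => (1 + R / ‖z‖) • z) '' {0}ᶜ := by
    ext z
    constructor
    · intro hz
      have hz : R < ‖z‖ := hz
      have hzp : 0 < ‖z‖ := lt_of_le_of_lt hR hz
      refine ⟨((‖z‖ - R) / ‖z‖) • z, ?_, ?_⟩
      · have : z ≠ 0 := norm_pos_iff.1 hzp
        have h2 : (‖z‖ - R) / ‖z‖ ≠ 0 := (div_pos (by linarith) hzp).ne'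
        simp [this, h2]
      · simp only
        have h3 : 0 < ‖z‖ - R := by linarith
        rw [norm_smul, Real.norm_of_nonneg (div_nonneg h3.le hzp.le), smul_smul]
        have : (1 + R / ((‖z‖ - R) / ‖z‖ * ‖z‖)) * ((‖z‖ - R) / ‖z‖) = 1 := by
          field_simp
          ring
        rw [this, one_smul]
    · rintro ⟨w, hw, rfl⟩
      have hw0 : 0 < ‖w‖ := norm_pos_iff.2 hw
      show R < ‖(1 + R / ‖w‖) • w‖
      rw [norm_smul, Real.norm_of_nonneg (by positivity)]
      have : (1 + R / ‖w‖) * ‖w‖ = ‖w‖ + R := by field_simp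
      linarith
  rw [this]
  apply h0.image
  refine ContinuousOn.smul (f := fun z : ℝ × ℝ => 1 + R / ‖z‖) (g := fun z => z) ?_ continuousOn_id
  apply continuousOn_const.add
  exact continuousOn_const.div continuous_norm.continuousOn (fun z hz => norm_ne_zero_iff.2 hz)

lemma SC_of_outer {K : Set (ℝ × ℝ)} (hK : Bornology.IsBounded K) {p q : ℝ × ℝ}
    (hp : p ∈ outerOf K) (hq : q ∈ outerOf K) : SC K p q := by
  obtain ⟨M, hM⟩ := hK.exists_norm_le
  set R := max M 0
  have hfar : {z : ℝ × ℝ | R < ‖z‖} ⊆ Kᶜ := by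
    intro z hz hzK
    have := hM z hzK
    have h2 : R < ‖z‖ := hz
    have : M ≤ R := le_max_left _ _
    linarith
  have key : ∀ p ∈ outerOf K, ∃ z, R < ‖z‖ ∧ SC K p z := by
    intro p hp
    by_contra hcon
    push Not at hcon
    apply hp.2
    refine (Metric.isBounded_iff_subset_closedBall 0).2 ⟨R, ?_⟩
    intro z hz
    by_contra hzR
    simp at hzR
    exact hcon z hzR (SC_iff.2 hz)
  obtain ⟨z, hz, hpz⟩ := key p hp
  obtain ⟨w, hw, hqw⟩ := key q hq
  exact hpz.trans (SC.trans ⟨_, isPreconnected_far R (le_max_right _ _), hfar, hz, hw⟩ hqw.symm)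

lemma outerOf_of_SC {K : Set (ℝ × ℝ)} {p q : ℝ × ℝ} (hp : p ∈ outerOf K) (h : SC K p q) :
    q ∈ outerOf K := by
  refine ⟨h.right, ?_⟩
  rw [← connectedComponentIn_eq (SC_iff.1 h)]
  exact hp.2

lemma outerOf_anti {K K' : Set (ℝ × ℝ)} (h : K' ⊆ K) : outerOf K ⊆ outerOf K' := by
  intro p hp
  refine ⟨fun h' => hp.1 (h h'), fun hb => hp.2 (hb.subset ?_)⟩
  exact connectedComponentIn_mono _ (compl_subset_compl.2 h)

lemma SC_open {K : Set (ℝ × ℝ)} (hK : IsClosed K) (p : ℝ × ℝ) : IsOpen {q | SC K p q} := by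
  have : {q | SC K p q} = connectedComponentIn Kᶜ p := by ext q; exact SC_iff
  rw [this]
  exact hK.isOpen_compl.connectedComponentIn

lemma SC_connected (K : Set (ℝ × ℝ)) (p : ℝ × ℝ) : IsPreconnected {q | SC K p q} := by
  have : {q | SC K p q} = connectedComponentIn Kᶜ p := by ext q; exact SC_iff
  rw [this]
  exact isPreconnected_connectedComponentIn

/-- Points near `p ∉ K` are in the same component. -/
lemma SC_nhds {K : Set (ℝ × ℝ)} (hK : IsClosed K) {p : ℝ × ℝ} (hp : p ∉ K) :
    {q | SC K p q} ∈ nhds p := (SC_open hK p).mem_nhds (SC.refl hp)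

/-- The frontier of a component of the complement lies in the set. -/
lemma SC_frontier {K : Set (ℝ × ℝ)} (hK : IsClosed K) (p : ℝ × ℝ) :
    frontier {q | SC K p q} ⊆ K := by
  intro z hz
  by_contra hzK
  rw [(SC_open hK p).frontier_eq] at hz
  obtain ⟨w, hw1, hw2⟩ := mem_closure_iff_nhds.1 hz.1 _ (SC_nhds hK hzK)
  exact hz.2 (SC.trans hw2 (SC.symm hw1))

/-- A connected set meeting `U` but not its frontier stays in `U`. -/
lemma subset_of_frontier_disjoint {U S : Set (ℝ × ℝ)} (hU : IsOpen U) (hS : IsPreconnected S)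
    (hne : (S ∩ U).Nonempty) (hd : Disjoint S (frontier U)) : S ⊆ U := by
  intro x hx
  by_contra hxU
  have h2 : x ∈ (closure U)ᶜ := by
    intro hc
    exact hd.le_bot ⟨hx, by rw [hU.frontier_eq]; exact ⟨hc, hxU⟩⟩
  obtain ⟨y, hyS, hyU, hyV⟩ := hS U (closure U)ᶜ hU isClosed_closure.isOpen_compl
    (by
      intro y hy
      by_cases hyU : y ∈ U
      · exact Or.inl hyU
      · right
        intro hc
        exact hd.le_bot ⟨hy, by rw [hU.frontier_eq]; exact ⟨hc, hyU⟩⟩)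
    hne ⟨x, hx, h2⟩
  exact hyV (subset_closure hyU)

/-- Existence of a logarithm of the quotient `(z - p) / (z - q)` on `K`. -/
def QLog (K : Set (ℝ × ℝ)) (p q : ℝ × ℝ) : Prop :=
  ∃ g : ℝ × ℝ → ℂ, ContinuousOn g K ∧
    ∀ z ∈ K, (toC z - toC p) / (toC z - toC q) = Complex.exp (g z)

lemma toC_sub_ne {K : Set (ℝ × ℝ)} {p z : ℝ × ℝ} (hp : p ∉ K) (hz : z ∈ K) :
    toC z - toC p ≠ 0 := by
  intro h
  exact hp (toC_injective (sub_eq_zero.1 h) ▸ hz)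

lemma QLog_bounded_aux {K : Set (ℝ × ℝ)} (hK : IsCompact K) {p q : ℝ × ℝ}
    (hp : p ∉ K) (hq : q ∉ K) (h : QLog K p q) (hns : ¬ SC K p q)
    (hb : Bornology.IsBounded {x | SC K p x}) : False := by
  classical
  obtain ⟨g, hg, hge⟩ := h
  obtain ⟨G, hG⟩ := ContinuousMap.exists_restrict_eq hK.isClosed
    (⟨K.domRestrict g, hg.domRestrict⟩ : C(K, ℂ))
  have hGK : ∀ z ∈ K, G z = g z := fun z hz => by
    have := congrArg (fun F : C(K, ℂ) => F ⟨z, hz⟩) hG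
    exact this
  set U : Set (ℝ × ℝ) := {x | SC K p x} with hU
  have hpU : p ∈ U := SC.refl hp
  let H : ℝ × ℝ → ℂ := fun z =>
    if z ∈ U then (toC z - toC q) * Complex.exp (G z) else toC z - toC p
  have hH : Continuous H := by
    apply Continuous.if
    · intro z hz
      have hzK : z ∈ K := SC_frontier hK.isClosed p hz
      rw [hGK z hzK, ← hge z hzK, mul_div_cancel₀ _ (toC_sub_ne hq hzK)]
    · exact (toC_continuous.sub continuous_const).mul (Complex.continuous_exp.comp G.continuous)
    · exact toC_continuous.sub continuous_const
  have hH0 : ∀ z, H z ≠ 0 := by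
    intro z
    by_cases hz : z ∈ U
    · simp only [H, hz, if_true]
      refine mul_ne_zero (fun h => hns ?_) (Complex.exp_ne_zero _)
      rw [← toC_injective (sub_eq_zero.1 h)]
      exact hz
    · simp only [H, hz, if_false]
      intro h
      exact hz (toC_injective (sub_eq_zero.1 h) ▸ hpU)
  let e := Complex.equivRealProdCLM
  have hte : ∀ w : ℂ, toC (e w) = w := fun w => e.symm_apply_apply w
  have hbi : Bornology.IsBounded (toC '' U) := by
    have : toC '' U ⊆ toC '' closure U := image_mono subset_closure
    refine Bornology.IsBounded.subset ?_ this
    exact (hb.isCompact_closure.image toC_continuous).isBounded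
  obtain ⟨M, hM⟩ := hbi.exists_norm_le
  set R := M + 1
  have hpR : ‖toC p‖ < R := by
    have := hM _ ⟨p, hpU, rfl⟩
    linarith
  obtain ⟨k, hk, hke⟩ := exists_log_star (Metric.closedBall (0 : ℂ) R) (isCompact_closedBall _ _)
    (by
      intro z hz t ht0 ht1
      simp only [mem_closedBall_zero_iff] at hz ⊢
      rw [norm_smul, Real.norm_of_nonneg ht0]
      nlinarith [norm_nonneg z])
    (fun w => H (e w)) (hH.comp e.continuous).continuousOn (fun z _ => hH0 _)
  refine no_log_circle (toC p) R hpR k hk (fun z hz => ?_)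
  rw [← hke z (by simp [hz])]
  have : e z ∉ U := by
    intro h
    have := hM _ ⟨_, h, rfl⟩
    rw [hte, hz] at this
    linarith
  simp only [H, this, if_false, hte]

lemma QLog.symm {K : Set (ℝ × ℝ)} {p q : ℝ × ℝ} (h : QLog K p q) : QLog K q p := by
  obtain ⟨g, hg, hge⟩ := h
  refine ⟨fun z => - g z, hg.neg, fun z hz => ?_⟩
  rw [Complex.exp_neg, ← hge z hz, inv_div]

lemma SC_of_QLog {K : Set (ℝ × ℝ)} (hK : IsCompact K) {p q : ℝ × ℝ}
    (hp : p ∉ K) (hq : q ∉ K) (h : QLog K p q) : SC K p q := by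
  by_contra hns
  have hset : ∀ p, {x | SC K p x} = connectedComponentIn Kᶜ p := fun p => by ext q; exact SC_iff
  by_cases hb : Bornology.IsBounded {x | SC K p x}
  · exact QLog_bounded_aux hK hp hq h hns hb
  by_cases hb' : Bornology.IsBounded {x | SC K q x}
  · exact QLog_bounded_aux hK hq hp h.symm (fun h => hns h.symm) hb'
  rw [hset] at hb hb'
  exact hns (SC_of_outer hK.isBounded ⟨hp, hb⟩ ⟨hq, hb'⟩)

lemma QLog_of_SC {K : Set (ℝ × ℝ)} (hK : IsCompact K) {p q : ℝ × ℝ} (h : SC K p q) :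
    QLog K p q := by
  obtain ⟨S, hS, hSK, hpS, hqS⟩ := h
  refine hS.induction₂ (QLog K) ?_ ?_ ?_ hpS hqS
  · intro x hx
    have hxK := hSK hx
    rcases K.eq_empty_or_nonempty with rfl | hne
    · exact Filter.Eventually.of_forall fun y => ⟨fun _ => 0, by simp, by simp⟩
    -- minimal distance in the complex plane
    obtain ⟨z0, hz0, hmin⟩ := hK.exists_isMinOn hne
      (f := fun z => ‖toC z - toC x‖) (toC_continuous.sub continuous_const).norm.continuousOn
    have hpos : 0 < ‖toC z0 - toC x‖ := norm_pos_iff.2 (toC_sub_ne hxK hz0)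
    have hev : ∀ᶠ y in nhds x, ‖toC x - toC y‖ < ‖toC z0 - toC x‖ := by
      have : Continuous fun y => ‖toC x - toC y‖ := (continuous_const.sub toC_continuous).norm
      refine this.continuousAt.eventually_lt continuousAt_const ?_
      simpa using hpos
    have hloc : ∀ᶠ y in nhds x, QLog K y x := by
      filter_upwards [hev] with y hy
      refine ⟨fun z => Complex.log ((toC z - toC y) / (toC z - toC x)), ?_, ?_⟩
      · apply ContinuousOn.clog
        · exact ((toC_continuous.sub continuous_const).continuousOn).div
            ((toC_continuous.sub continuous_const).continuousOn) (fun z hz => toC_sub_ne hxK hz)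
        · intro z hz
          have hne0 := toC_sub_ne hxK hz
          have : ‖(toC z - toC y) / (toC z - toC x) - 1‖ < 1 := by
            rw [div_sub_one hne0, norm_div, div_lt_one (norm_pos_iff.2 hne0)]
            have : toC z - toC y - (toC z - toC x) = toC x - toC y := by ring
            rw [this]
            exact lt_of_lt_of_le hy (hmin hz)
          simpa using Complex.mem_slitPlane_of_norm_lt_one this
      · intro z hz
        rw [Complex.exp_log]
        refine div_ne_zero ?_ (toC_sub_ne hxK hz)
        intro h0
        have h1 : toC z = toC y := sub_eq_zero.1 h0
        rw [← h1, ← norm_neg, neg_sub] at hy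
        exact absurd (hmin hz) (not_le.2 hy)
    refine (hloc.mono fun y hy => hy.symm).filter_mono nhdsWithin_le_nhds
  · intro x y z hx hy hz ⟨g, hg, hge⟩ ⟨k, hk, hke⟩
    refine ⟨fun w => g w + k w, hg.add hk, fun w hw => ?_⟩
    rw [Complex.exp_add, ← hge w hw, ← hke w hw, div_mul_div_cancel₀ (toC_sub_ne (hSK hy) hw)]
  · intro x y hx hy h
    exact h.symm

/-- Janiszewski's theorem. -/
theorem janiszewski {A B : Set (ℝ × ℝ)} (hA : IsCompact A) (hB : IsCompact B)
    (hAB : IsPreconnected (A ∩ B)) {p q : ℝ × ℝ} (h1 : SC A p q) (h2 : SC B p q) :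
    SC (A ∪ B) p q := by
  refine SC_of_QLog (hA.union hB) (fun h => h.elim h1.left h2.left)
    (fun h => h.elim h1.right h2.right) ?_
  exact log_glue A B hA.isClosed hB.isClosed hAB _ (QLog_of_SC hA h1) (QLog_of_SC hB h2)

/-- Compact sets on which every nonvanishing function has a logarithm. -/
def HasLogs (K : Set (ℝ × ℝ)) : Prop :=
  IsCompact K ∧ ∀ f : ℝ × ℝ → ℂ, ContinuousOn f K → (∀ z ∈ K, f z ≠ 0) →
    ∃ g : ℝ × ℝ → ℂ, ContinuousOn g K ∧ ∀ z ∈ K, f z = Complex.exp (g z)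

lemma HasLogs.union {A B : Set (ℝ × ℝ)} (hA : HasLogs A) (hB : HasLogs B)
    (h : IsPreconnected (A ∩ B)) : HasLogs (A ∪ B) := by
  refine ⟨hA.1.union hB.1, fun f hf h0 => ?_⟩
  exact log_glue A B hA.1.isClosed hB.1.isClosed h f
    (hA.2 f (hf.mono subset_union_left) (fun z hz => h0 z (Or.inl hz)))
    (hB.2 f (hf.mono subset_union_right) (fun z hz => h0 z (Or.inr hz)))

lemma HasLogs.SC {K : Set (ℝ × ℝ)} (hK : HasLogs K) {p q : ℝ × ℝ} (hp : p ∉ K) (hq : q ∉ K) :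
    SC K p q := by
  refine SC_of_QLog hK.1 hp hq (hK.2 _ ?_ ?_)
  · exact ((toC_continuous.sub continuous_const).continuousOn).div
      ((toC_continuous.sub continuous_const).continuousOn) (fun z hz => toC_sub_ne hq hz)
  · intro z hz
    exact div_ne_zero (toC_sub_ne hp hz) (toC_sub_ne hq hz)

lemma HasLogs.singleton (p : ℝ × ℝ) : HasLogs {p} := by
  refine ⟨isCompact_singleton, fun f _ h0 => ⟨fun _ => Complex.log (f p), continuousOn_const, ?_⟩⟩
  rintro z rfl
  rw [Complex.exp_log (h0 _ rfl)]

/-- Subarcs of injective paths have logarithms. -/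
lemma HasLogs.arc (γ : unitInterval → ℝ × ℝ) (hγ : Continuous γ) (hinj : Function.Injective γ)
    (s t : unitInterval) : HasLogs (γ '' Icc s t) := by
  rcases le_or_gt s t with hst | hst
  swap
  · rw [Icc_eq_empty (not_le.2 hst), image_empty]
    exact ⟨isCompact_empty, fun f _ _ => ⟨fun _ => 0, by simp, by simp⟩⟩
  refine ⟨isCompact_Icc.image hγ, fun f hf h0 => ?_⟩
  have hemb : Topology.IsEmbedding γ := (hγ.isClosedEmbedding hinj).isEmbedding
  let c : ℝ → unitInterval := fun x =>
    (projIcc s t hst (projIcc 0 1 zero_le_one x : unitInterval) : Icc s t)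
  have hc : Continuous c := continuous_subtype_val.comp (continuous_projIcc.comp continuous_projIcc)
  have hcm : ∀ x, c x ∈ Icc s t := fun x => (projIcc s t hst _).2
  obtain ⟨g, hg, hge⟩ := exists_log_star (Icc (0 : ℝ) 1) isCompact_Icc
    (by
      intro z hz r h0 h1
      simp only [smul_eq_mul, mem_Icc] at hz ⊢
      constructor <;> nlinarith)
    (fun x => f (γ (c x)))
    (by
      apply Continuous.continuousOn
      exact hf.comp_continuous (hγ.comp hc) (fun x => ⟨_, hcm x, rfl⟩))
    (fun x _ => h0 _ ⟨_, hcm x, rfl⟩)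
  have hcid : ∀ x ∈ Icc s t, c (x : ℝ) = x := by
    intro x hx
    simp only [c]
    rw [projIcc_of_mem zero_le_one x.2]
    rw [projIcc_of_mem hst hx]
  refine ⟨fun z => g ((Function.invFun γ z : unitInterval) : ℝ), ?_, ?_⟩
  · have hinv : ContinuousOn (Function.invFun γ) (range γ) := by
      rw [continuousOn_iff_continuous_domRestrict]
      have : (range γ).domRestrict (Function.invFun γ) = hemb.toHomeomorph.symm := by
        ext ⟨z, x, rfl⟩
        have h1 : hemb.toHomeomorph.symm ⟨γ x, x, rfl⟩ = x := by
          rw [Homeomorph.symm_apply_eq]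
          rfl
        have h2 : Function.invFun γ (γ x) = x := Function.leftInverse_invFun hinj x
        exact congrArg Subtype.val (h2.trans h1.symm)
      rw [this]
      exact hemb.toHomeomorph.symm.continuous
    refine hg.comp (continuous_subtype_val.comp_continuousOn (hinv.mono (image_subset_range _ _))) ?_
    intro z _
    exact (Function.invFun γ z).2
  · rintro z ⟨x, hx, rfl⟩
    simp only
    rw [Function.leftInverse_invFun hinj x, ← hge _ x.2, hcid x hx]

end

section
/-! Part II: point sets of plane drawings -/

namespace Drawing

variable {V : Type} {G : SimpleGraph V} (D : Drawing G)

/-- The point set of the subdrawing induced by a set of vertices. -/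
def subSet (W : Set V) : Set (ℝ × ℝ) :=
  D.pos '' W ∪ {p | ∃ x ∈ W, ∃ y ∈ W, ∃ h : G.Adj x y, p ∈ D.arcSet h}

lemma arcSet_eq_image {u v : V} (h : G.Adj u v) : D.arcSet h = ⇑(D.arc h) '' Icc 0 1 := by
  ext p
  constructor
  · rintro ⟨t, rfl⟩
    exact ⟨t, ⟨t.2.1, t.2.2⟩, rfl⟩
  · rintro ⟨t, _, rfl⟩
    exact ⟨t, rfl⟩

lemma arcSet_symm {u v : V} (h : G.Adj u v) : D.arcSet h.symm = D.arcSet h := by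
  unfold arcSet
  rw [D.arc_symm h, Path.symm_range]

lemma arc_continuous {u v : V} (h : G.Adj u v) : Continuous ⇑(D.arc h) := (D.arc h).continuous

lemma arcSet_compact {u v : V} (h : G.Adj u v) : IsCompact (D.arcSet h) :=
  isCompact_range (D.arc_continuous h)

lemma arcSet_hasLogs {u v : V} (h : G.Adj u v) : HasLogs (D.arcSet h) := by
  rw [arcSet_eq_image]
  exact HasLogs.arc _ (D.arc_continuous h) (D.arc_inj h) 0 1

lemma arcSet_preconnected {u v : V} (h : G.Adj u v) : IsPreconnected (D.arcSet h) :=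
  isPreconnected_range (D.arc_continuous h)

lemma left_mem_arcSet {u v : V} (h : G.Adj u v) : D.pos u ∈ D.arcSet h := ⟨0, (D.arc h).source⟩

lemma right_mem_arcSet {u v : V} (h : G.Adj u v) : D.pos v ∈ D.arcSet h := ⟨1, (D.arc h).target⟩

lemma pos_mem_arcSet {u v w : V} (h : G.Adj u v) (hw : D.pos w ∈ D.arcSet h) : w = u ∨ w = v := by
  obtain ⟨t, ht⟩ := hw
  rcases D.arc_vertex h t w ht with rfl | rfl
  · left; rw [(D.arc h).source] at ht; exact D.pos_inj ht.symm
  · right; rw [(D.arc h).target] at ht; exact D.pos_inj ht.symm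

lemma arc_inter (hp : D.IsPlane) {u v x y : V} (h₁ : G.Adj u v) (h₂ : G.Adj x y)
    (hne : s(u, v) ≠ s(x, y)) {p : ℝ × ℝ} (hp1 : p ∈ D.arcSet h₁) (hp2 : p ∈ D.arcSet h₂) :
    ∃ w, p = D.pos w ∧ (w = u ∨ w = v) ∧ (w = x ∨ w = y) := by
  have key : ∀ w, p = D.pos w → ∃ w, p = D.pos w ∧ (w = u ∨ w = v) ∧ (w = x ∨ w = y) := by
    rintro w rfl
    exact ⟨w, rfl, D.pos_mem_arcSet h₁ hp1, D.pos_mem_arcSet h₂ hp2⟩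
  obtain ⟨t, ht⟩ := hp1
  obtain ⟨s, hs⟩ := hp2
  by_cases ht0 : t = 0
  · subst ht0; exact key u (by rw [← ht, (D.arc h₁).source])
  by_cases ht1 : t = 1
  · subst ht1; exact key v (by rw [← ht, (D.arc h₁).target])
  by_cases hs0 : s = 0
  · subst hs0; exact key x (by rw [← hs, (D.arc h₂).source])
  by_cases hs1 : s = 1
  · subst hs1; exact key y (by rw [← hs, (D.arc h₂).target])
  exact absurd ⟨u, v, x, y, h₁, h₂, hne, ⟨t, ⟨ht0, ht1⟩, ht⟩, ⟨s, ⟨hs0, hs1⟩, hs⟩⟩ (hp p)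

lemma arcSet_congr {u v x y : V} (h₁ : G.Adj u v) (h₂ : G.Adj x y) (he : s(u, v) = s(x, y)) :
    D.arcSet h₁ = D.arcSet h₂ := by
  rcases Sym2.eq_iff.1 he with ⟨rfl, rfl⟩ | ⟨rfl, rfl⟩
  · rfl
  · exact (D.arcSet_symm h₁).symm

lemma walkSet_nil (u : V) : D.walkSet (SimpleGraph.Walk.nil : G.Walk u u) = {D.pos u} := by
  ext p
  simp [walkSet, eq_comm]

lemma walkSet_cons {u v w : V} (h : G.Adj u v) (W : G.Walk v w) :
    D.walkSet (SimpleGraph.Walk.cons h W) = D.arcSet h ∪ D.walkSet W := by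
  ext p
  simp only [walkSet, mem_union, mem_image, mem_iUnion, SimpleGraph.Walk.support_cons,
    SimpleGraph.Walk.darts_cons, List.mem_cons, mem_setOf_eq]
  constructor
  · rintro (⟨x, rfl | hx, rfl⟩ | ⟨d, rfl | hd, hpd⟩)
    · exact Or.inl (D.left_mem_arcSet h)
    · exact Or.inr (Or.inl ⟨x, hx, rfl⟩)
    · exact Or.inl hpd
    · exact Or.inr (Or.inr ⟨d, hd, hpd⟩)
  · rintro (hp | ⟨x, hx, rfl⟩ | ⟨d, hd, hpd⟩)
    · exact Or.inr ⟨_, Or.inl rfl, hp⟩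
    · exact Or.inl ⟨x, Or.inr hx, rfl⟩
    · exact Or.inr ⟨d, Or.inr hd, hpd⟩

lemma pos_mem_walkSet {u v w : V} (W : G.Walk u v) : D.pos w ∈ D.walkSet W ↔ w ∈ W.support := by
  induction W with
  | nil =>
    rw [walkSet_nil]
    simp [D.pos_inj.eq_iff]
  | cons h W ih =>
    rw [walkSet_cons, SimpleGraph.Walk.support_cons, List.mem_cons, mem_union, ih]
    constructor
    · rintro (h1 | h1)
      · rcases D.pos_mem_arcSet h h1 with rfl | rfl
        · exact Or.inl rfl
        · exact Or.inr W.start_mem_support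
      · exact Or.inr h1
    · rintro (rfl | h1)
      · exact Or.inl (D.left_mem_arcSet h)
      · exact Or.inr h1

lemma walkSet_append {u v w : V} (W : G.Walk u v) (W' : G.Walk v w) :
    D.walkSet (W.append W') = D.walkSet W ∪ D.walkSet W' := by
  induction W with
  | nil =>
    rw [walkSet_nil, SimpleGraph.Walk.nil_append, eq_comm, union_eq_right, singleton_subset_iff]
    exact (D.pos_mem_walkSet W').2 W'.start_mem_support
  | cons h W ih => rw [SimpleGraph.Walk.cons_append, walkSet_cons, walkSet_cons, ih, union_assoc]

lemma walkSet_single {u v : V} (h : G.Adj u v) :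
    D.walkSet (SimpleGraph.Walk.cons h SimpleGraph.Walk.nil) = D.arcSet h := by
  rw [walkSet_cons, walkSet_nil, union_eq_left, singleton_subset_iff]
  exact D.right_mem_arcSet h

lemma walkSet_reverse {u v : V} (W : G.Walk u v) : D.walkSet W.reverse = D.walkSet W := by
  induction W with
  | nil => rfl
  | cons h W ih =>
    rw [SimpleGraph.Walk.reverse_cons, walkSet_append, walkSet_single, walkSet_cons, ih, arcSet_symm,
      union_comm]

lemma walkSet_compact {u v : V} (W : G.Walk u v) : IsCompact (D.walkSet W) := by
  induction W with
  | nil => rw [walkSet_nil]; exact isCompact_singleton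
  | cons h W ih => rw [walkSet_cons]; exact (D.arcSet_compact h).union ih

lemma walkSet_preconnected {u v : V} (W : G.Walk u v) : IsPreconnected (D.walkSet W) := by
  induction W with
  | nil => rw [walkSet_nil]; exact isPreconnected_singleton
  | cons h W ih =>
    rw [walkSet_cons]
    exact IsPreconnected.union _ (D.right_mem_arcSet h)
      ((D.pos_mem_walkSet W).2 W.start_mem_support) (D.arcSet_preconnected h) ih

lemma mem_walkSet {u v : V} (W : G.Walk u v) {p : ℝ × ℝ} (hp : p ∈ D.walkSet W) :
    (∃ w ∈ W.support, p = D.pos w) ∨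
      ∃ x y, ∃ h : G.Adj x y, s(x, y) ∈ W.edges ∧ p ∈ D.arcSet h := by
  rcases hp with ⟨w, hw, rfl⟩ | hp
  · exact Or.inl ⟨w, hw, rfl⟩
  · simp only [mem_iUnion] at hp
    obtain ⟨d, hd, hp⟩ := hp
    exact Or.inr ⟨_, _, d.adj, List.mem_map.2 ⟨d, hd, rfl⟩, hp⟩

lemma arcSet_subset_walkSet {u v x y : V} (W : G.Walk u v) (h : G.Adj x y)
    (he : s(x, y) ∈ W.edges) : D.arcSet h ⊆ D.walkSet W := by
  obtain ⟨d, hd, hde⟩ := List.mem_map.1 he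
  have : D.arcSet h = D.arcSet d.adj := D.arcSet_congr _ _ hde.symm
  rw [this]
  intro p hp
  right
  simp only [mem_iUnion]
  exact ⟨d, hd, hp⟩

lemma arc_walk_inter (hp : D.IsPlane) {u v x y : V} (h : G.Adj x y) (W : G.Walk u v)
    (he : s(x, y) ∉ W.edges) {p : ℝ × ℝ} (hp1 : p ∈ D.arcSet h) (hp2 : p ∈ D.walkSet W) :
    ∃ w, p = D.pos w ∧ (w = x ∨ w = y) ∧ w ∈ W.support := by
  rcases D.mem_walkSet W hp2 with ⟨w, hw, rfl⟩ | ⟨a, b, hab, hmem, hpab⟩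
  · exact ⟨w, rfl, D.pos_mem_arcSet h hp1, hw⟩
  · obtain ⟨w, rfl, h1, h2⟩ := D.arc_inter hp h hab (by rintro h; exact he (h ▸ hmem)) hp1 hpab
    exact ⟨w, rfl, h1, (D.pos_mem_walkSet W).1 hp2⟩

lemma walk_inter (hp : D.IsPlane) {u v x y : V} (W : G.Walk u v) (W' : G.Walk x y)
    (he : ∀ e ∈ W.edges, e ∉ W'.edges) {p : ℝ × ℝ} (hp1 : p ∈ D.walkSet W)
    (hp2 : p ∈ D.walkSet W') : ∃ w, p = D.pos w ∧ w ∈ W.support ∧ w ∈ W'.support := by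
  rcases D.mem_walkSet W hp1 with ⟨w, hw, rfl⟩ | ⟨a, b, hab, hmem, hpab⟩
  · exact ⟨w, rfl, hw, (D.pos_mem_walkSet W').1 hp2⟩
  · obtain ⟨w, rfl, h1, h2⟩ := D.arc_walk_inter hp hab W' (he _ hmem) hpab hp2
    exact ⟨w, rfl, (D.pos_mem_walkSet W).1 hp1, h2⟩

lemma walkSet_hasLogs (hp : D.IsPlane) {u v : V} (W : G.Walk u v) (hW : W.IsPath) :
    HasLogs (D.walkSet W) := by
  induction W with
  | nil => rw [walkSet_nil]; exact HasLogs.singleton _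
  | @cons a b c h W ih =>
    rw [SimpleGraph.Walk.cons_isPath_iff] at hW
    rw [walkSet_cons]
    refine (D.arcSet_hasLogs h).union (ih hW.1) (Set.Subsingleton.isPreconnected ?_)
    have : ∀ p ∈ D.arcSet h ∩ D.walkSet W, p = D.pos b := by
      rintro p ⟨h1, h2⟩
      obtain ⟨w, rfl, hw, hw'⟩ := D.arc_walk_inter hp h W
        (fun he => hW.2 (W.fst_mem_support_of_mem_edges he)) h1 h2
      rcases hw with rfl | rfl
      · exact absurd hw' hW.2
      · rfl
    intro p hp q hq
    rw [this p hp, this q hq]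

lemma walkSet_subset_graphSet {u v : V} (W : G.Walk u v) : D.walkSet W ⊆ D.graphSet := by
  intro p hp
  rcases D.mem_walkSet W hp with ⟨w, hw, rfl⟩ | ⟨a, b, hab, hmem, hpab⟩
  · exact Or.inl ⟨w, rfl⟩
  · right
    simp only [mem_iUnion]
    exact ⟨a, b, hab, hpab⟩

lemma subSet_subset_graphSet (W : Set V) : D.subSet W ⊆ D.graphSet := by
  rintro p (⟨w, _, rfl⟩ | ⟨x, _, y, _, h, hp⟩)
  · exact Or.inl ⟨w, rfl⟩
  · right
    simp only [mem_iUnion]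
    exact ⟨x, y, h, hp⟩

lemma graphSet_eq : D.graphSet = D.subSet univ := by
  apply Subset.antisymm _ (D.subSet_subset_graphSet _)
  rintro p (⟨w, rfl⟩ | hp)
  · exact Or.inl ⟨w, trivial, rfl⟩
  · simp only [mem_iUnion] at hp
    obtain ⟨x, y, h, hp⟩ := hp
    exact Or.inr ⟨x, trivial, y, trivial, h, hp⟩

lemma subSet_compact [Finite V] (W : Set V) : IsCompact (D.subSet W) := by
  apply IsCompact.union ((Set.toFinite W).image _).isCompact
  have : {p | ∃ x ∈ W, ∃ y ∈ W, ∃ h : G.Adj x y, p ∈ D.arcSet h} =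
      ⋃ (x : V) (y : V) (h : x ∈ W ∧ y ∈ W ∧ G.Adj x y), D.arcSet h.2.2 := by
    ext p
    simp only [mem_iUnion, mem_setOf_eq]
    constructor
    · rintro ⟨x, hx, y, hy, h, hp⟩
      exact ⟨x, y, ⟨hx, hy, h⟩, hp⟩
    · rintro ⟨x, y, ⟨hx, hy, h⟩, hp⟩
      exact ⟨x, hx, y, hy, h, hp⟩
  rw [this]
  exact isCompact_iUnion fun x => isCompact_iUnion fun y => isCompact_iUnion fun h =>
    D.arcSet_compact _

lemma graphSet_compact [Finite V] : IsCompact D.graphSet := by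
  rw [graphSet_eq]; exact D.subSet_compact _

lemma outerFace_eq : D.outerFace = outerOf D.graphSet := rfl

lemma outerFace_subset (W : Set V) : D.outerFace ⊆ outerOf (D.subSet W) := by
  rw [outerFace_eq]; exact outerOf_anti (D.subSet_subset_graphSet W)

lemma outerFace_SC [Finite V] {o : ℝ × ℝ} (ho : o ∈ D.outerFace) :
    D.outerFace = {q | SC D.graphSet o q} := by
  ext q
  constructor
  · intro hq
    exact SC_of_outer D.graphSet_compact.isBounded ho hq
  · intro hq
    exact outerOf_of_SC ho hq

lemma outerFace_open [Finite V] : IsOpen D.outerFace := by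
  rcases D.outerFace.eq_empty_or_nonempty with h | ⟨o, ho⟩
  · rw [h]; exact isOpen_empty
  · rw [D.outerFace_SC ho]; exact SC_open D.graphSet_compact.isClosed o

lemma outerFace_preconnected [Finite V] : IsPreconnected D.outerFace := by
  rcases D.outerFace.eq_empty_or_nonempty with h | ⟨o, ho⟩
  · rw [h]; exact isPreconnected_empty
  · rw [D.outerFace_SC ho]; exact SC_connected _ o

/-- Points of the frontier of the outer face not on `K` are joined to the outer face off `K`. -/
lemma SC_frontier_outer [Finite V] {K : Set (ℝ × ℝ)} (hK : K ⊆ D.graphSet) {o z : ℝ × ℝ}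
    (ho : o ∈ D.outerFace) (hz : z ∈ frontier D.outerFace) (hzK : z ∉ K) : SC K o z := by
  refine ⟨insert z D.outerFace, D.outerFace_preconnected.subset_closure (subset_insert _ _) ?_,
    ?_, Or.inr ho, Or.inl rfl⟩
  · exact insert_subset (frontier_subset_closure hz) subset_closure
  · rintro x (rfl | hx)
    · exact hzK
    · exact fun h => hx.1 (hK h)

/-- An inner point of an arc is joined to an endpoint off a set that meets the arc only in
vertex points, if that endpoint is not in the set. -/
lemma SC_arc {K : Set (ℝ × ℝ)} {x y : V} (h : G.Adj x y)
    (hK : ∀ p ∈ D.arcSet h, p ∈ K → p = D.pos y) {p : ℝ × ℝ} (hp : p ∈ D.arcSet h)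
    (hpy : p ≠ D.pos y) : SC K (D.pos x) p := by
  refine ⟨⇑(D.arc h) '' Iio 1, isPreconnected_Iio.image _ (D.arc_continuous h).continuousOn, ?_, ?_, ?_⟩
  · rintro _ ⟨t, ht, rfl⟩ hk
    have := hK _ ⟨t, rfl⟩ hk
    exact (ne_of_lt ht) (D.arc_inj h (this.trans (D.arc h).target.symm))
  · exact ⟨0, by simp, (D.arc h).source⟩
  · obtain ⟨t, rfl⟩ := hp
    refine ⟨t, ?_, rfl⟩
    refine lt_of_le_of_ne t.2.2 ?_
    intro h1
    apply hpy
    have : t = 1 := Subtype.ext h1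
    rw [this, (D.arc h).target]

end Drawing

end

section
lemma subsingleton_preconnected {S : Set (ℝ × ℝ)} (p : ℝ × ℝ) (h : ∀ z ∈ S, z = p) :
    IsPreconnected S := by
  apply Set.Subsingleton.isPreconnected
  intro x hx y hy
  rw [h x hx, h y hy]

namespace Drawing

variable {V : Type} {G : SimpleGraph V} (D : Drawing G)

/-- Three internally disjoint paths with the same ends, the first two bounding the outer face. -/
structure SplitHyp {u v : V} (A B Q : G.Walk u v) : Prop where
  plane : D.IsPlane
  hA : A.IsPath
  hB : B.IsPath
  hQ : Q.IsPath
  AB : ∀ x ∈ A.support, x ∈ B.support → x = u ∨ x = v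
  AQ : ∀ x ∈ A.support, x ∈ Q.support → x = u ∨ x = v
  BQ : ∀ x ∈ B.support, x ∈ Q.support → x = u ∨ x = v
  eA : s(u, v) ∉ A.edges
  eB : s(u, v) ∉ B.edges
  ind : ∀ x ∈ Q.support, ∀ y ∈ Q.support, G.Adj x y → s(x, y) ∈ Q.edges
  fr : frontier D.outerFace = D.walkSet A ∪ D.walkSet B

lemma edges_disj {u v u' v' : V} (A : G.Walk u v) (B : G.Walk u' v') {a b : V}
    (h : ∀ x ∈ A.support, x ∈ B.support → x = a ∨ x = b) (he : s(a, b) ∉ A.edges) :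
    ∀ e ∈ A.edges, e ∉ B.edges := by
  intro e
  induction e using Sym2.ind with
  | _ x y =>
    intro h1 h2
    have hxy : G.Adj x y := SimpleGraph.Walk.adj_of_mem_edges _ h1
    have hx := h x (A.fst_mem_support_of_mem_edges h1) (B.fst_mem_support_of_mem_edges h2)
    have hy := h y (A.snd_mem_support_of_mem_edges h1) (B.snd_mem_support_of_mem_edges h2)
    rcases hx with rfl | rfl <;> rcases hy with rfl | rfl
    · exact hxy.ne rfl
    · exact he h1
    · exact he (Sym2.eq_swap ▸ h1)
    · exact hxy.ne rfl

lemma exists_split {u v : V} (Q : G.Walk u v) (d : G.Dart) (hd : d ∈ Q.darts) :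
    ∃ (Q1 : G.Walk u d.fst) (Q2 : G.Walk d.snd v),
      Q = Q1.append (SimpleGraph.Walk.cons d.adj Q2) := by
  induction Q with
  | nil => simp at hd
  | @cons a b c h W ih =>
    rw [SimpleGraph.Walk.darts_cons, List.mem_cons] at hd
    rcases hd with rfl | hd
    · exact ⟨SimpleGraph.Walk.nil, W, rfl⟩
    · obtain ⟨Q1, Q2, hQ⟩ := ih hd
      exact ⟨SimpleGraph.Walk.cons h Q1, Q2, by rw [SimpleGraph.Walk.cons_append, ← hQ]⟩

lemma arcSet_subset_closure_Ioo {x y : V} (h : G.Adj x y) :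
    D.arcSet h ⊆ closure (⇑(D.arc h) '' Ioo 0 1) := by
  rintro _ ⟨t, rfl⟩
  have : closure (Ioo (0 : unitInterval) 1) = Icc 0 1 := closure_Ioo (by simp)
  exact image_closure_subset_closure_image (D.arc_continuous h)
    (mem_image_of_mem _ (this ▸ ⟨t.2.1, t.2.2⟩))

lemma walkSet_subset_of_inner {u v : V} (Q : G.Walk u v) (huv : u ≠ v) {S : Set (ℝ × ℝ)}
    (hS : IsClosed S)
    (h : ∀ d ∈ Q.darts, ∀ t : unitInterval, 0 < t → t < 1 → D.arc d.adj t ∈ S) :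
    D.walkSet Q ⊆ S := by
  have h' : ∀ d ∈ Q.darts, D.arcSet d.adj ⊆ S := by
    intro d hd
    refine (D.arcSet_subset_closure_Ioo d.adj).trans (closure_minimal ?_ hS)
    rintro _ ⟨t, ht, rfl⟩
    exact h d hd t ht.1 ht.2
  clear h
  rintro p (⟨w, hw, rfl⟩ | hp)
  · have : ∃ d ∈ Q.darts, w = d.fst ∨ w = d.snd := by
      clear h'
      induction Q with
      | nil => exact absurd rfl huv
      | @cons a b c h W ih =>
        rw [mem_setOf_eq, SimpleGraph.Walk.support_cons, List.mem_cons] at hw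
        rcases hw with rfl | hw
        · exact ⟨⟨(w, b), h⟩, by simp, Or.inl rfl⟩
        · by_cases hbc : b = c
          · subst hbc
            by_cases hwb : w = b
            · exact ⟨⟨(a, b), h⟩, by simp, Or.inr hwb⟩
            · cases W with
              | nil => simp at hw; exact absurd hw hwb
              | @cons _ b' _ h2 W2 =>
                have : ∀ {x y : V} (W : G.Walk x y), w ∈ W.support → w ≠ x →
                    ∃ d ∈ W.darts, w = d.fst ∨ w = d.snd := by
                  intro x y W
                  induction W with
                  | nil => intro h1 h2; simp at h1; exact absurd h1 h2
                  | @cons x z y h3 W3 ih3 =>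
                    intro h1 h2
                    rw [SimpleGraph.Walk.support_cons, List.mem_cons] at h1
                    by_cases hwz : w = z
                    · exact ⟨⟨(x, z), h3⟩, by simp, Or.inr hwz⟩
                    · obtain ⟨d, hd, hd'⟩ := ih3 (h1.resolve_left h2) hwz
                      exact ⟨d, by simp [hd], hd'⟩
                obtain ⟨d, hd, hd'⟩ := this _ hw hwb
                exact ⟨d, by rw [SimpleGraph.Walk.darts_cons]; exact List.mem_cons_of_mem _ hd, hd'⟩
          · obtain ⟨d, hd, hd'⟩ := ih hbc hw
            exact ⟨d, by simp [hd], hd'⟩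
    obtain ⟨d, hd, rfl | rfl⟩ := this
    · exact h' d hd (D.left_mem_arcSet _)
    · exact h' d hd (D.right_mem_arcSet _)
  · simp only [mem_iUnion] at hp
    obtain ⟨d, hd, hp⟩ := hp
    exact h' d hd hp

namespace SplitHyp

variable {D} {u v : V} {A B Q : G.Walk u v}

lemma symm (S : D.SplitHyp A B Q) : D.SplitHyp B A Q :=
  { plane := S.plane, hA := S.hB, hB := S.hA, hQ := S.hQ
    AB := fun x h1 h2 => S.AB x h2 h1
    AQ := S.BQ, BQ := S.AQ, eA := S.eB, eB := S.eA, ind := S.ind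
    fr := by rw [S.fr, union_comm] }

lemma a_q (S : D.SplitHyp A B Q) {z : ℝ × ℝ} (h1 : z ∈ D.walkSet A) (h2 : z ∈ D.walkSet Q) :
    z = D.pos u ∨ z = D.pos v := by
  obtain ⟨w, rfl, hw1, hw2⟩ := D.walk_inter S.plane A Q (edges_disj A Q S.AQ S.eA) h1 h2
  rcases S.AQ w hw1 hw2 with rfl | rfl
  · exact Or.inl rfl
  · exact Or.inr rfl

lemma a_b (S : D.SplitHyp A B Q) {z : ℝ × ℝ} (h1 : z ∈ D.walkSet A) (h2 : z ∈ D.walkSet B) :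
    z ∈ D.walkSet Q := by
  obtain ⟨w, rfl, hw1, hw2⟩ := D.walk_inter S.plane A B (edges_disj A B S.AB S.eA) h1 h2
  rcases S.AB w hw1 hw2 with rfl | rfl
  · exact (D.pos_mem_walkSet Q).2 Q.start_mem_support
  · exact (D.pos_mem_walkSet Q).2 Q.end_mem_support

lemma inter_eq (S : D.SplitHyp A B Q) :
    (D.walkSet A ∪ D.walkSet Q) ∩ (D.walkSet B ∪ D.walkSet Q) = D.walkSet Q := by
  ext z
  constructor
  · rintro ⟨h1 | h1, h2 | h2⟩
    · exact S.a_b h1 h2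
    · exact h2
    · exact h1
    · exact h1
  · intro h
    exact ⟨Or.inr h, Or.inr h⟩

lemma subA (S : D.SplitHyp A B Q) : D.walkSet A ∪ D.walkSet Q ⊆ D.graphSet :=
  union_subset (D.walkSet_subset_graphSet A) (D.walkSet_subset_graphSet Q)

lemma compA (S : D.SplitHyp A B Q) : IsCompact (D.walkSet A ∪ D.walkSet Q) :=
  (D.walkSet_compact A).union (D.walkSet_compact Q)

lemma f2 [Finite V] (S : D.SplitHyp A B Q) {o z : ℝ × ℝ} (ho : o ∈ D.outerFace)
    (hz : z ∈ D.walkSet A) (hz' : z ∉ D.walkSet Q) : SC (D.walkSet B ∪ D.walkSet Q) o z := by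
  refine D.SC_frontier_outer S.symm.subA ho (S.fr ▸ Or.inl hz) ?_
  rintro (h | h)
  · exact hz' (S.a_b hz h)
  · exact hz' h

lemma f3 [Finite V] (S : D.SplitHyp A B Q) {o z : ℝ × ℝ} (ho : o ∈ D.outerFace)
    (h1 : SC (D.walkSet A ∪ D.walkSet Q) o z) (h2 : SC (D.walkSet B ∪ D.walkSet Q) o z) :
    z ∈ D.outerFace := by
  have h := janiszewski S.compA S.symm.compA (by
    rw [S.inter_eq]; exact D.walkSet_preconnected Q) h1 h2
  obtain ⟨T, hT, hTK, hoT, hzT⟩ := h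
  refine subset_of_frontier_disjoint D.outerFace_open hT ⟨o, hoT, ho⟩ ?_ hzT
  rw [Set.disjoint_left]
  intro x hx hxf
  rw [S.fr] at hxf
  apply hTK hx
  rcases hxf with h | h
  · exact Or.inl (Or.inl h)
  · exact Or.inr (Or.inl h)

lemma g1 [Finite V] (S : D.SplitHyp A B Q) {o : ℝ × ℝ} (ho : o ∈ D.outerFace) {W : Set V}
    (hW : ∀ w ∈ W, ¬ SC (D.walkSet B ∪ D.walkSet Q) o (D.pos w)) {g : ℝ × ℝ}
    (hg : g ∈ D.subSet W) : ¬ SC (D.walkSet B ∪ D.walkSet Q) o g := by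
  rcases hg with ⟨w, hw, rfl⟩ | ⟨x, hx, y, hy, h, hg⟩
  · exact hW w hw
  intro hs
  have hgn : g ∉ D.walkSet B ∪ D.walkSet Q := hs.right
  have heB : s(x, y) ∉ B.edges := fun he => hgn (Or.inl (D.arcSet_subset_walkSet B h he hg))
  have heQ : s(x, y) ∉ Q.edges := fun he => hgn (Or.inr (D.arcSet_subset_walkSet Q h he hg))
  have main : ∀ x ∈ W, ∀ y ∈ W, ∀ h : G.Adj x y, g ∈ D.arcSet h → s(x, y) ∉ B.edges →
      s(x, y) ∉ Q.edges → x ∈ Q.support := by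
    intro x hx y hy h hg heB heQ
    have hgy : g ≠ D.pos y := fun h => hW y hy (h ▸ hs)
    by_contra hxQ
    by_cases hxB : x ∈ B.support
    · have hxA : x ∉ A.support := by
        intro hxA
        rcases S.AB x hxA hxB with rfl | rfl
        · exact hxQ Q.start_mem_support
        · exact hxQ Q.end_mem_support
      have h1 : SC (D.walkSet A ∪ D.walkSet Q) o (D.pos x) :=
        S.symm.f2 ho ((D.pos_mem_walkSet B).2 hxB) (fun h => hxQ ((D.pos_mem_walkSet Q).1 h))
      have h2 : SC (D.walkSet A ∪ D.walkSet Q) (D.pos x) g := by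
        refine D.SC_arc h ?_ hg hgy
        rintro p hp (hpA | hpQ)
        · obtain ⟨w, rfl, rfl | rfl, hw⟩ := D.arc_walk_inter S.plane h A
            (fun he => hxA (A.fst_mem_support_of_mem_edges he)) hp hpA
          · exact absurd hw hxA
          · rfl
        · obtain ⟨w, rfl, rfl | rfl, hw⟩ := D.arc_walk_inter S.plane h Q heQ hp hpQ
          · exact absurd hw hxQ
          · rfl
      have h3 := S.f3 ho (h1.trans h2) hs
      apply h3.1
      rw [D.graphSet_eq]
      exact Or.inr ⟨x, trivial, y, trivial, h, hg⟩
    · have h2 : SC (D.walkSet B ∪ D.walkSet Q) (D.pos x) g := by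
        refine D.SC_arc h ?_ hg hgy
        rintro p hp (hpA | hpQ)
        · obtain ⟨w, rfl, rfl | rfl, hw⟩ := D.arc_walk_inter S.plane h B heB hp hpA
          · exact absurd hw hxB
          · rfl
        · obtain ⟨w, rfl, rfl | rfl, hw⟩ := D.arc_walk_inter S.plane h Q heQ hp hpQ
          · exact absurd hw hxQ
          · rfl
      exact hW x hx (hs.trans h2.symm)
  have hxQ := main x hx y hy h hg heB heQ
  have hyQ := main y hy x hx h.symm (by rwa [D.arcSet_symm]) (by rwa [Sym2.eq_swap])
    (by rwa [Sym2.eq_swap])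
  exact heQ (S.ind x hxQ y hyQ h)

end SplitHyp
end Drawing

end

section
namespace Drawing

variable {V : Type} {G : SimpleGraph V} {D : Drawing G}
namespace SplitHyp

variable {u v : V} {A B Q : G.Walk u v}

/-- Removing an open subarc of a path from a cycle leaves a set with logarithms. -/
lemma cycle_minus (S : D.SplitHyp A B Q) (d : G.Dart) (hd : d ∈ Q.darts)
    {l r : unitInterval} (hlr : l < r) (hl : l < 1) (hr : 0 < r) :
    ∃ K', HasLogs K' ∧ K' ⊆ D.walkSet B ∪ D.walkSet Q ∧
      (∀ z ∈ D.walkSet B ∪ D.walkSet Q, z ∉ ⇑(D.arc d.adj) '' Ioo l r → z ∈ K') ∧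
      (∀ t, l < t → t < r → D.arc d.adj t ∉ K') := by
  obtain ⟨Q1, Q2, hQ⟩ := exists_split Q d hd
  have hpath := S.hQ
  have hsup : Q.support = Q1.support ++ Q2.support := by
    rw [hQ, SimpleGraph.Walk.support_append]; rfl
  have hnd : (Q1.support ++ Q2.support).Nodup := hsup ▸ hpath.support_nodup
  rw [List.nodup_append] at hnd
  obtain ⟨n1, n2, n3⟩ := hnd
  have hne : ∀ x ∈ Q1.support, x ∉ Q2.support := fun x h1 h2 => n3 x h1 x h2 rfl
  have p1 : Q1.IsPath := (SimpleGraph.Walk.isPath_def _).2 n1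
  have p2 : Q2.IsPath := (SimpleGraph.Walk.isPath_def _).2 n2
  have hset : D.walkSet Q = D.walkSet Q1 ∪ (D.arcSet d.adj ∪ D.walkSet Q2) := by
    rw [hQ, D.walkSet_append, D.walkSet_cons]
  have hmem : ∀ x, x ∈ Q.support ↔ x ∈ Q1.support ∨ x ∈ Q2.support := by
    intro x; rw [hsup, List.mem_append]
  have hedges : ∀ e, e ∈ Q.edges ↔ e ∈ Q1.edges ∨ e = s(d.fst, d.snd) ∨ e ∈ Q2.edges := by
    intro e; rw [hQ, SimpleGraph.Walk.edges_append, List.mem_append,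
      SimpleGraph.Walk.edges_cons, List.mem_cons]
  have hBQe := edges_disj B Q S.BQ S.eB
  have eB : s(d.fst, d.snd) ∉ B.edges := fun h => hBQe _ h ((hedges _).2 (Or.inr (Or.inl rfl)))
  have e1 : s(d.fst, d.snd) ∉ Q1.edges := fun h =>
    hne _ (Q1.snd_mem_support_of_mem_edges h) Q2.start_mem_support
  have e2 : s(d.fst, d.snd) ∉ Q2.edges := fun h =>
    hne _ Q1.end_mem_support (Q2.fst_mem_support_of_mem_edges h)
  -- inner points of the arc are not on the rest
  have hinner : ∀ t, D.arc d.adj t ∈ D.walkSet B ∪ D.walkSet Q1 ∪ D.walkSet Q2 → t = 0 ∨ t = 1 := by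
    rintro t ((h | h) | h)
    · obtain ⟨w, hw, _⟩ := D.arc_walk_inter S.plane d.adj B eB ⟨t, rfl⟩ h
      exact D.arc_vertex d.adj t w hw
    · obtain ⟨w, hw, _⟩ := D.arc_walk_inter S.plane d.adj Q1 e1 ⟨t, rfl⟩ h
      exact D.arc_vertex d.adj t w hw
    · obtain ⟨w, hw, _⟩ := D.arc_walk_inter S.plane d.adj Q2 e2 ⟨t, rfl⟩ h
      exact D.arc_vertex d.adj t w hw
  have L1 : HasLogs (D.walkSet B ∪ D.walkSet Q1) := by
    refine (D.walkSet_hasLogs S.plane B S.hB).union (D.walkSet_hasLogs S.plane Q1 p1) ?_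
    apply subsingleton_preconnected (D.pos u)
    rintro z ⟨h1, h2⟩
    obtain ⟨w, rfl, hw1, hw2⟩ := D.walk_inter S.plane B Q1
      (fun e h h' => hBQe e h ((hedges e).2 (Or.inl h'))) h1 h2
    rcases S.BQ w hw1 ((hmem w).2 (Or.inl hw2)) with rfl | rfl
    · rfl
    · exact absurd Q2.end_mem_support (hne _ hw2)
  have L2 : HasLogs (D.walkSet B ∪ D.walkSet Q1 ∪ D.walkSet Q2) := by
    refine L1.union (D.walkSet_hasLogs S.plane Q2 p2) ?_
    apply subsingleton_preconnected (D.pos v)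
    rintro z ⟨h1 | h1, h2⟩
    · obtain ⟨w, rfl, hw1, hw2⟩ := D.walk_inter S.plane B Q2
        (fun e h h' => hBQe e h ((hedges e).2 (Or.inr (Or.inr h')))) h1 h2
      rcases S.BQ w hw1 ((hmem w).2 (Or.inr hw2)) with rfl | rfl
      · exact absurd hw2 (hne _ Q1.start_mem_support)
      · rfl
    · obtain ⟨w, rfl, hw1, hw2⟩ := D.walk_inter S.plane Q1 Q2
        (edges_disj Q1 Q2 (a := d.fst) (b := d.snd) (fun x hx hx' => absurd hx' (hne x hx)) e1) h1 h2
      exact absurd hw2 (hne _ hw1)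
  have harc := fun s t => HasLogs.arc _ (D.arc_continuous d.adj) (D.arc_inj d.adj) s t
  have L3 : HasLogs (D.walkSet B ∪ D.walkSet Q1 ∪ D.walkSet Q2 ∪ ⇑(D.arc d.adj) '' Icc r 1) := by
    refine L2.union (harc r 1) ?_
    apply subsingleton_preconnected (D.pos d.snd)
    rintro z ⟨h1, ⟨t, ht, rfl⟩⟩
    rcases hinner t h1 with rfl | rfl
    · exact absurd hr (not_lt.2 ht.1)
    · exact (D.arc d.adj).target
  have L4 : HasLogs (D.walkSet B ∪ D.walkSet Q1 ∪ D.walkSet Q2 ∪ ⇑(D.arc d.adj) '' Icc r 1 ∪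
      ⇑(D.arc d.adj) '' Icc 0 l) := by
    refine L3.union (harc 0 l) ?_
    apply subsingleton_preconnected (D.pos d.fst)
    rintro z ⟨h1 | ⟨t', ht', h1⟩, ⟨t, ht, rfl⟩⟩
    · rcases hinner t h1 with rfl | rfl
      · exact (D.arc d.adj).source
      · exact absurd hl (not_lt.2 ht.2)
    · have := D.arc_inj _ h1
      subst this
      exact absurd (lt_of_le_of_lt ht.2 hlr) (not_lt.2 ht'.1)
  refine ⟨_, L4, ?_, ?_, ?_⟩
  · rw [hset]
    rintro z ((((h | h) | h) | ⟨t, _, rfl⟩) | ⟨t, _, rfl⟩)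
    · exact Or.inl h
    · exact Or.inr (Or.inl h)
    · exact Or.inr (Or.inr (Or.inr h))
    · exact Or.inr (Or.inr (Or.inl ⟨t, rfl⟩))
    · exact Or.inr (Or.inr (Or.inl ⟨t, rfl⟩))
  · rw [hset]
    rintro z (h | h | ⟨t, rfl⟩ | h) hz
    · exact Or.inl (Or.inl (Or.inl (Or.inl h)))
    · exact Or.inl (Or.inl (Or.inl (Or.inr h)))
    · by_cases h1 : t ≤ l
      · exact Or.inr ⟨t, ⟨t.2.1, h1⟩, rfl⟩
      · by_cases h2 : r ≤ t
        · exact Or.inl (Or.inr ⟨t, ⟨h2, t.2.2⟩, rfl⟩)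
        · exact absurd ⟨t, ⟨not_le.1 h1, not_le.1 h2⟩, rfl⟩ hz
    · exact Or.inl (Or.inl (Or.inr h))
  · rintro t h1 h2 ((h | ⟨t', ht', h⟩) | ⟨t', ht', h⟩)
    · rcases hinner t h with rfl | rfl
      · exact absurd h1 (not_lt.2 l.2.1)
      · exact absurd h2 (not_lt.2 r.2.2)
    · have := D.arc_inj _ h
      subst this
      exact absurd h2 (not_lt.2 ht'.1)
    · have := D.arc_inj _ h
      subst this
      exact absurd h1 (not_lt.2 ht'.2)

end SplitHyp
end Drawing

end

section
namespace Drawing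

variable {V : Type} {G : SimpleGraph V} {D : Drawing G}
namespace SplitHyp

variable {u v : V} {A B Q : G.Walk u v}

lemma inner_closure [Finite V] (S : D.SplitHyp A B Q) {o : ℝ × ℝ} (ho : o ∈ D.outerFace)
    (d : G.Dart) (hd : d ∈ Q.darts) {t : unitInterval} (h0 : 0 < t) (h1 : t < 1) :
    D.arc d.adj t ∈ closure {z | SC (D.walkSet B ∪ D.walkSet Q) o z} := by
  set U := {z | SC (D.walkSet B ∪ D.walkSet Q) o z} with hU
  by_contra hn
  have hcl : IsClosed (D.walkSet B ∪ D.walkSet Q) := S.symm.compA.isClosed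
  have hUo : IsOpen U := SC_open hcl o
  have hnb : ⇑(D.arc d.adj) ⁻¹' (closure U)ᶜ ∈ nhds t :=
    (isClosed_closure.isOpen_compl.preimage (D.arc_continuous d.adj)).mem_nhds hn
  obtain ⟨l, r, ⟨hl, hr⟩, hlr⟩ := (mem_nhds_iff_exists_Ioo_subset' ⟨0, h0⟩ ⟨1, h1⟩).1 hnb
  obtain ⟨K', hK', hsub, hcov, hout⟩ := S.cycle_minus d hd (hl.trans hr) (hl.trans h1) (h0.trans hr)
  have hoK : o ∉ D.walkSet B ∪ D.walkSet Q := fun h => ho.1 (S.symm.subA h)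
  obtain ⟨T, hT, hTK, hoT, hzT⟩ := hK'.SC (fun h => hoK (hsub h)) (hout t hl hr)
  have : T ⊆ U := by
    refine subset_of_frontier_disjoint hUo hT ⟨o, hoT, SC.refl hoK⟩ ?_
    rw [Set.disjoint_left]
    intro x hx hxf
    apply hTK hx
    refine hcov x (SC_frontier hcl o hxf) ?_
    rintro ⟨s, hs, rfl⟩
    exact hlr hs (frontier_subset_closure hxf)
  exact hn (subset_closure (this hzT))

lemma side [Finite V] (S : D.SplitHyp A B Q) (huv : u ≠ v) {o : ℝ × ℝ} (ho : o ∈ D.outerFace)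
    {W : Set V} (hW : ∀ w ∈ W, ¬ SC (D.walkSet B ∪ D.walkSet Q) o (D.pos w)) :
    D.walkSet Q ⊆ closure (outerOf (D.subSet W)) := by
  refine D.walkSet_subset_of_inner Q huv isClosed_closure ?_
  intro d hd t h0 h1
  have hcl2 : IsClosed (D.walkSet B ∪ D.walkSet Q) := S.symm.compA.isClosed
  have hcl1 : IsClosed (D.walkSet A ∪ D.walkSet Q) := S.compA.isClosed
  have hKcl : IsClosed (D.subSet W) := (D.subSet_compact W).isClosed
  rw [mem_closure_iff]
  intro N hN hzN
  have hza : D.arc d.adj t ∉ D.walkSet A := by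
    intro h
    have hdQ : s(d.fst, d.snd) ∈ Q.edges := List.mem_map.2 ⟨d, hd, rfl⟩
    obtain ⟨w, hw, _⟩ := D.arc_walk_inter S.plane d.adj A
      (fun h => edges_disj A Q S.AQ S.eA _ h hdQ) ⟨t, rfl⟩ h
    rcases D.arc_vertex d.adj t w hw with rfl | rfl
    · exact lt_irrefl _ h0
    · exact lt_irrefl _ h1
  obtain ⟨w, ⟨hwN, hwa⟩, hwU⟩ := mem_closure_iff.1 (S.inner_closure ho d hd h0 h1)
    (N ∩ (D.walkSet A)ᶜ) (hN.inter (D.walkSet_compact A).isClosed.isOpen_compl) ⟨hzN, hza⟩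
  refine ⟨w, hwN, ?_⟩
  replace hwU : SC (D.walkSet B ∪ D.walkSet Q) o w := hwU
  by_cases hwO : w ∈ D.outerFace
  · exact D.outerFace_subset W hwO
  have hns : ¬ SC (D.walkSet A ∪ D.walkSet Q) o w := fun h => hwO (S.f3 ho h hwU)
  have hwC1 : w ∉ D.walkSet A ∪ D.walkSet Q := by
    rintro (h | h)
    · exact hwa h
    · exact hwU.right (Or.inr h)
  set M := {z | SC (D.walkSet A ∪ D.walkSet Q) w z} with hM
  have hMo : IsOpen M := SC_open hcl1 w
  have hMc : IsPreconnected M := SC_connected _ w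
  have hwM : w ∈ M := SC.refl hwC1
  have hy : ∃ y ∈ frontier M, y ∈ D.walkSet A ∧ y ∉ D.walkSet Q := by
    by_contra hcon
    push Not at hcon
    obtain ⟨T, hT, hTK, hwT, hoT⟩ := (D.walkSet_hasLogs S.plane Q S.hQ).SC
      (fun h => hwC1 (Or.inr h)) (fun h => ho.1 (D.walkSet_subset_graphSet Q h))
    have : T ⊆ M := by
      refine subset_of_frontier_disjoint hMo hT ⟨w, hwT, hwM⟩ ?_
      rw [Set.disjoint_left]
      intro x hx hxf
      apply hTK hx
      rcases SC_frontier hcl1 w hxf with h | h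
      · exact hcon x hxf h
      · exact h
    exact hns (SC.symm (this hoT))
  obtain ⟨y, hyM, hya, hyq⟩ := hy
  have hMC2 : M ⊆ (D.walkSet B ∪ D.walkSet Q)ᶜ := by
    rintro x hx (h | h)
    · have hxC1 : x ∉ D.walkSet A ∪ D.walkSet Q := SC.right hx
      have := S.symm.f2 ho h (fun h => hxC1 (Or.inr h))
      exact hns (this.trans (SC.symm hx))
    · exact (SC.right hx) (Or.inr h)
  have hMK : M ⊆ (D.subSet W)ᶜ := by
    intro x hx hxK
    exact S.g1 ho hW hxK (hwU.trans ⟨M, hMc, hMC2, hwM, hx⟩)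
  have hyK : y ∉ D.subSet W := fun h => S.g1 ho hW h (S.f2 ho hya hyq)
  have hyO : y ∈ closure D.outerFace := frontier_subset_closure (S.fr ▸ Or.inl hya)
  obtain ⟨d', hd1, hd2⟩ := mem_closure_iff_nhds.1 (frontier_subset_closure hyM) _ (SC_nhds hKcl hyK)
  obtain ⟨o', ho1, ho2⟩ := mem_closure_iff_nhds.1 hyO _ (SC_nhds hKcl hyK)
  have s1 : SC (D.subSet W) y d' := hd1
  have s2 : SC (D.subSet W) y o' := ho1
  exact outerOf_of_SC (D.outerFace_subset W ho2)
    ((s2.symm.trans s1).trans ⟨M, hMc, hMK, hd2, hwM⟩)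

lemma split [Finite V] (S : D.SplitHyp A B Q) (huv : u ≠ v) :
    ∃ W1 W2 : Set V, (∀ w, w ∈ W1 ∨ w ∈ W2) ∧ (∀ w ∈ W1, w ∈ W2 → w ∈ Q.support) ∧
      (∀ w ∈ Q.support, w ∈ W1 ∧ w ∈ W2) ∧ (∀ w ∈ A.support, w ∈ W1) ∧
      (∀ w ∈ B.support, w ∈ W2) ∧
      (∀ x ∈ W1, ∀ y ∈ W2, G.Adj x y → x ∈ Q.support ∨ y ∈ Q.support) ∧
      D.walkSet Q ⊆ closure (outerOf (D.subSet W1)) ∧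
      D.walkSet Q ⊆ closure (outerOf (D.subSet W2)) := by
  have hne : D.outerFace.Nonempty := by
    by_contra h
    rw [not_nonempty_iff_eq_empty] at h
    have hf := S.fr
    rw [h, frontier_empty] at hf
    have : D.pos u ∈ D.walkSet A ∪ D.walkSet B :=
      Or.inl ((D.pos_mem_walkSet A).2 A.start_mem_support)
    rw [← hf] at this
    exact this
  obtain ⟨o, ho⟩ := hne
  have hQC : ∀ w ∈ Q.support, ¬ SC (D.walkSet B ∪ D.walkSet Q) o (D.pos w) :=
    fun w hw h => h.right (Or.inr ((D.pos_mem_walkSet Q).2 hw))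
  have hQC1 : ∀ w ∈ Q.support, ¬ SC (D.walkSet A ∪ D.walkSet Q) o (D.pos w) :=
    fun w hw h => h.right (Or.inr ((D.pos_mem_walkSet Q).2 hw))
  have hgr : ∀ w, D.pos w ∉ D.outerFace := fun w h => h.1 (Or.inl ⟨w, rfl⟩)
  refine ⟨{w | SC (D.walkSet B ∪ D.walkSet Q) o (D.pos w) ∨ w ∈ Q.support},
    {w | ¬ SC (D.walkSet B ∪ D.walkSet Q) o (D.pos w)}, ?_, ?_, ?_, ?_, ?_, ?_, ?_, ?_⟩
  · intro w
    by_cases h : SC (D.walkSet B ∪ D.walkSet Q) o (D.pos w)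
    · exact Or.inl (Or.inl h)
    · exact Or.inr h
  · rintro w (h | h) h2
    · exact absurd h h2
    · exact h
  · exact fun w hw => ⟨Or.inr hw, hQC w hw⟩
  · intro w hw
    by_cases hq : w ∈ Q.support
    · exact Or.inr hq
    · exact Or.inl (S.f2 ho ((D.pos_mem_walkSet A).2 hw) (fun h => hq ((D.pos_mem_walkSet Q).1 h)))
  · intro w hw h
    exact h.right (Or.inl ((D.pos_mem_walkSet B).2 hw))
  · rintro x (hx | hx) y hy h
    swap
    · exact Or.inl hx
    replace hy : ¬ SC (D.walkSet B ∪ D.walkSet Q) o (D.pos y) := hy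
    by_contra hcon
    push Not at hcon
    obtain ⟨hxQ, hyQ⟩ := hcon
    have hxB : x ∉ B.support := fun h => hx.right (Or.inl ((D.pos_mem_walkSet B).2 h))
    have meet2 : ∀ p ∈ D.arcSet h, p ∈ D.walkSet B ∪ D.walkSet Q → p = D.pos y := by
      rintro p hp (hpB | hpQ)
      · obtain ⟨w, rfl, rfl | rfl, hw⟩ := D.arc_walk_inter S.plane h B
          (fun he => hxB (B.fst_mem_support_of_mem_edges he)) hp hpB
        · exact absurd hw hxB
        · rfl
      · obtain ⟨w, rfl, rfl | rfl, hw⟩ := D.arc_walk_inter S.plane h Q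
          (fun he => hxQ (Q.fst_mem_support_of_mem_edges he)) hp hpQ
        · exact absurd hw hxQ
        · rfl
    by_cases hyB : y ∈ B.support
    · have hyA : y ∉ A.support := by
        intro hyA
        rcases S.AB y hyA hyB with rfl | rfl
        · exact hyQ Q.start_mem_support
        · exact hyQ Q.end_mem_support
      have meet1 : ∀ p ∈ D.arcSet h.symm, p ∈ D.walkSet A ∪ D.walkSet Q → p = D.pos x := by
        rintro p hp (hpB | hpQ)
        · obtain ⟨w, rfl, rfl | rfl, hw⟩ := D.arc_walk_inter S.plane h.symm A
            (fun he => hyA (A.fst_mem_support_of_mem_edges he)) hp hpB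
          · exact absurd hw hyA
          · rfl
        · obtain ⟨w, rfl, rfl | rfl, hw⟩ := D.arc_walk_inter S.plane h.symm Q
            (fun he => hyQ (Q.fst_mem_support_of_mem_edges he)) hp hpQ
          · exact absurd hw hyQ
          · rfl
      obtain ⟨t, ht0, ht1⟩ : ∃ t : unitInterval, 0 < t ∧ t < 1 := exists_between (by simp)
      have hz : D.arc h t ∈ D.arcSet h := ⟨t, rfl⟩
      have hzx : D.arc h t ≠ D.pos x := by
        intro he
        exact ht0.ne' (D.arc_inj h (he.trans (D.arc h).source.symm))
      have hzy : D.arc h t ≠ D.pos y := by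
        intro he
        exact ht1.ne (D.arc_inj h (he.trans (D.arc h).target.symm))
      have s2 := hx.trans (D.SC_arc h meet2 hz hzy)
      have s1 := (S.symm.f2 ho ((D.pos_mem_walkSet B).2 hyB)
        (fun h => hyQ ((D.pos_mem_walkSet Q).1 h))).trans
        (D.SC_arc h.symm meet1 (by rw [D.arcSet_symm]; exact hz) hzx)
      apply (S.f3 ho s1 s2).1
      rw [D.graphSet_eq]
      exact Or.inr ⟨x, trivial, y, trivial, h, hz⟩
    · apply hy
      refine hx.trans ?_
      refine ⟨D.arcSet h, D.arcSet_preconnected h, ?_, D.left_mem_arcSet h, D.right_mem_arcSet h⟩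
      intro p hp hpK
      obtain rfl := meet2 p hp hpK
      rcases hpK with h' | h'
      · exact hyB ((D.pos_mem_walkSet B).1 h')
      · exact hyQ ((D.pos_mem_walkSet Q).1 h')
  · refine S.symm.side huv ho ?_
    rintro w (hw | hw) h
    · exact hgr w (S.f3 ho h hw)
    · exact hQC1 w hw h
  · exact S.side huv ho (fun w hw => hw)

end SplitHyp
end Drawing

end

section
namespace Drawing

variable {V V' : Type} {G : SimpleGraph V} (D : Drawing G)

/-- The drawing of an induced subgraph. -/
def pull (g : V' → V) (hg : Function.Injective g) : Drawing (G.comap g) where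
  pos := fun v => D.pos (g v)
  pos_inj := D.pos_inj.comp hg
  arc := fun u v h => D.arc (u := g u) (v := g v) h
  arc_symm := fun u v h => D.arc_symm (u := g u) (v := g v) h
  arc_inj := fun u v h => D.arc_inj (u := g u) (v := g v) h
  arc_vertex := fun u v h t w => D.arc_vertex (u := g u) (v := g v) h t (g w)
  arc_meet_once := fun u v x y h₁ h₂ hne =>
    D.arc_meet_once (u := g u) (v := g v) (x := g x) (y := g y) h₁ h₂
      (fun h => hne (Sym2.map.injective hg h))
  arc_no_triple := fun u₁ v₁ u₂ v₂ u₃ v₃ h₁ h₂ h₃ n1 n2 n3 p hp => by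
    by_contra hcon
    have h12 := fun h => n1 (Sym2.map.injective hg (a₁ := s(u₁, v₁)) (a₂ := s(u₂, v₂)) h)
    have h13 := fun h => n2 (Sym2.map.injective hg (a₁ := s(u₁, v₁)) (a₂ := s(u₃, v₃)) h)
    have h23 := fun h => n3 (Sym2.map.injective hg (a₁ := s(u₂, v₂)) (a₂ := s(u₃, v₃)) h)
    obtain ⟨w, rfl⟩ := D.arc_no_triple (u₁ := g u₁) (v₁ := g v₁) (u₂ := g u₂) (v₂ := g v₂)
      (u₃ := g u₃) (v₃ := g v₃) h₁ h₂ h₃ h12 h13 h23 p hp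
    have := D.pos_mem_arcSet (u := g u₁) (v := g v₁) h₁ hp.1.1
    rcases this with rfl | rfl
    · exact hcon ⟨u₁, rfl⟩
    · exact hcon ⟨v₁, rfl⟩

variable (g : V' → V) (hg : Function.Injective g)

lemma pull_plane (hp : D.IsPlane) : (D.pull g hg).IsPlane := by
  rintro p ⟨u, v, x, y, h₁, h₂, hne, hp1, hp2⟩
  exact hp p ⟨g u, g v, g x, g y, h₁, h₂, fun h => hne (Sym2.map.injective hg h), hp1, hp2⟩

lemma pull_graphSet : (D.pull g hg).graphSet = D.subSet (range g) := by
  ext p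
  constructor
  · rintro (⟨w, rfl⟩ | hp)
    · exact Or.inl ⟨g w, ⟨w, rfl⟩, rfl⟩
    · simp only [mem_iUnion] at hp
      obtain ⟨x, y, h, hp⟩ := hp
      exact Or.inr ⟨g x, ⟨x, rfl⟩, g y, ⟨y, rfl⟩, h, hp⟩
  · rintro (⟨w, ⟨w', rfl⟩, rfl⟩ | ⟨x, ⟨x', rfl⟩, y, ⟨y', rfl⟩, h, hp⟩)
    · exact Or.inl ⟨w', rfl⟩
    · right
      simp only [mem_iUnion]
      exact ⟨x', y', h, hp⟩

lemma pull_outerFace : (D.pull g hg).outerFace = outerOf (D.subSet (range g)) := by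
  rw [outerFace_eq, pull_graphSet]

lemma pull_walk {a b : V} (P : G.Walk a b) (hP : ∀ v ∈ P.support, v ∈ range g) :
    ∀ a' b' : V', g a' = a → g b' = b → ∃ P' : (G.comap g).Walk a' b',
      P'.support.map g = P.support ∧ P'.length = P.length ∧
      (D.pull g hg).walkSet P' = D.walkSet P := by
  induction P with
  | nil =>
    rintro a' b' rfl hb
    obtain rfl := hg hb
    refine ⟨SimpleGraph.Walk.nil, by simp, rfl, ?_⟩
    rw [walkSet_nil, walkSet_nil]
    rfl
  | @cons u v w h P ih =>
    rintro a' b' rfl rfl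
    obtain ⟨v', rfl⟩ := hP v (by simp)
    obtain ⟨P', h1, h2, h3⟩ := ih (fun x hx => hP x (by simp [hx])) v' b' rfl rfl
    have h' : (G.comap g).Adj a' v' := h
    refine ⟨SimpleGraph.Walk.cons h' P', by simp [h1], by simp [h2], ?_⟩
    rw [walkSet_cons, walkSet_cons, h3]
    rfl

end Drawing

lemma mem_frontier_outerOf {K : Set (ℝ × ℝ)} {p : ℝ × ℝ} (hp : p ∈ K)
    (h : p ∈ closure (outerOf K)) : p ∈ frontier (outerOf K) :=
  ⟨h, fun h' => (interior_subset h').1 hp⟩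

lemma sub_colorable (C : Config) (hmin : C.Minimal) (W : Set (Fin C.n)) (hW : W ≠ univ)
    {a b : Fin C.n} (P : C.G.Walk a b) (hP : P.IsPath) (hlen : P.length ≤ 2)
    (hPW : ∀ v ∈ P.support, v ∈ W)
    (hPo : C.D.walkSet P ⊆ closure (outerOf (C.D.subSet W)))
    (L : Fin C.n → Finset ℕ)
    (h5 : ∀ v ∈ W, C.D.pos v ∉ closure (outerOf (C.D.subSet W)) → 5 ≤ (L v).card)
    (h3 : ∀ v ∈ W, v ∉ P.support → 3 ≤ (L v).card)
    (h1 : ∀ v ∈ P.support, (L v).card = 1)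
    (hadj : ∀ u ∈ W, ∀ v ∈ W, C.G.Adj u v → (L u).card = 3 → (L v).card ≠ 3)
    (hprop : ∀ u ∈ P.support, ∀ v ∈ P.support, C.G.Adj u v → L u ≠ L v)
    (hcom : ∀ p₀ p₁ p₂, P.support = [p₀, p₁, p₂] → ∀ x ∈ W, C.G.Adj x p₀ → C.G.Adj x p₁ →
      C.G.Adj x p₂ → L x ≠ L p₀ ∪ L p₁ ∪ L p₂) :
    ∃ c : Fin C.n → ℕ, (∀ v ∈ W, c v ∈ L v) ∧
      ∀ u ∈ W, ∀ v ∈ W, C.G.Adj u v → c u ≠ c v := by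
  classical
  let f : Fin (Nat.card W) ≃ W := (Finite.equivFin W).symm
  let g : Fin (Nat.card W) → Fin C.n := fun i => (f i : Fin C.n)
  have hg : Function.Injective g := fun i j h => f.injective (Subtype.ext h)
  have hgf : ∀ x (hx : x ∈ W), g (f.symm ⟨x, hx⟩) = x := fun x hx =>
    congrArg Subtype.val (f.apply_symm_apply ⟨x, hx⟩)
  have hr : range g = W := by
    ext x
    constructor
    · rintro ⟨i, rfl⟩
      exact (f i).2
    · intro hx
      exact ⟨f.symm ⟨x, hx⟩, hgf x hx⟩
  by_contra hcon
  have hfa : g (f.symm ⟨a, hPW a P.start_mem_support⟩) = a := hgf _ _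
  have hfb : g (f.symm ⟨b, hPW b P.end_mem_support⟩) = b := hgf _ _
  obtain ⟨P', hs, hl, hw⟩ := C.D.pull_walk g hg P (fun v hv => by rw [hr]; exact hPW v hv) _ _ hfa hfb
  have hO : (C.D.pull g hg).outerFace = outerOf (C.D.subSet W) := by
    rw [C.D.pull_outerFace g hg, hr]
  have hsup : ∀ i, i ∈ P'.support ↔ g i ∈ P.support := by
    intro i
    rw [← hs, List.mem_map_of_injective hg]
  have hgW : ∀ i, g i ∈ W := fun i => (f i).2
  let C' : Config :=
    { n := Nat.card W
      G := C.G.comap g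
      D := C.D.pull g hg
      plane := C.D.pull_plane g hg C.plane
      a := _
      b := _
      P := P'
      P_path := by
        rw [SimpleGraph.Walk.isPath_def]
        apply List.Nodup.of_map g
        rw [hs]
        exact hP.support_nodup
      P_len := by rw [hl]; exact hlen
      P_boundary := by
        rw [hw, hO]
        intro p hp
        refine mem_frontier_outerOf ?_ (hPo hp)
        rcases C.D.mem_walkSet P hp with ⟨w, hw, rfl⟩ | ⟨x, y, h, he, hp⟩
        · exact Or.inl ⟨w, hPW w hw, rfl⟩
        · exact Or.inr ⟨x, hPW x (P.fst_mem_support_of_mem_edges he), y,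
            hPW y (P.snd_mem_support_of_mem_edges he), h, hp⟩
      L := fun i => L (g i)
      size5 := by
        intro i hi
        refine h5 _ (hgW i) ?_
        intro h
        apply hi
        unfold Drawing.OnOuter
        rw [hO]
        exact mem_frontier_outerOf (Or.inl ⟨g i, hgW i, rfl⟩) h
      size3 := fun i _ hi => h3 _ (hgW i) (fun h => hi ((hsup i).2 h))
      size1 := fun i hi => h1 _ ((hsup i).1 hi)
      no_adjacent_3 := fun i j h => hadj _ (hgW i) _ (hgW j) h
      proper_on_P := fun i hi j hj h => hprop _ ((hsup i).1 hi) _ ((hsup j).1 hj) h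
      common_neighbor := fun p₀ p₁ p₂ h x => by
        refine hcom (g p₀) (g p₁) (g p₂) ?_ (g x) (hgW x)
        rw [← hs, h]
        rfl
      not_colorable := by
        rintro ⟨c, hc1, hc2⟩
        apply hcon
        refine ⟨fun v => if h : v ∈ W then c (f.symm ⟨v, h⟩) else 0, ?_, ?_⟩
        · intro v hv
          have : c (f.symm ⟨v, hv⟩) ∈ L (g (f.symm ⟨v, hv⟩)) := hc1 (f.symm ⟨v, hv⟩)
          rw [hgf v hv] at this
          simpa only [hv, dif_pos] using this
        · intro u hu v hv h
          simp only [hu, hv, dif_pos]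
          apply hc2
          show C.G.Adj (g _) (g _)
          rw [hgf u hu, hgf v hv]
          exact h }
  have hsz := hmin.1 C'
  have hn : C'.n < C.n := by
    have h := Set.ncard_lt_ncard (ssubset_univ_iff.2 hW)
    rw [Set.ncard_univ, Nat.card_fin] at h
    exact h
  have he : C'.G.edgeSet.ncard ≤ C.G.edgeSet.ncard := by
    refine Set.ncard_le_ncard_of_injOn (Sym2.map g) ?_ (Sym2.map.injective hg).injOn (Set.toFinite _)
    intro e
    induction e using Sym2.ind with
    | _ x y => exact fun h => h
  unfold Config.size at hsz
  omega

end

section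
open SimpleGraph in
lemma walk_append_disj {V : Type} {G : SimpleGraph V} {a b c : V} (R1 : G.Walk a b)
    (R2 : G.Walk b c) (h : (R1.append R2).IsPath) {x : V} (h1 : x ∈ R1.support)
    (h2 : x ∈ R2.support) : x = b := by
  have hn := h.support_nodup
  rw [Walk.support_append, List.nodup_append] at hn
  rw [Walk.support_eq_cons, List.mem_cons] at h2
  rcases h2 with h2 | h2
  · exact h2
  · exact absurd rfl (hn.2.2 x h1 x h2)

open SimpleGraph in
lemma walk_len1 {V : Type} {G : SimpleGraph V} {a b : V} (R : G.Walk a b) (h : R.IsPath)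
    (he : s(a, b) ∈ R.edges) : R.length = 1 := by
  cases R with
  | nil => simp at he
  | @cons _ x _ h1 T =>
    rw [Walk.cons_isPath_iff] at h
    rw [Walk.edges_cons, List.mem_cons] at he
    rcases he with he | he
    · have : b = x := by
        rcases Sym2.eq_iff.1 he with ⟨_, h2⟩ | ⟨h2, _⟩
        · exact h2
        · exact absurd h2 h1.ne
      subst this
      have := Walk.isPath_iff_eq_nil.1 h.1
      rw [this]
      rfl
    · exact absurd (T.fst_mem_support_of_mem_edges he) h.2

open SimpleGraph in
lemma walk_first {V : Type} {G : SimpleGraph V} {a b : V} (R : G.Walk a b) (p : V → Prop)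
    (h : ∃ x ∈ R.support, p x) : ∃ (v : V) (R1 : G.Walk a v) (R2 : G.Walk v b),
      R = R1.append R2 ∧ p v ∧ ∀ y ∈ R1.support, p y → y = v := by
  induction R with
  | @nil a =>
    obtain ⟨x, hx, hpx⟩ := h
    simp at hx
    subst hx
    exact ⟨x, Walk.nil, Walk.nil, rfl, hpx, by simp⟩
  | @cons a c b h1 T ih =>
    by_cases hpa : p a
    · exact ⟨a, Walk.nil, Walk.cons h1 T, rfl, hpa, by simp⟩
    · obtain ⟨x, hx, hpx⟩ := h
      rw [Walk.support_cons, List.mem_cons] at hx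
      rcases hx with rfl | hx
      · exact absurd hpx hpa
      · obtain ⟨v, R1, R2, rfl, hv, hf⟩ := ih ⟨x, hx, hpx⟩
        refine ⟨v, Walk.cons h1 R1, R2, rfl, hv, ?_⟩
        intro y hy hpy
        rw [Walk.support_cons, List.mem_cons] at hy
        rcases hy with rfl | hy
        · exact absurd hpy hpa
        · exact hf y hy hpy

open SimpleGraph in
lemma walk_split3 {V : Type} {G : SimpleGraph V} {a b : V} (R : G.Walk a b) {u v : V}
    (hu : u ∈ R.support) (hv : v ∈ R.support) :
    ∃ (u' v' : V) (R1 : G.Walk a u') (R2 : G.Walk u' v') (R3 : G.Walk v' b),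
      R = R1.append (R2.append R3) ∧ ((u' = u ∧ v' = v) ∨ (u' = v ∧ v' = u)) := by
  classical
  have hs := R.take_spec hu
  rw [← hs, Walk.mem_support_append_iff] at hv
  rcases hv with hv | hv
  · refine ⟨v, u, (R.takeUntil u hu).takeUntil v hv, (R.takeUntil u hu).dropUntil v hv,
      R.dropUntil u hu, ?_, Or.inr ⟨rfl, rfl⟩⟩
    rw [Walk.append_assoc, Walk.take_spec, Walk.take_spec]
  · refine ⟨u, v, R.takeUntil u hu, (R.dropUntil u hu).takeUntil v hv,
      (R.dropUntil u hu).dropUntil v hv, ?_, Or.inl ⟨rfl, rfl⟩⟩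
    rw [Walk.take_spec, Walk.take_spec]

/-- A separation of the vertex set along the list `T`. -/
structure VSep (C : Config) (T : List (Fin C.n)) (W1 W2 : Set (Fin C.n)) : Prop where
  cov : ∀ w, w ∈ W1 ∨ w ∈ W2
  int : ∀ w ∈ W1, w ∈ W2 → w ∈ T
  sub : ∀ w ∈ T, w ∈ W1 ∧ w ∈ W2
  no : ∀ x ∈ W1, ∀ y ∈ W2, C.G.Adj x y → x ∈ T ∨ y ∈ T

lemma VSep.symm {C : Config} {T : List (Fin C.n)} {W1 W2 : Set (Fin C.n)} (S : VSep C T W1 W2) :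
    VSep C T W2 W1 where
  cov w := (S.cov w).symm
  int w h1 h2 := S.int w h2 h1
  sub w h := (S.sub w h).symm
  no x hx y hy h := (S.no y hy x hx h.symm).symm

lemma VSep.stay {C : Config} {T : List (Fin C.n)} {W1 W2 : Set (Fin C.n)} (S : VSep C T W1 W2)
    {x y : Fin C.n} (hx : x ∈ W1) (hxT : x ∉ T) (hyT : y ∉ T) (h : C.G.Adj x y) : y ∈ W1 := by
  rcases S.cov y with h1 | h1
  · exact h1
  · rcases S.no x hx y h1 h with h2 | h2
    · exact absurd h2 hxT
    · exact absurd h2 hyT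

lemma VSep.glue {C : Config} {T : List (Fin C.n)} {W1 W2 : Set (Fin C.n)} (S : VSep C T W1 W2)
    (c1 c2 : Fin C.n → ℕ) (h1 : ∀ w ∈ W1, w ∉ T → c1 w ∈ C.L w) (h2 : ∀ w ∈ W2, c2 w ∈ C.L w)
    (p1 : ∀ u ∈ W1, ∀ v ∈ W1, C.G.Adj u v → c1 u ≠ c1 v)
    (p2 : ∀ u ∈ W2, ∀ v ∈ W2, C.G.Adj u v → c2 u ≠ c2 v)
    (hT : ∀ w ∈ T, c1 w = c2 w) : False := by
  classical
  apply C.not_colorable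
  have key1 : ∀ w ∈ W1, (if w ∈ W2 then c2 w else c1 w) = c1 w := by
    intro w hw
    by_cases h : w ∈ W2
    · rw [if_pos h, hT w (S.int w hw h)]
    · rw [if_neg h]
  have key2 : ∀ w ∈ W2, (if w ∈ W2 then c2 w else c1 w) = c2 w := fun w hw => if_pos hw
  refine ⟨fun w => if w ∈ W2 then c2 w else c1 w, ?_, ?_⟩
  · intro w
    by_cases h : w ∈ W2
    · simp only [if_pos h]; exact h2 w h
    · simp only [if_neg h]
      exact h1 w ((S.cov w).resolve_right h) (fun hw => h (S.sub w hw).2)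
  · intro u v h
    show (if u ∈ W2 then c2 u else c1 u) ≠ (if v ∈ W2 then c2 v else c1 v)
    rcases S.cov u with hu | hu <;> rcases S.cov v with hv | hv
    · rw [key1 u hu, key1 v hv]; exact p1 u hu v hv h
    · rcases S.no u hu v hv h with hh | hh
      · rw [key2 u (S.sub u hh).2, key2 v hv]; exact p2 _ (S.sub u hh).2 _ hv h
      · rw [key1 u hu, key1 v (S.sub v hh).1]; exact p1 _ hu _ (S.sub v hh).1 h
    · rcases S.no v hv u hu h.symm with hh | hh
      · rw [key2 u hu, key2 v (S.sub v hh).2]; exact p2 _ hu _ (S.sub v hh).2 h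
      · rw [key1 v hv, key1 u (S.sub u hh).1]; exact p1 _ (S.sub u hh).1 _ hv h
    · rw [key2 u hu, key2 v hv]; exact p2 u hu v hv h

/-- The outer cycle, as a path `R` from `p2` to `p0` together with the vertex `p1`. -/
structure OFrame (C : Config) {p0 p2 : Fin C.n} (p1 : Fin C.n) (R : C.G.Walk p2 p0) : Prop where
  h0 : C.G.Adj p1 p0
  h2 : C.G.Adj p1 p2
  path : R.IsPath
  p1R : p1 ∉ R.support
  ne : p0 ≠ p2
  fr : frontier C.D.outerFace = C.D.walkSet R ∪ (C.D.arcSet h0 ∪ C.D.arcSet h2)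

namespace OFrame

variable {C : Config} {p0 p1 p2 : Fin C.n} {R : C.G.Walk p2 p0}

lemma symm (f : OFrame C p1 R) : OFrame C p1 R.reverse where
  h0 := f.h2
  h2 := f.h0
  path := f.path.reverse
  p1R := by simpa using f.p1R
  ne := f.ne.symm
  fr := by rw [f.fr, C.D.walkSet_reverse, union_comm (C.D.arcSet _) (C.D.arcSet _)]

lemma onOuter (f : OFrame C p1 R) (w : Fin C.n) : C.D.OnOuter w ↔ w = p1 ∨ w ∈ R.support := by
  unfold Drawing.OnOuter
  rw [f.fr]
  constructor
  · rintro (h | h | h)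
    · exact Or.inr ((C.D.pos_mem_walkSet R).1 h)
    · rcases C.D.pos_mem_arcSet _ h with h | h
      · exact Or.inl h
      · exact Or.inr (h ▸ R.end_mem_support)
    · rcases C.D.pos_mem_arcSet _ h with h | h
      · exact Or.inl h
      · exact Or.inr (h ▸ R.start_mem_support)
  · rintro (rfl | h)
    · exact Or.inr (Or.inl (C.D.left_mem_arcSet _))
    · exact Or.inl ((C.D.pos_mem_walkSet R).2 h)

open SimpleGraph in
/-- Splitting along a chord at `p1`. -/
lemma split1 {v : Fin C.n} {R1 : C.G.Walk p2 v} {R2 : C.G.Walk v p0}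
    (f : OFrame C p1 (R1.append R2)) (h : C.G.Adj p1 v) (hv0 : v ≠ p0) (hv2 : v ≠ p2) :
    ∃ W1 W2, VSep C [p1, v] W1 W2 ∧ (∀ w ∈ R1.support, w ∈ W1) ∧ (∀ w ∈ R2.support, w ∈ W2) ∧
      C.D.arcSet h ⊆ closure (outerOf (C.D.subSet W1)) ∧
      C.D.arcSet h ⊆ closure (outerOf (C.D.subSet W2)) := by
  have hd := fun x => walk_append_disj R1 R2 f.path (x := x)
  have hn1 : p1 ∉ R1.support := fun h => f.p1R (Walk.mem_support_append_iff _ _ |>.2 (Or.inl h))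
  have hn2 : p1 ∉ R2.support := fun h => f.p1R (Walk.mem_support_append_iff _ _ |>.2 (Or.inr h))
  have S : C.D.SplitHyp (Walk.cons f.h2 R1) (Walk.cons f.h0 R2.reverse) (Walk.cons h Walk.nil) :=
    { plane := C.plane
      hA := (Walk.cons_isPath_iff _ _).2 ⟨f.path.of_append_left, hn1⟩
      hB := (Walk.cons_isPath_iff _ _).2 ⟨f.path.of_append_right.reverse, by simpa using hn2⟩
      hQ := by simp [h.ne]
      AB := by
        intro x hx hx'
        simp only [Walk.support_cons, List.mem_cons, Walk.support_reverse, List.mem_reverse] at hx hx'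
        rcases hx with hx | hx
        · exact Or.inl hx
        · rcases hx' with hx' | hx'
          · exact Or.inl hx'
          · exact Or.inr (hd x hx hx')
      AQ := by simp
      BQ := by simp
      eA := by
        rw [Walk.edges_cons, List.mem_cons]
        rintro (he | he)
        · rcases Sym2.eq_iff.1 he with ⟨_, h2⟩ | ⟨h2, _⟩
          · exact hv2 h2
          · exact f.h2.ne h2
        · exact hn1 (R1.fst_mem_support_of_mem_edges he)
      eB := by
        rw [Walk.edges_cons, List.mem_cons, Walk.edges_reverse, List.mem_reverse]
        rintro (he | he)
        · rcases Sym2.eq_iff.1 he with ⟨_, h2⟩ | ⟨h2, _⟩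
          · exact hv0 h2
          · exact f.h0.ne h2
        · exact hn2 (R2.fst_mem_support_of_mem_edges he)
      ind := by
        intro x hx y hy hxy
        simp only [Walk.support_cons, Walk.support_nil, List.mem_cons, List.not_mem_nil, or_false] at hx hy
        simp only [Walk.edges_cons, Walk.edges_nil, List.mem_singleton]
        rcases hx with rfl | rfl <;> rcases hy with rfl | rfl
        · exact absurd rfl hxy.ne
        · rfl
        · exact Sym2.eq_swap
        · exact absurd rfl hxy.ne
      fr := by
        rw [f.fr, C.D.walkSet_append, C.D.walkSet_cons, C.D.walkSet_cons, C.D.walkSet_reverse]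
        ext z
        simp only [mem_union]
        tauto }
  obtain ⟨W1, W2, h1, h2, h3, h4, h5, h6, h7, h8⟩ := S.split h.ne
  rw [C.D.walkSet_single] at h7 h8
  refine ⟨W1, W2, ⟨h1, h2, h3, h6⟩, ?_, ?_, h7, h8⟩
  · exact fun w hw => h4 w (by simp [hw])
  · exact fun w hw => h5 w (by simp [hw])

open SimpleGraph in
/-- Splitting along a chord of `R`. -/
lemma split2 {u v : Fin C.n} {R1 : C.G.Walk p2 u} {R2 : C.G.Walk u v} {R3 : C.G.Walk v p0}
    (f : OFrame C p1 (R1.append (R2.append R3))) (h : C.G.Adj u v)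
    (he : s(u, v) ∉ (R1.append (R2.append R3)).edges) :
    ∃ W1 W2, VSep C [u, v] W1 W2 ∧ (∀ w ∈ R2.support, w ∈ W1) ∧ (∀ w ∈ R1.support, w ∈ W2) ∧
      (∀ w ∈ R3.support, w ∈ W2) ∧ p1 ∈ W2 ∧
      C.D.arcSet h ⊆ closure (outerOf (C.D.subSet W1)) ∧
      C.D.arcSet h ⊆ closure (outerOf (C.D.subSet W2)) := by
  have hd := fun x => walk_append_disj R1 (R2.append R3) f.path (x := x)
  have hd' := fun x => walk_append_disj R2 R3 f.path.of_append_right (x := x)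
  have hpn := f.p1R
  simp only [Walk.mem_support_append_iff, not_or] at hpn hd
  obtain ⟨n1, n2, n3⟩ := hpn
  rw [Walk.edges_append, Walk.edges_append, List.mem_append, List.mem_append] at he
  push Not at he
  have hp1 := f.path.of_append_left
  have hp3 := f.path.of_append_right.of_append_right
  have hv1 : ∀ x ∈ R1.support, x ∉ R3.support := by
    intro x hx1 hx3
    have hxu := hd x hx1 (Or.inr hx3)
    have : x = v := hd' x (hxu ▸ R2.start_mem_support) hx3
    exact h.ne (hxu.symm.trans this)
  have S : C.D.SplitHyp R2
      (R1.reverse.append (Walk.cons f.h2.symm (Walk.cons f.h0 R3.reverse))) (Walk.cons h Walk.nil) :=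
    { plane := C.plane
      hA := f.path.of_append_right.of_append_left
      hB := by
        rw [Walk.isPath_def, Walk.support_append, List.nodup_append]
        simp only [Walk.support_cons, List.tail_cons, Walk.support_reverse, List.nodup_reverse,
          List.nodup_cons, List.mem_cons, List.mem_reverse]
        refine ⟨hp1.support_nodup, ⟨n3, hp3.support_nodup⟩, ?_⟩
        rintro a ha b (rfl | hb) rfl
        · exact n1 ha
        · exact hv1 _ ha hb
      hQ := by simp [h.ne]
      AB := by
        intro x hx hx'
        simp only [Walk.mem_support_append_iff, Walk.support_cons, List.mem_cons,
          Walk.support_reverse, List.mem_reverse] at hx'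
        rcases hx' with hx' | rfl | rfl | hx'
        · exact Or.inl (hd x hx' (Or.inl hx))
        · exact Or.inl (hd x R1.start_mem_support (Or.inl hx))
        · exact absurd hx n2
        · exact Or.inr (hd' x hx hx')
      AQ := by simp
      BQ := by simp
      eA := he.2.1
      eB := by
        simp only [Walk.edges_append, Walk.edges_cons, List.mem_cons, Walk.edges_reverse,
          List.mem_reverse, List.mem_append, not_or]
        have hu1 : u ≠ p1 := fun h => n1 (h ▸ R1.end_mem_support)
        have hv1 : v ≠ p1 := fun h => n3 (h ▸ R3.start_mem_support)
        refine ⟨he.1, ?_, ?_, he.2.2⟩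
        · intro hh
          rcases Sym2.eq_iff.1 hh with ⟨_, h2⟩ | ⟨h2, _⟩
          · exact hv1 h2
          · exact hu1 h2
        · intro hh
          rcases Sym2.eq_iff.1 hh with ⟨h2, _⟩ | ⟨_, h2⟩
          · exact hu1 h2
          · exact hv1 h2
      ind := by
        intro x hx y hy hxy
        simp only [Walk.support_cons, Walk.support_nil, List.mem_cons, List.not_mem_nil, or_false] at hx hy
        simp only [Walk.edges_cons, Walk.edges_nil, List.mem_singleton]
        rcases hx with rfl | rfl <;> rcases hy with rfl | rfl
        · exact absurd rfl hxy.ne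
        · rfl
        · exact Sym2.eq_swap
        · exact absurd rfl hxy.ne
      fr := by
        rw [f.fr, C.D.walkSet_append, C.D.walkSet_append, C.D.walkSet_append, C.D.walkSet_cons,
          C.D.walkSet_cons, C.D.walkSet_reverse, C.D.walkSet_reverse, C.D.arcSet_symm f.h2]
        ext z
        simp only [mem_union]
        tauto }
  obtain ⟨W1, W2, h1, h2, h3, h4, h5, h6, h7, h8⟩ := S.split h.ne
  rw [C.D.walkSet_single] at h7 h8
  refine ⟨W1, W2, ⟨h1, h2, h3, h6⟩, h4, ?_, ?_, ?_, h7, h8⟩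
  · exact fun w hw => h5 w (by simp [Walk.mem_support_append_iff, hw])
  · exact fun w hw => h5 w (by simp [Walk.mem_support_append_iff, hw])
  · exact h5 p1 (by simp [Walk.mem_support_append_iff])

open SimpleGraph in
/-- Splitting along a path `p2 x p0`. -/
lemma split3 (f : OFrame C p1 R) {x : Fin C.n} (hx2 : C.G.Adj p2 x) (hx0 : C.G.Adj x p0)
    (hx1 : x ≠ p1) (hxR : x ∉ R.support) (h02 : ¬ C.G.Adj p2 p0) :
    ∃ W1 W2, VSep C [p2, x, p0] W1 W2 ∧ (∀ w ∈ R.support, w ∈ W1) ∧ p1 ∈ W2 ∧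
      C.D.arcSet hx2 ∪ C.D.arcSet hx0 ⊆ closure (outerOf (C.D.subSet W1)) ∧
      C.D.arcSet hx2 ∪ C.D.arcSet hx0 ⊆ closure (outerOf (C.D.subSet W2)) := by
  have hno : ∀ {a b : Fin C.n} (T : C.G.Walk a b), s(p2, p0) ∉ T.edges := fun T he =>
    h02 (Walk.adj_of_mem_edges _ he)
  have S : C.D.SplitHyp R (Walk.cons f.h2.symm (Walk.cons f.h0 Walk.nil))
      (Walk.cons hx2 (Walk.cons hx0 Walk.nil)) :=
    { plane := C.plane
      hA := f.path
      hB := by simp [f.h2.ne.symm, f.h0.ne, f.ne.symm]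
      hQ := by simp [hx2.ne, hx0.ne, f.ne.symm]
      AB := by
        intro y hy hy'
        simp only [Walk.support_cons, Walk.support_nil, List.mem_cons, List.not_mem_nil, or_false] at hy'
        rcases hy' with rfl | rfl | rfl
        · exact Or.inl rfl
        · exact absurd hy f.p1R
        · exact Or.inr rfl
      AQ := by
        intro y hy hy'
        simp only [Walk.support_cons, Walk.support_nil, List.mem_cons, List.not_mem_nil, or_false] at hy'
        rcases hy' with rfl | rfl | rfl
        · exact Or.inl rfl
        · exact absurd hy hxR
        · exact Or.inr rfl
      BQ := by
        intro y hy hy'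
        simp only [Walk.support_cons, Walk.support_nil, List.mem_cons, List.not_mem_nil, or_false] at hy hy'
        rcases hy' with rfl | rfl | rfl
        · exact Or.inl rfl
        · rcases hy with h | h | h
          · exact Or.inl h
          · exact absurd h hx1
          · exact Or.inr h
        · exact Or.inr rfl
      eA := hno _
      eB := hno _
      ind := by
        intro a ha b hb hab
        simp only [Walk.support_cons, Walk.support_nil, List.mem_cons, List.not_mem_nil, or_false] at ha hb
        simp only [Walk.edges_cons, Walk.edges_nil, List.mem_cons, List.not_mem_nil, or_false]
        rcases ha with rfl | rfl | rfl <;> rcases hb with rfl | rfl | rfl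
        · exact absurd rfl hab.ne
        · exact Or.inl rfl
        · exact absurd hab h02
        · exact Or.inl Sym2.eq_swap
        · exact absurd rfl hab.ne
        · exact Or.inr rfl
        · exact absurd hab.symm h02
        · exact Or.inr Sym2.eq_swap
        · exact absurd rfl hab.ne
      fr := by
        rw [f.fr, C.D.walkSet_cons, C.D.walkSet_single, C.D.arcSet_symm f.h2,
          union_comm (C.D.arcSet _) (C.D.arcSet _)] }
  obtain ⟨W1, W2, h1, h2, h3, h4, h5, h6, h7, h8⟩ := S.split f.ne.symm
  rw [C.D.walkSet_cons, C.D.walkSet_single] at h7 h8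
  refine ⟨W1, W2, ⟨h1, h2, h3, h6⟩, h4, ?_, h7, h8⟩
  exact h5 p1 (by simp)

end OFrame

end

section
open SimpleGraph

lemma edge_mem_of_arcSet (C : Config) {a b x y : Fin C.n} (F : C.G.Walk a b) (h : C.G.Adj x y)
    (hs : C.D.arcSet h ⊆ C.D.walkSet F) : s(x, y) ∈ F.edges := by
  by_contra hne
  obtain ⟨t, ht0, ht1⟩ : ∃ t : unitInterval, 0 < t ∧ t < 1 := exists_between (by simp)
  obtain ⟨w, hw, _⟩ := C.D.arc_walk_inter C.plane h F hne ⟨t, rfl⟩ (hs ⟨t, rfl⟩)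
  rcases C.D.arc_vertex h t w hw with rfl | rfl
  · exact lt_irrefl _ ht0
  · exact lt_irrefl _ ht1

lemma exists_frame (C : Config) {r : Fin C.n} (F : C.G.Walk r r) (hF : F.IsCycle)
    (hbd : C.D.BoundsOuter F) {p1 : Fin C.n} (hp1 : p1 ∈ F.support) :
    ∃ (x y : Fin C.n) (R : C.G.Walk x y), OFrame C p1 R ∧ F.length = R.length + 2 ∧
      ∀ z, s(p1, z) ∈ F.edges → z = x ∨ z = y := by
  have hF' := hF.rotate hp1
  have hlen := F.length_rotate p1 hp1
  have hset : C.D.walkSet (F.rotate p1 hp1) = C.D.walkSet F := by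
    rw [Walk.rotate, C.D.walkSet_append, union_comm, ← C.D.walkSet_append, Walk.take_spec]
  have hed : ∀ e, e ∈ F.edges ↔ e ∈ (F.rotate p1 hp1).edges :=
    fun e => (F.rotate_edges p1 hp1).mem_iff.symm
  generalize F.rotate p1 hp1 = F' at *
  cases F' with
  | nil => exact absurd hF' (by simp)
  | @cons _ x _ h T =>
    rw [Walk.cons_isCycle_iff] at hF'
    obtain ⟨hT, hTe⟩ := hF'
    cases T with
    | nil => exact absurd rfl h.ne
    | @cons _ x' _ h' T' =>
      obtain ⟨y, R, hy, hR⟩ := Walk.exists_cons_eq_concat h' T'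
      rw [hR] at hT hTe hlen hset hed
      rw [Walk.concat_isPath_iff] at hT
      have hxy : y ≠ x := by
        rintro rfl
        apply hTe
        rw [Walk.edges_concat, List.concat_eq_append, List.mem_append]
        exact Or.inr (by simp [Sym2.eq_swap])
      refine ⟨x, y, R, ⟨hy.symm, h, hT.1, hT.2, hxy, ?_⟩, ?_, ?_⟩
      · have := hbd
        unfold Drawing.BoundsOuter at this
        rw [this, ← hset, C.D.walkSet_cons, Walk.concat_eq_append, C.D.walkSet_append,
          C.D.walkSet_single, C.D.arcSet_symm hy]
        ext z
        simp only [mem_union]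
        tauto
      · rw [Walk.length_cons, Walk.length_concat] at hlen
        omega
      · intro z hz
        rw [hed, Walk.edges_cons, List.mem_cons, Walk.edges_concat, List.concat_eq_append,
          List.mem_append, List.mem_singleton] at hz
        rcases hz with hz | hz | hz
        · left
          rcases Sym2.eq_iff.1 hz with ⟨_, h2⟩ | ⟨h2, _⟩
          · exact h2
          · exact absurd h2 h.ne
        · exact absurd (R.fst_mem_support_of_mem_edges hz) hT.2
        · right
          rcases Sym2.eq_iff.1 hz with ⟨h2, _⟩ | ⟨_, h2⟩
          · exact absurd h2.symm hy.ne
          · exact h2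

lemma three_le (C : Config) {v : Fin C.n} (hv : v ∉ C.P.support) : 3 ≤ (C.L v).card := by
  by_cases h : C.D.OnOuter v
  · exact C.size3 v h hv
  · have := C.size5 v h
    omega

lemma bd_mono (C : Config) (W : Set (Fin C.n)) :
    frontier C.D.outerFace ⊆ closure (outerOf (C.D.subSet W)) :=
  frontier_subset_closure.trans (closure_mono (C.D.outerFace_subset W))

lemma five_le (C : Config) {W : Set (Fin C.n)} {v : Fin C.n}
    (hv : C.D.pos v ∉ closure (outerOf (C.D.subSet W))) : 5 ≤ (C.L v).card :=
  C.size5 v (fun h => hv (bd_mono C W h))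

lemma color_side (C : Config) (hmin : C.Minimal) (W : Set (Fin C.n)) (hW : W ≠ univ)
    {a b : Fin C.n} (P : C.G.Walk a b) (hP : P.IsPath) (hlen : P.length ≤ 2)
    (hPW : ∀ v ∈ P.support, v ∈ W)
    (hPo : C.D.walkSet P ⊆ closure (outerOf (C.D.subSet W)))
    (L : Fin C.n → Finset ℕ)
    (hL : ∀ v ∈ W, v ∉ P.support → L v = C.L v ∧ v ∉ C.P.support)
    (h1 : ∀ v ∈ P.support, (L v).card = 1)
    (hprop : ∀ u ∈ P.support, ∀ v ∈ P.support, C.G.Adj u v → L u ≠ L v)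
    (hcom : ∀ p₀ p₁ p₂, P.support = [p₀, p₁, p₂] → ∀ x ∈ W, C.G.Adj x p₀ → C.G.Adj x p₁ →
      C.G.Adj x p₂ → L x ≠ L p₀ ∪ L p₁ ∪ L p₂) :
    ∃ c : Fin C.n → ℕ, (∀ v ∈ W, c v ∈ L v) ∧
      ∀ u ∈ W, ∀ v ∈ W, C.G.Adj u v → c u ≠ c v := by
  refine sub_colorable C hmin W hW P hP hlen hPW hPo L ?_ ?_ h1 ?_ hprop hcom
  · intro v hv hvo
    have hvP : v ∉ P.support := fun h => hvo (hPo ((C.D.pos_mem_walkSet P).2 h))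
    rw [(hL v hv hvP).1]
    exact five_le C hvo
  · intro v hv hvP
    rw [(hL v hv hvP).1]
    exact three_le C (hL v hv hvP).2
  · intro u hu v hv h hu3 hv3
    have huP : u ∉ P.support := fun h => by rw [h1 u h] at hu3; omega
    have hvP : v ∉ P.support := fun h => by rw [h1 v h] at hv3; omega
    rw [(hL u hu huP).1] at hu3
    rw [(hL v hv hvP).1] at hv3
    exact C.no_adjacent_3 u v h hu3 hv3

lemma extend_path (C : Config) (hmin : C.Minimal) {a b : Fin C.n} (P : C.G.Walk a b) (hP : P.IsPath)
    (hlen : P.length ≤ 2) (hlt : C.P.length < P.length)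
    (hbd : C.D.walkSet P ⊆ frontier C.D.outerFace) (x : Fin C.n) (hx : x ∉ C.P.support)
    (hsup : ∀ v, v ∈ P.support ↔ v ∈ C.P.support ∨ v = x) (col : ℕ) (hcol : col ∈ C.L x)
    (hc : ∀ p ∈ C.P.support, C.G.Adj x p → C.L p ≠ {col})
    (hcom : ∀ p₀ p₁ p₂, P.support = [p₀, p₁, p₂] → ∀ y, C.G.Adj y p₀ → C.G.Adj y p₁ →
      C.G.Adj y p₂ → Function.update C.L x {col} y ≠ Function.update C.L x {col} p₀ ∪
        Function.update C.L x {col} p₁ ∪ Function.update C.L x {col} p₂) : False := by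
  have hux : Function.update C.L x {col} x = {col} := by simp
  have hun : ∀ v, v ≠ x → Function.update C.L x {col} v = C.L v := fun v hv => by simp [hv]
  let C' : Config :=
    { n := C.n
      G := C.G
      D := C.D
      plane := C.plane
      a := a
      b := b
      P := P
      P_path := hP
      P_len := hlen
      P_boundary := hbd
      L := Function.update C.L x {col}
      size5 := by
        intro v hv
        rw [hun]
        · exact C.size5 v hv
        · rintro rfl
          exact hv (hbd ((C.D.pos_mem_walkSet P).2 ((hsup v).2 (Or.inr rfl))))
      size3 := by
        intro v hv hvP
        rw [hsup] at hvP
        push Not at hvP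
        rw [hun v hvP.2]
        exact C.size3 v hv hvP.1
      size1 := by
        intro v hv
        by_cases hvx : v = x
        · subst hvx; rw [hux]; rfl
        · rw [hun v hvx]
          exact C.size1 v (((hsup v).1 hv).resolve_right hvx)
      no_adjacent_3 := by
        intro u v h hu hv
        have h1 : u ≠ x := by rintro rfl; rw [hux] at hu; simp at hu
        have h2 : v ≠ x := by rintro rfl; rw [hux] at hv; simp at hv
        rw [hun u h1] at hu
        rw [hun v h2] at hv
        exact C.no_adjacent_3 u v h hu hv
      proper_on_P := by
        intro u hu v hv h
        by_cases h1 : u = x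
        · have h2 : v ≠ x := fun h2 => h.ne (h1.trans h2.symm)
          rw [hun v h2, h1, hux]
          exact (hc v (((hsup v).1 hv).resolve_right h2) (h1 ▸ h)).symm
        · rw [hun u h1]
          by_cases h2 : v = x
          · rw [h2, hux]
            exact hc u (((hsup u).1 hu).resolve_right h1) (h2 ▸ h.symm)
          · rw [hun v h2]
            exact C.proper_on_P u (((hsup u).1 hu).resolve_right h1) v
              (((hsup v).1 hv).resolve_right h2) h
      common_neighbor := hcom
      not_colorable := by
        rintro ⟨c, hc1, hc2⟩
        refine C.not_colorable ⟨c, ?_, hc2⟩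
        intro v
        by_cases h1 : v = x
        · have := hc1 x
          rw [hux, Finset.mem_singleton] at this
          rw [h1, this]
          exact hcol
        · have := hc1 v
          rwa [hun v h1] at this }
  have := hmin.2.1 C' rfl
  unfold Config.plen at this
  exact absurd this (not_le.2 hlt)

/-- A vertex adjacent to both ends of `R` cannot avoid a chord at `p1`. -/
lemma chord_side {C : Config} {p0 p1 p2 : Fin C.n} {R : C.G.Walk p2 p0} (f : OFrame C p1 R)
    {x : Fin C.n} (hxR : x ∈ R.support) (hx0 : x ≠ p0) (hx2 : x ≠ p2) (h : C.G.Adj p1 x) :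
    ∃ W1 W2, VSep C [p1, x] W1 W2 ∧ p2 ∈ W1 ∧ p0 ∈ W2 ∧ p0 ∉ W1 := by
  obtain ⟨W1, W2, S, h1, h2, _, _⟩ := OFrame.split1 (R1 := R.takeUntil x hxR)
    (R2 := R.dropUntil x hxR) (by rw [Walk.take_spec]; exact f) h hx0 hx2
  refine ⟨W1, W2, S, h1 p2 (Walk.start_mem_support _), h2 p0 (Walk.end_mem_support _), ?_⟩
  intro h0
  have := S.int p0 h0 (h2 p0 (Walk.end_mem_support _))
  simp at this
  rcases this with h' | h'
  · exact f.h0.ne h'.symm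
  · exact hx0 h'.symm

lemma chord_side1 {C : Config} {p0 p1 p2 : Fin C.n} {R : C.G.Walk p2 p0} (f : OFrame C p1 R)
    {x : Fin C.n} (hxR : x ∈ R.support) (hx0 : x ≠ p0) (hx2 : x ≠ p2) (h : C.G.Adj p1 x)
    {y : Fin C.n} (hy1 : y ≠ p1) (hyx : y ≠ x) (h2 : C.G.Adj p2 y) (h0 : C.G.Adj y p0) : False := by
  obtain ⟨W1, W2, S, a2, a0, n0⟩ := chord_side f hxR hx0 hx2 h
  have q2 : p2 ∉ [p1, x] := by simp [f.h2.ne.symm, hx2.symm]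
  have q0 : p0 ∉ [p1, x] := by simp [f.h0.ne.symm, hx0.symm]
  have qy : y ∉ [p1, x] := by simp [hy1, hyx]
  exact n0 (S.stay (S.stay a2 q2 qy h2) qy q0 h0)

lemma chord_side2 {C : Config} {p0 p1 p2 : Fin C.n} {R : C.G.Walk p2 p0} (f : OFrame C p1 R)
    {x : Fin C.n} (hxR : x ∈ R.support) (hx0 : x ≠ p0) (hx2 : x ≠ p2) (h : C.G.Adj p1 x)
    {v y : Fin C.n} (hv1 : v ≠ p1) (hvx : v ≠ x) (hy1 : y ≠ p1) (hyx : y ≠ x)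
    (h2 : C.G.Adj p2 v) (hvy : C.G.Adj v y) (h0 : C.G.Adj y p0) : False := by
  obtain ⟨W1, W2, S, a2, a0, n0⟩ := chord_side f hxR hx0 hx2 h
  have q2 : p2 ∉ [p1, x] := by simp [f.h2.ne.symm, hx2.symm]
  have q0 : p0 ∉ [p1, x] := by simp [f.h0.ne.symm, hx0.symm]
  have qy : y ∉ [p1, x] := by simp [hy1, hyx]
  have qv : v ∉ [p1, x] := by simp [hv1, hvx]
  exact n0 (S.stay (S.stay (S.stay a2 q2 qv h2) qv qy hvy) qy q0 h0)

end

section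
open SimpleGraph

lemma color_one (C : Config) (hmin : C.Minimal) (W : Set (Fin C.n)) (hW : W ≠ univ)
    {x y : Fin C.n} (hxy : C.G.Adj x y) (hx : x ∈ W) (hy : y ∈ W)
    (hs : C.D.arcSet hxy ⊆ closure (outerOf (C.D.subSet W))) {a b : ℕ} (hab : a ≠ b)
    (hP : ∀ v ∈ W, v ∈ C.P.support → v = x ∨ v = y) :
    ∃ c : Fin C.n → ℕ, (∀ v ∈ W, v ≠ x → v ≠ y → c v ∈ C.L v) ∧ c x = a ∧ c y = b ∧
      ∀ u ∈ W, ∀ v ∈ W, C.G.Adj u v → c u ≠ c v := by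
  classical
  have hne := hxy.ne
  let L : Fin C.n → Finset ℕ := fun v => if v = x then {a} else if v = y then {b} else C.L v
  have Lx : L x = {a} := by simp [L]
  have Ly : L y = {b} := by simp [L, hne.symm]
  have Lo : ∀ v, v ≠ x → v ≠ y → L v = C.L v := fun v h1 h2 => by simp [L, h1, h2]
  obtain ⟨c, h1, h2⟩ := color_side C hmin W hW (Walk.cons hxy Walk.nil) (by simp [hne])
    (by simp) (by simp [hx, hy]) (by rw [C.D.walkSet_single]; exact hs) L
    (by
      intro v hv hvP
      simp at hvP
      refine ⟨Lo v hvP.1 hvP.2, fun h => ?_⟩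
      rcases hP v hv h with h | h
      · exact hvP.1 h
      · exact hvP.2 h)
    (by
      intro v hv
      simp at hv
      rcases hv with rfl | rfl
      · rw [Lx]; rfl
      · rw [Ly]; rfl)
    (by
      intro u hu v hv h
      simp at hu hv
      rcases hu with rfl | rfl <;> rcases hv with rfl | rfl
      · exact absurd rfl h.ne
      · rw [Lx, Ly]; simpa using hab
      · rw [Lx, Ly]; simpa using hab.symm
      · exact absurd rfl h.ne)
    (by intro p0 p1 p2 h; simp at h)
  refine ⟨c, fun v hv hvx hvy => ?_, ?_, ?_, h2⟩
  · rw [← Lo v hvx hvy]; exact h1 v hv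
  · have := h1 x hx; rw [Lx] at this; simpa using this
  · have := h1 y hy; rw [Ly] at this; simpa using this

lemma color_two (C : Config) (hmin : C.Minimal) (W : Set (Fin C.n)) (hW : W ≠ univ)
    {x y z : Fin C.n} (hxy : C.G.Adj x y) (hyz : C.G.Adj y z) (hxz : x ≠ z)
    (hx : x ∈ W) (hy : y ∈ W) (hz : z ∈ W)
    (hs : C.D.arcSet hxy ⊆ closure (outerOf (C.D.subSet W)))
    (hs' : C.D.arcSet hyz ⊆ closure (outerOf (C.D.subSet W)))
    {a b d : ℕ} (hab : a ≠ b) (hbd : b ≠ d) (had : C.G.Adj x z → a ≠ d)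
    (hP : ∀ v ∈ W, v ∈ C.P.support → v = x ∨ v = y ∨ v = z)
    (hcom : ∀ w ∈ W, C.G.Adj w x → C.G.Adj w y → C.G.Adj w z → C.L w ≠ {a, b, d}) :
    ∃ c : Fin C.n → ℕ, (∀ v ∈ W, v ≠ x → v ≠ y → v ≠ z → c v ∈ C.L v) ∧
      c x = a ∧ c y = b ∧ c z = d ∧ ∀ u ∈ W, ∀ v ∈ W, C.G.Adj u v → c u ≠ c v := by
  classical
  have hne := hxy.ne
  have hne' := hyz.ne
  let L : Fin C.n → Finset ℕ :=
    fun v => if v = x then {a} else if v = y then {b} else if v = z then {d} else C.L v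
  have Lx : L x = {a} := by simp [L]
  have Ly : L y = {b} := by simp [L, hne.symm]
  have Lz : L z = {d} := by simp [L, hne'.symm, hxz.symm]
  have Lo : ∀ v, v ≠ x → v ≠ y → v ≠ z → L v = C.L v :=
    fun v h1 h2 h3 => by simp [L, h1, h2, h3]
  obtain ⟨c, h1, h2⟩ := color_side C hmin W hW (Walk.cons hxy (Walk.cons hyz Walk.nil))
    (by simp [hne, hne', hxz]) (by simp) (by simp [hx, hy, hz])
    (by
      rw [C.D.walkSet_cons, C.D.walkSet_single]
      exact union_subset hs hs') L
    (by
      intro v hv hvP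
      simp at hvP
      refine ⟨Lo v hvP.1 hvP.2.1 hvP.2.2, fun h => ?_⟩
      rcases hP v hv h with h | h | h
      · exact hvP.1 h
      · exact hvP.2.1 h
      · exact hvP.2.2 h)
    (by
      intro v hv
      simp at hv
      rcases hv with rfl | rfl | rfl
      · rw [Lx]; rfl
      · rw [Ly]; rfl
      · rw [Lz]; rfl)
    (by
      intro u hu v hv h
      simp at hu hv
      rcases hu with rfl | rfl | rfl <;> rcases hv with rfl | rfl | rfl
      · exact absurd rfl h.ne
      · rw [Lx, Ly]; simpa using hab
      · rw [Lx, Lz]; simpa using had h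
      · rw [Lx, Ly]; simpa using hab.symm
      · exact absurd rfl h.ne
      · rw [Ly, Lz]; simpa using hbd
      · rw [Lx, Lz]; simpa using (had h.symm).symm
      · rw [Ly, Lz]; simpa using hbd.symm
      · exact absurd rfl h.ne)
    (by
      intro p0 p1 p2 h w hw w0 w1 w2
      simp at h
      obtain ⟨rfl, rfl, rfl⟩ := h
      rw [Lo w w0.ne w1.ne w2.ne, Lx, Ly, Lz]
      convert hcom w hw w0 w1 w2 using 1
      ext t; simp)
  refine ⟨c, fun v hv hvx hvy hvz => ?_, ?_, ?_, ?_, h2⟩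
  · rw [← Lo v hvx hvy hvz]; exact h1 v hv
  · have := h1 x hx; rw [Lx] at this; simpa using this
  · have := h1 y hy; rw [Ly] at this; simpa using this
  · have := h1 z hz; rw [Lz] at this; simpa using this

/-- The outer cycle, with the precolored path `p0 p1 p2`. -/
structure PFrame (C : Config) {p0 p2 : Fin C.n} (p1 : Fin C.n) (R : C.G.Walk p2 p0)
    (a0 a1 a2 : ℕ) : Prop extends OFrame C p1 R where
  mem : ∀ v, v ∈ C.P.support ↔ v = p0 ∨ v = p1 ∨ v = p2
  l0 : C.L p0 = {a0}
  l1 : C.L p1 = {a1}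
  l2 : C.L p2 = {a2}
  n01 : a0 ≠ a1
  n12 : a1 ≠ a2
  n02 : C.G.Adj p0 p2 → a0 ≠ a2
  com : ∀ x, C.G.Adj x p0 → C.G.Adj x p1 → C.G.Adj x p2 → C.L x ≠ {a0, a1, a2}

lemma PFrame.symm {C : Config} {p0 p1 p2 : Fin C.n} {R : C.G.Walk p2 p0} {a0 a1 a2 : ℕ}
    (f : PFrame C p1 R a0 a1 a2) : PFrame C p1 R.reverse a2 a1 a0 where
  toOFrame := f.toOFrame.symm
  mem v := by rw [f.mem]; tauto
  l0 := f.l2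
  l1 := f.l1
  l2 := f.l0
  n01 := f.n12.symm
  n12 := f.n01.symm
  n02 h := (f.n02 h.symm).symm
  com x h0 h1 h2 := by
    have := f.com x h2 h1 h0
    convert this using 1
    ext t; simp; tauto

lemma card_three {L : Finset ℕ} (a b d : ℕ) (h3 : 3 ≤ L.card) (h : L = {a, b, d}) : L.card = 3 := by
  have := Finset.card_le_three (a := a) (b := b) (c := d)
  rw [h] at h3 ⊢
  omega

/-- A vertex with a list `{a,b,d}` off the precolored path lies on `R`. -/
lemma PFrame.bad {C : Config} {p0 p1 p2 : Fin C.n} {R : C.G.Walk p2 p0} {a0 a1 a2 : ℕ}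
    (f : PFrame C p1 R a0 a1 a2) {x : Fin C.n} (hx1 : x ≠ p1) {a b d : ℕ}
    (h : C.L x = {a, b, d}) : x ∈ R.support := by
  by_contra hx
  have : ¬ C.D.OnOuter x := by
    rw [f.toOFrame.onOuter]; tauto
  have h5 := C.size5 x this
  have := Finset.card_le_three (a := a) (b := b) (c := d)
  rw [h] at h5
  omega

lemma PFrame.bad_card {C : Config} {p0 p1 p2 : Fin C.n} {R : C.G.Walk p2 p0} {a0 a1 a2 : ℕ}
    (f : PFrame C p1 R a0 a1 a2) {x : Fin C.n} (hx0 : x ≠ p0) (hx1 : x ≠ p1) (hx2 : x ≠ p2)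
    {a b d : ℕ} (h : C.L x = {a, b, d}) : (C.L x).card = 3 := by
  refine card_three a b d (three_le C ?_) h
  rw [f.mem]; tauto

lemma exists_pick (L S : Finset ℕ) (h : S.card < L.card) : ∃ t ∈ L, t ∉ S := by
  by_contra hc
  push Not at hc
  exact absurd (Finset.card_le_card hc) (not_le.2 h)

lemma exists_pick2 (L S : Finset ℕ) (h : S.card + 1 < L.card) :
    ∃ t ∈ L, ∃ t' ∈ L, t ∉ S ∧ t' ∉ S ∧ t ≠ t' := by
  obtain ⟨t, ht, hS⟩ := exists_pick L S (by omega)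
  obtain ⟨t', ht', hS'⟩ := exists_pick L (insert t S)
    (lt_of_le_of_lt (Finset.card_insert_le _ _) h)
  rw [Finset.mem_insert, not_or] at hS'
  exact ⟨t, ht, t', ht', hS, hS'.2, Ne.symm hS'.1⟩

/-- No chord joins two vertices of `R`. -/
lemma PFrame.no_chord {C : Config} (hmin : C.Minimal) {p0 p1 p2 : Fin C.n} {R : C.G.Walk p2 p0}
    {a0 a1 a2 : ℕ} (f : PFrame C p1 R a0 a1 a2) {u v : Fin C.n} (hu : u ∈ R.support)
    (hv : v ∈ R.support) (h : C.G.Adj u v) : s(u, v) ∈ R.edges := by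
  by_contra he
  obtain ⟨u', v', R1, R2, R3, rfl, huv⟩ := walk_split3 R hu hv
  have h' : C.G.Adj u' v' := by
    rcases huv with ⟨rfl, rfl⟩ | ⟨rfl, rfl⟩
    · exact h
    · exact h.symm
  have he' : s(u', v') ∉ (R1.append (R2.append R3)).edges := by
    rcases huv with ⟨rfl, rfl⟩ | ⟨rfl, rfl⟩
    · exact he
    · rwa [Sym2.eq_swap]
  clear huv he hu hv h
  obtain ⟨W1, W2, S, s2, s1, s3, hp1, o1, o2⟩ := f.toOFrame.split2 h' he'
  have huW := S.sub u' (by simp)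
  have hvW := S.sub v' (by simp)
  have hinter : ∀ w ∈ W1, w ∈ W2 → w = u' ∨ w = v' := by
    intro w h1 h2
    simpa using S.int w h1 h2
  have p1u : p1 ≠ u' := by rintro rfl; exact f.p1R (by simp)
  have p1v : p1 ≠ v' := by rintro rfl; exact f.p1R (by simp)
  have p1W : p1 ∉ W1 := fun hh => by
    rcases hinter p1 hh hp1 with h | h
    · exact p1u h
    · exact p1v h
  have hp2 : p2 ∈ W2 := s1 _ R1.start_mem_support
  have hp0 : p0 ∈ W2 := s3 _ R3.end_mem_support
  -- an interior vertex
  obtain ⟨w, hw2, hwu, hwv⟩ : ∃ w ∈ R2.support, w ≠ u' ∧ w ≠ v' := by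
    cases R2 with
    | nil => exact absurd rfl h'.ne
    | @cons _ w _ hh T =>
      refine ⟨w, by simp, hh.ne.symm, ?_⟩
      rintro rfl
      apply he'
      simp [Walk.edges_append]
  have hwW : w ∉ W2 := fun hh => by
    rcases hinter w (s2 _ hw2) hh with h | h
    · exact hwu h
    · exact hwv h
  obtain ⟨c2, hc2, q2⟩ := color_side C hmin W2 (fun h => hwW (h ▸ mem_univ w)) C.P C.P_path C.P_len
    (by intro v hv; rw [f.mem] at hv; rcases hv with rfl | rfl | rfl <;> assumption)
    (C.P_boundary.trans (bd_mono C W2)) C.L (fun v _ h => ⟨rfl, h⟩) C.size1 C.proper_on_P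
    (fun p0 p1 p2 h x _ => C.common_neighbor p0 p1 p2 h x)
  obtain ⟨c1, hc1, eu, ev, q1⟩ := color_one C hmin W1 (fun h => p1W (h ▸ mem_univ p1)) h' huW.1 hvW.1
    o1 (q2 u' huW.2 v' hvW.2 h')
    (by
      intro v hv hvP
      apply hinter v hv
      rw [f.mem] at hvP; rcases hvP with rfl | rfl | rfl <;> assumption)
  refine S.glue c1 c2 (fun w hw hT => ?_) hc2 q1 q2 ?_
  · simp at hT
    exact hc1 w hw hT.1 hT.2
  · intro w hw
    simp at hw
    rcases hw with rfl | rfl <;> assumption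

end

section
open SimpleGraph

lemma OFrame.arc0 {C : Config} {p0 p1 p2 : Fin C.n} {R : C.G.Walk p2 p0} (f : OFrame C p1 R)
    (W : Set (Fin C.n)) : C.D.arcSet f.h0 ⊆ closure (outerOf (C.D.subSet W)) := by
  refine Subset.trans ?_ (bd_mono C W)
  rw [f.fr]
  exact subset_union_left.trans subset_union_right

lemma OFrame.arc2 {C : Config} {p0 p1 p2 : Fin C.n} {R : C.G.Walk p2 p0} (f : OFrame C p1 R)
    (W : Set (Fin C.n)) : C.D.arcSet f.h2 ⊆ closure (outerOf (C.D.subSet W)) := by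
  refine Subset.trans ?_ (bd_mono C W)
  rw [f.fr]
  exact subset_union_right.trans subset_union_right

lemma triple_ne {a b s t : ℕ} (hs : s ≠ b) (ht : t ≠ b) (hst : s ≠ t) :
    ({a, b, s} : Finset ℕ) ≠ {a, b, t} := by
  intro h
  have h1 : s ∈ ({a, b, t} : Finset ℕ) := by rw [← h]; simp
  have h2 : t ∈ ({a, b, s} : Finset ℕ) := by rw [h]; simp
  simp at h1 h2
  rcases h1 with h1 | h1 | h1
  · rcases h2 with h2 | h2 | h2
    · exact hst (h1.trans h2.symm)
    · exact ht h2
    · exact hst h2.symm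
  · exact hs h1
  · exact hst h1

/-- No chord is incident with `p1`. -/
lemma PFrame.no_chord1 {C : Config} (hmin : C.Minimal) {p0 p1 p2 : Fin C.n} {R : C.G.Walk p2 p0}
    {a0 a1 a2 : ℕ} (f : PFrame C p1 R a0 a1 a2) {u : Fin C.n} (hu : u ∈ R.support)
    (hu0 : u ≠ p0) (hu2 : u ≠ p2) : ¬ C.G.Adj p1 u := by
  intro hadj
  obtain ⟨v, R1, R2, rfl, ⟨h, hv0, hv2⟩, hfirst⟩ := walk_first R
    (fun y => C.G.Adj p1 y ∧ y ≠ p0 ∧ y ≠ p2) ⟨u, hu, hadj, hu0, hu2⟩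
  clear hadj hu0 hu2 hu
  obtain ⟨W1, W2, S, s1, s2, o1, o2⟩ := f.toOFrame.split1 h hv0 hv2
  have hpW := S.sub p1 (by simp)
  have hvW := S.sub v (by simp)
  have hinter : ∀ w ∈ W1, w ∈ W2 → w = p1 ∨ w = v := by
    intro w h1 h2
    simpa using S.int w h1 h2
  have hp2 : p2 ∈ W1 := s1 _ R1.start_mem_support
  have hp0 : p0 ∈ W2 := s2 _ R2.end_mem_support
  have hp2' : p2 ∉ W2 := fun hh => by
    rcases hinter p2 hp2 hh with h | h
    · exact f.h2.ne h.symm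
    · exact hv2 h.symm
  have hp0' : p0 ∉ W1 := fun hh => by
    rcases hinter p0 hh hp0 with h | h
    · exact f.h0.ne h.symm
    · exact hv0 h.symm
  have hW1 : W1 ≠ univ := fun h => hp0' (h ▸ mem_univ p0)
  have hW2 : W2 ≠ univ := fun h => hp2' (h ▸ mem_univ p2)
  have hvP : v ∉ C.P.support := by
    rw [f.mem]
    have := h.ne.symm
    tauto
  have hv3 := three_le C hvP
  have hvR : v ∈ (R1.append R2).support := by simp
  -- colour the side of `p0`
  have key : ∃ c2 : Fin C.n → ℕ, (∀ w ∈ W2, c2 w ∈ C.L w) ∧ c2 p1 = a1 ∧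
      (C.G.Adj v p2 → c2 v ≠ a2) ∧ ∀ u ∈ W2, ∀ v ∈ W2, C.G.Adj u v → c2 u ≠ c2 v := by
    by_cases hvp2 : C.G.Adj v p2
    · have hpick : ∃ col ∈ C.L v, col ≠ a1 ∧ col ≠ a2 ∧ (C.G.Adj p0 v → a0 ≠ col) ∧
          ∀ w ∈ W2, C.G.Adj w p0 → C.G.Adj w p1 → C.G.Adj w v → C.L w ≠ {a0, a1, col} := by
        by_cases hvp0 : C.G.Adj v p0
        · obtain ⟨col, hcol, hS⟩ : ∃ t ∈ C.L v, t ∉ ({a0, a1, a2} : Finset ℕ) := by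
            by_contra hc
            push Not at hc
            exact f.com v hvp0 h.symm hvp2 (Finset.eq_of_subset_of_card_le hc
              (Finset.card_le_three.trans hv3))
          simp at hS
          refine ⟨col, hcol, hS.2.1, hS.2.2, fun _ hh => hS.1 hh.symm, ?_⟩
          intro w hw w0 w1 wv hL
          have hwR := f.bad w1.ne hL
          have hw2 : w ≠ p2 := by rintro rfl; exact hp2' hw
          exact chord_side1 f.toOFrame hwR w0.ne hw2 w1.symm h.ne.symm wv.ne.symm hvp2.symm hvp0
        · by_cases h3 : (C.L v).card = 3
          · obtain ⟨col, hcol, hS⟩ := exists_pick (C.L v) {a1, a2}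
              (lt_of_le_of_lt Finset.card_le_two (by omega))
            simp at hS
            refine ⟨col, hcol, hS.1, hS.2, fun hh => absurd hh.symm hvp0, ?_⟩
            intro w hw w0 w1 wv hL
            have hw2 : w ≠ p2 := by rintro rfl; exact hp2' hw
            exact C.no_adjacent_3 w v wv (f.bad_card w0.ne w1.ne hw2 hL) h3
          · obtain ⟨s, hs, t, ht, hsS, htS, hst⟩ := exists_pick2 (C.L v) {a1, a2}
              (lt_of_le_of_lt (Nat.add_le_add_right Finset.card_le_two 1) (by omega))
            simp at hsS htS
            by_contra hno
            push Not at hno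
            obtain ⟨x, hx, x0, x1, xv, hxL⟩ := hno s hs hsS.1 hsS.2 (fun hh => absurd hh.symm hvp0)
            obtain ⟨y, hy, y0, y1, yv, hyL⟩ := hno t ht htS.1 htS.2 (fun hh => absurd hh.symm hvp0)
            have hxR := f.bad x1.ne hxL
            have hx2 : x ≠ p2 := by rintro rfl; exact hp2' hx
            have hyx : y ≠ x := by
              rintro rfl
              rw [hxL] at hyL
              exact triple_ne hsS.1 htS.1 hst hyL
            exact chord_side2 f.toOFrame hxR x0.ne hx2 x1.symm h.ne.symm xv.ne.symm y1.ne hyx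
              hvp2.symm yv.symm y0
      obtain ⟨col, hcol, hc1, hc2, hc0, hbad⟩ := hpick
      obtain ⟨c2, q, e0, e1, ev, pr⟩ := color_two C hmin W2 hW2 f.h0.symm h hv0.symm hp0 hpW.2 hvW.2
        (by rw [C.D.arcSet_symm]; exact f.toOFrame.arc0 W2) o2 f.n01 (Ne.symm hc1) hc0
        (by
          intro w hw hwP
          rw [f.mem] at hwP
          rcases hwP with h | h | h
          · exact Or.inl h
          · exact Or.inr (Or.inl h)
          · exact absurd (h ▸ hw) hp2')
        hbad
      refine ⟨c2, ?_, e1, fun _ => by rw [ev]; exact hc2, pr⟩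
      intro w hw
      by_cases w0 : w = p0
      · rw [w0, e0, f.l0]; simp
      by_cases w1 : w = p1
      · rw [w1, e1, f.l1]; simp
      by_cases wv : w = v
      · rw [wv, ev]; exact hcol
      exact q w hw w0 w1 wv
    · obtain ⟨c2, q, e0, e1, pr⟩ := color_one C hmin W2 hW2 f.h0.symm hp0 hpW.2
        (by rw [C.D.arcSet_symm]; exact f.toOFrame.arc0 W2) f.n01
        (by
          intro w hw hwP
          rw [f.mem] at hwP
          rcases hwP with h | h | h
          · exact Or.inl h
          · exact Or.inr h
          · exact absurd (h ▸ hw) hp2')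
      refine ⟨c2, ?_, e1, fun hh => absurd hh hvp2, pr⟩
      intro w hw
      by_cases w0 : w = p0
      · rw [w0, e0, f.l0]; simp
      by_cases w1 : w = p1
      · rw [w1, e1, f.l1]; simp
      exact q w hw w0 w1
  obtain ⟨c2, q2, e1, ev, pr2⟩ := key
  obtain ⟨c1, q1, d1, d2, d3, pr1⟩ := color_two C hmin W1 hW1 h.symm f.h2 hv2 hvW.1 hpW.1 hp2
    (by rw [C.D.arcSet_symm]; exact o1) (f.toOFrame.arc2 W1)
    (a := c2 v) (b := a1) (d := a2)
    (by rw [← e1]; exact pr2 v hvW.2 p1 hpW.2 h.symm) f.n12 ev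
    (by
      intro w hw hwP
      rw [f.mem] at hwP
      rcases hwP with h | h | h
      · exact absurd (h ▸ hw) hp0'
      · exact Or.inr (Or.inl h)
      · exact Or.inr (Or.inr h))
    (by
      intro w hw wv w1 w2 hL
      have hwR := f.bad w1.ne hL
      rw [Walk.mem_support_append_iff] at hwR
      rcases hwR with hwR | hwR
      · refine wv.ne (hfirst w hwR ⟨w1.symm, ?_, w2.ne⟩)
        rintro rfl
        exact hp0' hw
      · rcases hinter w hw (s2 _ hwR) with hh | hh
        · exact w1.ne hh
        · exact wv.ne hh)
  refine S.glue c1 c2 ?_ q2 pr1 pr2 ?_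
  · intro w hw hT
    simp at hT
    by_cases w2 : w = p2
    · rw [w2, d3, f.l2]; simp
    exact q1 w hw hT.2 hT.1 w2
  · intro w hw
    simp at hw
    rcases hw with rfl | rfl
    · rw [d2, e1]
    · exact d1

end

section
open SimpleGraph

/-- After deleting a vertex of the outer face, its neighbors are on the outer face. -/
lemma nbr_outer (C : Config) {v w : Fin C.n} (hv : C.D.OnOuter v) (h : C.G.Adj v w) :
    C.D.pos w ∈ closure (outerOf (C.D.subSet {v}ᶜ)) := by
  have hvK : C.D.pos v ∉ C.D.subSet {v}ᶜ := by
    rintro (⟨x, hx, hxv⟩ | ⟨x, hx, y, hy, h', hp⟩)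
    · exact hx (C.D.pos_inj hxv)
    · rcases C.D.pos_mem_arcSet h' hp with rfl | rfl
      · exact hx rfl
      · exact hy rfl
  obtain ⟨o, ho⟩ : C.D.outerFace.Nonempty := by
    rw [← closure_nonempty_iff]
    exact ⟨_, frontier_subset_closure hv⟩
  have h1 := C.D.SC_frontier_outer (C.D.subSet_subset_graphSet {v}ᶜ) ho hv hvK
  have hvo := outerOf_of_SC (C.D.outerFace_subset {v}ᶜ ho) h1
  have hK : ∀ p ∈ C.D.arcSet h, p ∈ C.D.subSet {v}ᶜ → p = C.D.pos w := by
    rintro p hp (⟨x, hx, rfl⟩ | ⟨x, hx, y, hy, h', hp'⟩)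
    · rcases C.D.pos_mem_arcSet h hp with rfl | rfl
      · exact absurd rfl hx
      · rfl
    · have hne : s(v, w) ≠ s(x, y) := by
        intro he
        have : v ∈ s(x, y) := by rw [← he]; simp
        rw [Sym2.mem_iff] at this
        rcases this with rfl | rfl
        · exact hx rfl
        · exact hy rfl
      obtain ⟨z, hz, hz1, hz2⟩ := C.D.arc_inter C.plane h h' hne hp hp'
      rcases hz1 with rfl | rfl
      · rcases hz2 with rfl | rfl
        · exact absurd rfl hx
        · exact absurd rfl hy
      · exact hz
  have hcl : (1 : unitInterval) ∈ closure (Iio (1 : unitInterval)) := by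
    rw [closure_Iio' ⟨0, by simp⟩]
    simp
  have := image_closure_subset_closure_image (C.D.arc_continuous h) ⟨1, hcl, rfl⟩
  rw [(C.D.arc h).target] at this
  refine closure_mono ?_ this
  rintro _ ⟨t, ht, rfl⟩
  refine outerOf_of_SC hvo (C.D.SC_arc h hK ⟨t, rfl⟩ ?_)
  intro he
  exact (ne_of_lt ht) (C.D.arc_inj h (he.trans (C.D.arc h).target.symm))

lemma del_vertex (C : Config) (hmin : C.Minimal) {v z : Fin C.n} (hv : C.D.OnOuter v) {col : ℕ}
    (hcol : col ∈ C.L v) {a b : Fin C.n} (P : C.G.Walk a b) (hP : P.IsPath) (hlen : P.length ≤ 2)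
    (hvP : v ∉ P.support) (hbd : C.D.walkSet P ⊆ frontier C.D.outerFace)
    (hsup : ∀ w, w ∈ C.P.support → w = v ∨ w ∈ P.support)
    (hsub : ∀ w ∈ P.support, w ∈ C.P.support)
    (hc : ∀ w ∈ P.support, C.G.Adj v w → col ∉ C.L w)
    (hz : ∀ w, C.D.OnOuter w → w ≠ v → w ∉ P.support → w = z ∧ 4 ≤ (C.L w).card ∧
      ∀ p₀ p₁ p₂, P.support = [p₀, p₁, p₂] → ¬ (C.G.Adj w p₀ ∧ C.G.Adj w p₁ ∧ C.G.Adj w p₂))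
    (hcom : ∀ p₀ p₁ p₂, P.support = [p₀, p₁, p₂] → ∀ x, C.G.Adj x p₀ → C.G.Adj x p₁ →
      C.G.Adj x p₂ → C.L x ≠ C.L p₀ ∪ C.L p₁ ∪ C.L p₂) : False := by
  classical
  let L : Fin C.n → Finset ℕ :=
    fun w => if C.G.Adj v w ∧ w ∉ P.support then (C.L w).erase col else C.L w
  have Lsub : ∀ w, L w ⊆ C.L w := by
    intro w
    simp only [L]
    split_ifs
    · exact Finset.erase_subset _ _
    · exact Finset.Subset.refl _
  have LP : ∀ w ∈ P.support, L w = C.L w := fun w hw => by simp [L, hw]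
  have Ln : ∀ w, ¬ C.G.Adj v w → L w = C.L w := fun w hw => by simp [L, hw]
  have La : ∀ w, C.G.Adj v w → w ∉ P.support → L w = (C.L w).erase col :=
    fun w h1 h2 => by simp [L, h1, h2]
  have Lc : ∀ w, (C.L w).card ≤ (L w).card + 1 := by
    intro w
    simp only [L]
    split_ifs
    · have := Finset.pred_card_le_card_erase (s := C.L w) (a := col)
      omega
    · omega
  have hnP : ∀ w, w ≠ v → w ∉ P.support → w ∉ C.P.support := fun w h1 h2 h3 => by
    rcases hsup w h3 with h | h
    · exact h1 h
    · exact h2 h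
  have hout : ∀ w, w ∉ P.support → (L w).card = 3 → C.D.OnOuter w := by
    intro w hw h3
    by_contra ho
    have := C.size5 w ho
    have := Lc w
    omega
  obtain ⟨c, c1, c2⟩ := sub_colorable C hmin {v}ᶜ
    (fun h => (h ▸ mem_univ v : v ∈ ({v}ᶜ : Set (Fin C.n))) rfl) P hP hlen
    (by rintro w hw rfl; exact hvP hw)
    (hbd.trans (bd_mono C _)) L
    (by
      intro w hw hwo
      rw [Ln w (fun h => hwo (nbr_outer C hv h))]
      exact five_le C hwo)
    (by
      intro w hw hwP
      by_cases ho : C.D.OnOuter w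
      · have := (hz w ho hw hwP).2.1
        have := Lc w
        omega
      · have := C.size5 w ho
        have := Lc w
        omega)
    (by
      intro w hw
      rw [LP w hw]
      exact C.size1 w (hsub w hw))
    (by
      intro u hu w hw h hu3 hw3
      have huP : u ∉ P.support := fun hh => by
        rw [LP u hh, C.size1 u (hsub u hh)] at hu3; omega
      have hwP : w ∉ P.support := fun hh => by
        rw [LP w hh, C.size1 w (hsub w hh)] at hw3; omega
      exact h.ne ((hz u (hout u huP hu3) hu huP).1.trans (hz w (hout w hwP hw3) hw hwP).1.symm))
    (by
      intro u hu w hw h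
      rw [LP u hu, LP w hw]
      exact C.proper_on_P u (hsub u hu) w (hsub w hw) h)
    (by
      intro q0 q1 q2 hq x hx x0 x1 x2 hL
      have m0 : q0 ∈ P.support := by rw [hq]; simp
      have m1 : q1 ∈ P.support := by rw [hq]; simp
      have m2 : q2 ∈ P.support := by rw [hq]; simp
      have hxP : x ∉ P.support := by
        rw [hq]
        simp [x0.ne, x1.ne, x2.ne]
      rw [LP q0 m0, LP q1 m1, LP q2 m2] at hL
      by_cases hxv : C.G.Adj v x
      · have hcard : (L x).card ≤ 3 := by
          rw [hL]
          have s0 := C.size1 q0 (hsub _ m0)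
          have s1 := C.size1 q1 (hsub _ m1)
          have s2 := C.size1 q2 (hsub _ m2)
          have := Finset.card_union_le (C.L q0 ∪ C.L q1) (C.L q2)
          have := Finset.card_union_le (C.L q0) (C.L q1)
          omega
        have ho : C.D.OnOuter x := by
          by_contra ho
          have := C.size5 x ho
          have := Lc x
          omega
        exact (hz x ho hx hxP).2.2 q0 q1 q2 hq ⟨x0, x1, x2⟩
      · rw [Ln x hxv] at hL
        exact hcom q0 q1 q2 hq x x0 x1 x2 hL)
  have hv' : ∀ w, C.G.Adj v w → c w ≠ col := by
    intro w hw he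
    have h1 := c1 w hw.ne.symm
    by_cases hwP : w ∈ P.support
    · rw [LP w hwP, he] at h1
      exact hc w hwP hw h1
    · rw [La w hw hwP, he] at h1
      simp at h1
  refine C.not_colorable ⟨Function.update c v col, ?_, ?_⟩
  · intro w
    by_cases hw : w = v
    · subst hw; simpa using hcol
    · rw [Function.update_of_ne hw]
      exact Lsub w (c1 w hw)
  · intro u w h
    by_cases hu : u = v
    · subst hu
      rw [Function.update_self, Function.update_of_ne h.ne.symm]
      exact (hv' w h).symm
    · by_cases hw : w = v
      · subst hw
        rw [Function.update_self, Function.update_of_ne hu]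
        exact hv' u h.symm
      · rw [Function.update_of_ne hu, Function.update_of_ne hw]
        exact c2 u hu w hw h


lemma PFrame.len_ne_one {C : Config} (hmin : C.Minimal) {p0 p1 p2 : Fin C.n} {R : C.G.Walk p2 p0}
    {a0 a1 a2 : ℕ} (f : PFrame C p1 R a0 a1 a2) : R.length ≠ 1 := by
  intro hl
  have hout := f.toOFrame.onOuter
  have hR : ∀ w ∈ R.support, w = p2 ∨ w = p0 := by
    clear f hout
    intro w hw
    cases R with
    | nil => simp at hl
    | cons h T =>
      cases T with
      | nil => simpa using hw
      | cons h' T' => simp at hl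
  have hno : ∀ w, C.D.OnOuter w → w ≠ p1 → w ∉ R.support → False := by
    intro w h1 h2 h3
    rcases (hout w).1 h1 with h | h
    · exact h2 h
    · exact h3 h
  refine del_vertex C hmin (v := p1) (z := p1) ((hout p1).2 (Or.inl rfl)) (col := a1)
    (by rw [f.l1]; simp) R f.path (by omega) f.p1R ?_ ?_ ?_ ?_ ?_ ?_
  · rw [f.fr]; exact subset_union_left
  · intro w hw
    rw [f.mem] at hw
    rcases hw with rfl | rfl | rfl
    · exact Or.inr R.end_mem_support
    · exact Or.inl rfl
    · exact Or.inr R.start_mem_support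
  · intro w hw
    rw [f.mem]
    rcases hR w hw with h | h
    · exact Or.inr (Or.inr h)
    · exact Or.inl h
  · intro w hw _
    rcases hR w hw with h | h
    · rw [h, f.l2]; simpa using f.n12
    · rw [h, f.l0]; simpa using f.n01.symm
  · intro w h1 h2 h3
    exact (hno w h1 h2 h3).elim
  · intro q0 q1 q2 hq
    have := congrArg List.length hq
    rw [Walk.length_support, hl] at this
    simp at this

lemma PFrame.del {C : Config} (hmin : C.Minimal) {p0 p1 p2 : Fin C.n} {R : C.G.Walk p2 p0}
    {a0 a1 a2 : ℕ} (f : PFrame C p1 R a0 a1 a2) {v z : Fin C.n} (hv : v ∈ R.support)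
    (hv0 : v ≠ p0) (hv2 : v ≠ p2)
    (hz : ∀ y ∈ R.support, y = p0 ∨ y = p2 ∨ y = v ∨ (y = z ∧ 4 ≤ (C.L y).card)) {col : ℕ}
    (hcol : col ∈ C.L v) (hc0 : C.G.Adj v p0 → col ≠ a0) (hc2 : C.G.Adj v p2 → col ≠ a2) :
    False := by
  have hout := f.toOFrame.onOuter
  have hv1 : v ≠ p1 := by rintro rfl; exact f.p1R hv
  refine del_vertex C hmin (v := v) (z := z) ((hout v).2 (Or.inr hv)) hcol C.P C.P_path C.P_len
    ?_ C.P_boundary (fun w hw => Or.inr hw) (fun w hw => hw) ?_ ?_ C.common_neighbor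
  · rw [f.mem]; tauto
  · intro w hw h
    rw [f.mem] at hw
    rcases hw with rfl | rfl | rfl
    · rw [f.l0]; simpa using hc0 h
    · exact absurd h.symm (f.no_chord1 hmin hv hv0 hv2)
    · rw [f.l2]; simpa using hc2 h
  · intro w ho hwv hwP
    rw [f.mem] at hwP
    push Not at hwP
    have hwR := ((hout w).1 ho).resolve_left hwP.2.1
    rcases hz w hwR with h | h | h | ⟨h, h4⟩
    · exact absurd h hwP.1
    · exact absurd h hwP.2.2
    · exact absurd h hwv
    · refine ⟨h, h4, ?_⟩
      rintro q0 q1 q2 hq ⟨b0, b1, b2⟩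
      have hm : p1 ∈ C.P.support := (f.mem p1).2 (Or.inr (Or.inl rfl))
      rw [hq] at hm
      simp at hm
      apply f.no_chord1 hmin hwR hwP.1 hwP.2.2
      rcases hm with rfl | rfl | rfl
      · exact b0.symm
      · exact b1.symm
      · exact b2.symm

lemma PFrame.len_ne_two {C : Config} (hmin : C.Minimal) {p0 p1 p2 : Fin C.n} {R : C.G.Walk p2 p0}
    {a0 a1 a2 : ℕ} (f : PFrame C p1 R a0 a1 a2) : R.length ≠ 2 := by
  intro hl
  obtain ⟨v, hv, hv0, hv2, hall⟩ : ∃ v ∈ R.support, v ≠ p0 ∧ v ≠ p2 ∧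
      ∀ y ∈ R.support, y = p0 ∨ y = p2 ∨ y = v := by
    clear f
    cases R with
    | nil => simp at hl
    | @cons _ v _ h T =>
      cases T with
      | nil => simp at hl
      | cons h' T' =>
        cases T' with
        | nil =>
          refine ⟨v, by simp, h'.ne, h.ne.symm, ?_⟩
          intro y hy
          simp at hy
          tauto
        | cons h'' T'' => simp at hl
  have hvP : v ∉ C.P.support := by
    rw [f.mem]
    have : v ≠ p1 := by rintro rfl; exact f.p1R hv
    tauto
  have := three_le C hvP
  obtain ⟨col, hcol, hS⟩ := exists_pick (C.L v) {a0, a2}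
    (lt_of_le_of_lt Finset.card_le_two (by omega))
  simp at hS
  refine f.del hmin (z := v) hv hv0 hv2 ?_ hcol (fun _ => hS.1) (fun _ => hS.2)
  intro y hy
  rcases hall y hy with h | h | h <;> tauto

lemma PFrame.len_ne_three {C : Config} (hmin : C.Minimal) {p0 p1 p2 : Fin C.n} {R : C.G.Walk p2 p0}
    {a0 a1 a2 : ℕ} (f : PFrame C p1 R a0 a1 a2) : R.length ≠ 3 := by
  intro hl
  obtain ⟨v, w, hv, hw, hvw, hv0, hv2, hw0, hw2, hall, nv, nw⟩ : ∃ v w, v ∈ R.support ∧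
      w ∈ R.support ∧ C.G.Adj v w ∧ v ≠ p0 ∧ v ≠ p2 ∧ w ≠ p0 ∧ w ≠ p2 ∧
      (∀ y ∈ R.support, y = p0 ∨ y = p2 ∨ y = v ∨ y = w) ∧ s(v, p0) ∉ R.edges ∧
      s(w, p2) ∉ R.edges := by
    have hp := f.path
    clear f
    cases R with
    | nil => simp at hl
    | @cons _ v _ h T =>
      cases T with
      | nil => simp at hl
      | @cons _ w _ h' T' =>
        cases T' with
        | nil => simp at hl
        | cons h2 T2 =>
          cases T2 with
          | cons h3 T3 => simp at hl
          | nil =>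
            simp at hp
            have e1 := h.ne
            have e2 := h'.ne
            have e3 := h2.ne
            refine ⟨v, w, by simp, by simp, h', by tauto, h.ne.symm, h2.ne, by tauto, ?_, ?_, ?_⟩
            · intro y hy
              simp at hy
              tauto
            · simp
              grind
            · simp
              grind
  have hv1 : v ≠ p1 := by rintro rfl; exact f.p1R hv
  have hw1 : w ≠ p1 := by rintro rfl; exact f.p1R hw
  have hv3 := three_le C (v := v) (by rw [f.mem]; tauto)
  have hw3 := three_le C (v := w) (by rw [f.mem]; tauto)
  have nv' : ¬ C.G.Adj v p0 := fun h => nv (f.no_chord hmin hv R.end_mem_support h)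
  have nw' : ¬ C.G.Adj w p2 := fun h => nw (f.no_chord hmin hw R.start_mem_support h)
  by_cases h4 : 4 ≤ (C.L w).card
  · obtain ⟨col, hcol, hS⟩ := exists_pick (C.L v) {a2} (by simp; omega)
    simp at hS
    refine f.del hmin (z := w) hv hv0 hv2 ?_ hcol (fun h => absurd h nv') (fun _ => hS)
    intro y hy
    rcases hall y hy with h | h | h | h
    · tauto
    · tauto
    · tauto
    · exact Or.inr (Or.inr (Or.inr ⟨h, h ▸ h4⟩))
  · have h4' : 4 ≤ (C.L v).card := by
      have := C.no_adjacent_3 w v hvw.symm (by omega)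
      omega
    obtain ⟨col, hcol, hS⟩ := exists_pick (C.L w) {a0} (by simp; omega)
    simp at hS
    refine f.del hmin (z := v) hw hw0 hw2 ?_ hcol (fun _ => hS) (fun h => absurd h nw')
    intro y hy
    rcases hall y hy with h | h | h | h
    · tauto
    · tauto
    · exact Or.inr (Or.inr (Or.inr ⟨h, h ▸ h4'⟩))
    · tauto

end

section
open SimpleGraph

lemma walk_len2 {V : Type} {G : SimpleGraph V} {a b y : V} (R : G.Walk a b) (hR : R.IsPath)
    (hab : a ≠ b) (h1 : s(y, a) ∈ R.edges) (h2 : s(y, b) ∈ R.edges) : R.length = 2 := by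
  cases R with
  | nil => simp at h1
  | @cons _ u _ h T =>
    rw [Walk.cons_isPath_iff] at hR
    have hyu : y = u := by
      rw [Walk.edges_cons, List.mem_cons] at h1
      rcases h1 with h1 | h1
      · rcases Sym2.eq_iff.1 h1 with ⟨_, h3⟩ | ⟨h3, _⟩
        · exact absurd h3 h.ne
        · exact h3
      · exact absurd (T.snd_mem_support_of_mem_edges h1) hR.2
    subst hyu
    rw [Walk.edges_cons, List.mem_cons] at h2
    rcases h2 with h2 | h2
    · rcases Sym2.eq_iff.1 h2 with ⟨h3, _⟩ | ⟨_, h3⟩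
      · exact absurd h3.symm h.ne
      · exact absurd h3.symm hab
    · rw [Walk.length_cons, walk_len1 T hR.1 h2]

lemma PFrame.no_common {C : Config} (hmin : C.Minimal) {p0 p1 p2 : Fin C.n} {R : C.G.Walk p2 p0}
    {a0 a1 a2 : ℕ} (f : PFrame C p1 R a0 a1 a2) {x : Fin C.n} (hx0 : C.G.Adj x p0)
    (hx1 : C.G.Adj x p1) (hx2 : C.G.Adj x p2) : False := by
  have hxR : x ∉ R.support := fun h => f.no_chord1 hmin h hx0.ne hx2.ne hx1.symm
  have h02 : ¬ C.G.Adj p2 p0 := fun h => f.len_ne_one hmin (walk_len1 R f.path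
    (f.no_chord hmin R.start_mem_support R.end_mem_support h))
  obtain ⟨W1, W2, S, s1, hp1, o1, o2⟩ := f.toOFrame.split3 hx2.symm hx0 hx1.ne hxR h02
  have hxW := S.sub x (by simp)
  have h0W := S.sub p0 (by simp)
  have h2W := S.sub p2 (by simp)
  have hinter : ∀ w ∈ W1, w ∈ W2 → w = p2 ∨ w = x ∨ w = p0 := by
    intro w h1 h2
    simpa using S.int w h1 h2
  have p1W : p1 ∉ W1 := fun hh => by
    rcases hinter p1 hh hp1 with h | h | h
    · exact f.h2.ne h
    · exact hx1.ne h.symm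
    · exact f.h0.ne h
  obtain ⟨w, hw, hw0, hw2⟩ : ∃ w ∈ R.support, w ≠ p0 ∧ w ≠ p2 := by
    have hne := f.ne
    clear f s1
    cases R with
    | nil => exact absurd rfl hne
    | @cons _ u _ h T =>
      refine ⟨u, by simp, ?_, h.ne.symm⟩
      rintro rfl
      exact h02 h
  have hwW : w ∉ W2 := fun hh => by
    rcases hinter w (s1 _ hw) hh with h | h | h
    · exact hw2 h
    · exact hxR (h ▸ hw)
    · exact hw0 h
  obtain ⟨c2, hc2, q2⟩ := color_side C hmin W2 (fun h => hwW (h ▸ mem_univ w)) C.P C.P_path C.P_len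
    (by
      intro v hv
      rw [f.mem] at hv
      rcases hv with rfl | rfl | rfl
      · exact h0W.2
      · exact hp1
      · exact h2W.2)
    (C.P_boundary.trans (bd_mono C W2)) C.L (fun v _ h => ⟨rfl, h⟩) C.size1 C.proper_on_P
    (fun p0 p1 p2 h x _ => C.common_neighbor p0 p1 p2 h x)
  obtain ⟨c1, hc1, d1, d2, d3, q1⟩ := color_two C hmin W1 (fun h => p1W (h ▸ mem_univ p1))
    hx2.symm hx0 f.ne.symm h2W.1 hxW.1 h0W.1 (subset_union_left.trans o1)
    (subset_union_right.trans o1)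
    (q2 p2 h2W.2 x hxW.2 hx2.symm) (q2 x hxW.2 p0 h0W.2 hx0) (fun h => absurd h h02)
    (by
      intro v hv hvP
      rw [f.mem] at hvP
      rcases hvP with rfl | rfl | rfl
      · simp
      · exact absurd hv p1W
      · simp)
    (by
      intro y hy y2 yx y0 hL
      have hyR := f.bad (fun h => p1W (h ▸ hy)) hL
      exact f.len_ne_two hmin (walk_len2 R f.path f.ne.symm
        (f.no_chord hmin hyR R.start_mem_support y2)
        (f.no_chord hmin hyR R.end_mem_support y0)))
  refine S.glue c1 c2 (fun w hw hT => ?_) hc2 q1 q2 ?_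
  · simp at hT
    exact hc1 w hw hT.1 hT.2.1 hT.2.2
  · intro w hw
    simp at hw
    rcases hw with rfl | rfl | rfl <;> assumption

lemma P_len_ne_zero (C : Config) (hmin : C.Minimal) {r : Fin C.n} (F : C.G.Walk r r)
    (hF : F.IsCycle) (hbd : C.D.BoundsOuter F) : C.P.length ≠ 0 := by
  intro hl
  have hsup : ∀ v, v ∈ C.P.support ↔ v = C.a := by
    intro v
    have h1 : C.P.support.length = 1 := by rw [Walk.length_support, hl]
    obtain ⟨q, hq⟩ := List.length_eq_one_iff.1 h1
    have := C.P.start_mem_support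
    rw [hq] at this ⊢
    simp at this ⊢
    rw [this]
  have haF : C.a ∈ F.support := by
    rw [← C.D.pos_mem_walkSet, ← hbd]
    exact C.P_boundary ((C.D.pos_mem_walkSet _).2 C.P.start_mem_support)
  obtain ⟨x, y, R, f, -, -⟩ := exists_frame C F hF hbd haF
  obtain ⟨α, hα⟩ := Finset.card_eq_one.1 (C.size1 C.a C.P.start_mem_support)
  have hx : x ∉ C.P.support := by rw [hsup]; exact f.h2.ne.symm
  obtain ⟨col, hcol, hS⟩ := exists_pick (C.L x) {α} (by
    have := three_le C hx
    simp; omega)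
  simp at hS
  refine extend_path C hmin (Walk.cons f.h2 Walk.nil) (by simp [f.h2.ne]) (by simp) (by simp [hl])
    ?_ x hx ?_ col hcol ?_ ?_
  · rw [C.D.walkSet_single, f.fr]
    exact subset_union_right.trans subset_union_right
  · intro v
    rw [hsup]
    simp
  · intro p hp _
    rw [hsup] at hp
    rw [hp, hα]
    simpa using Ne.symm hS
  · intro q0 q1 q2 hq
    simp at hq

lemma P_len_ne_one (C : Config) (hmin : C.Minimal) {r : Fin C.n} (F : C.G.Walk r r)
    (hF : F.IsCycle) (hbd : C.D.BoundsOuter F) : C.P.length ≠ 1 := by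
  intro hl
  obtain ⟨q0, q1, h, hsup, hset⟩ : ∃ q0 q1, ∃ h : C.G.Adj q0 q1, C.P.support = [q0, q1] ∧
      C.D.walkSet C.P = C.D.arcSet h := by
    have key : ∀ (a b : Fin C.n) (P : C.G.Walk a b), P.length = 1 → ∃ q0 q1, ∃ h : C.G.Adj q0 q1,
        P.support = [q0, q1] ∧ C.D.walkSet P = C.D.arcSet h := by
      intro a b P hl
      cases P with
      | nil => simp at hl
      | cons h T =>
        cases T with
        | nil => exact ⟨_, _, h, by simp, by rw [C.D.walkSet_single]⟩
        | cons h' T' => simp at hl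
    exact key _ _ C.P hl
  have hPF : C.D.arcSet h ⊆ C.D.walkSet F := by
    rw [← hset, ← hbd]; exact C.P_boundary
  have hmem : ∀ v, v ∈ C.P.support ↔ v = q0 ∨ v = q1 := by
    intro v; rw [hsup]; simp
  have h1F : q1 ∈ F.support := by
    rw [← C.D.pos_mem_walkSet]
    exact hPF (C.D.right_mem_arcSet h)
  obtain ⟨p2, R, f⟩ : ∃ p2, ∃ R : C.G.Walk p2 q0, OFrame C q1 R := by
    obtain ⟨x, y, R, f, -, he⟩ := exists_frame C F hF hbd h1F
    rcases he q0 (by rw [Sym2.eq_swap]; exact edge_mem_of_arcSet C F h hPF) with rfl | rfl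
    · exact ⟨y, R.reverse, f.symm⟩
    · exact ⟨x, R, f⟩
  obtain ⟨a0, l0⟩ := Finset.card_eq_one.1 (C.size1 q0 ((hmem _).2 (Or.inl rfl)))
  obtain ⟨a1, l1⟩ := Finset.card_eq_one.1 (C.size1 q1 ((hmem _).2 (Or.inr rfl)))
  have hp2 : p2 ∉ C.P.support := by
    rw [hmem]
    rintro (h | h)
    · exact f.ne h.symm
    · exact f.h2.ne h.symm
  have h3 := three_le C hp2
  have bad : ∀ y, C.G.Adj y q0 → C.G.Adj y q1 → ∀ t, C.L y = {a0, a1, t} →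
      (C.L y).card = 3 ∧ y ∈ R.support := by
    intro y y0 y1 t hL
    have hyP : y ∉ C.P.support := by
      rw [hmem]
      rintro (h | h)
      · exact y0.ne h
      · exact y1.ne h
    have hc := card_three _ _ _ (three_le C hyP) hL
    refine ⟨hc, ?_⟩
    by_contra hyR
    have := C.size5 y (by
      rw [f.onOuter]
      rintro (h | h)
      · exact y1.ne h
      · exact hyR h)
    omega
  have hpick : ∃ t ∈ C.L p2, t ≠ a0 ∧ t ≠ a1 ∧ ∀ y, C.G.Adj y q0 → C.G.Adj y q1 → C.G.Adj y p2 →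
      C.L y ≠ {a0, a1, t} := by
    by_cases hc : (C.L p2).card = 3
    · obtain ⟨t, ht, hS⟩ := exists_pick (C.L p2) {a0, a1}
        (lt_of_le_of_lt Finset.card_le_two (by omega))
      simp at hS
      refine ⟨t, ht, hS.1, hS.2, ?_⟩
      intro y y0 y1 y2 hL
      exact C.no_adjacent_3 y p2 y2 (bad y y0 y1 t hL).1 hc
    · obtain ⟨s, hs, t, ht, hsS, htS, hst⟩ := exists_pick2 (C.L p2) {a0, a1}
        (lt_of_le_of_lt (Nat.add_le_add_right Finset.card_le_two 1) (by omega))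
      simp at hsS htS
      by_contra hno
      push Not at hno
      obtain ⟨x, x0, x1, x2, hxL⟩ := hno s hs hsS.1 hsS.2
      obtain ⟨y, y0, y1, y2, hyL⟩ := hno t ht htS.1 htS.2
      have hyx : y ≠ x := by
        rintro rfl
        rw [hxL] at hyL
        exact triple_ne hsS.2 htS.2 hst hyL
      exact chord_side1 f (bad x x0 x1 s hxL).2 x0.ne x2.ne x1.symm y1.ne hyx y2.symm y0
  obtain ⟨t, ht, t0, t1, hbad⟩ := hpick
  have hq0 : q0 ≠ p2 := f.ne
  have hq1 : q1 ≠ p2 := f.h2.ne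
  refine extend_path C hmin (Walk.cons h (Walk.cons f.h2 Walk.nil)) (by simp [h.ne, f.h2.ne, f.ne])
    (by simp) (by simp [hl]) ?_ p2 hp2 ?_ t ht ?_ ?_
  · rw [C.D.walkSet_cons, C.D.walkSet_single]
    refine union_subset ?_ ?_
    · rw [← hset]; exact C.P_boundary
    · rw [f.fr]
      exact subset_union_right.trans subset_union_right
  · intro v
    rw [hmem]
    simp [or_assoc]
  · intro p hp _
    rw [hmem] at hp
    rcases hp with rfl | rfl
    · rw [l0]; simpa using Ne.symm t0
    · rw [l1]; simpa using Ne.symm t1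
  · intro b0 b1 b2 hb y y0 y1 y2
    simp at hb
    obtain ⟨rfl, rfl, rfl⟩ := hb
    rw [Function.update_of_ne y2.ne, Function.update_of_ne hq0, Function.update_of_ne hq1,
      Function.update_self, l0, l1]
    convert hbad y y0 y1 y2 using 1
    ext t; simp

lemma exists_pframe (C : Config) {r : Fin C.n} (F : C.G.Walk r r)
    (hF : F.IsCycle) (hbd : C.D.BoundsOuter F) (hl : C.P.length = 2) :
    ∃ p0 p1 p2, ∃ R : C.G.Walk p2 p0, ∃ a0 a1 a2, PFrame C p1 R a0 a1 a2 ∧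
      F.length = R.length + 2 := by
  obtain ⟨q0, q1, q2, h, h', hsup, hset⟩ : ∃ q0 q1 q2, ∃ h : C.G.Adj q0 q1, ∃ h' : C.G.Adj q1 q2,
      C.P.support = [q0, q1, q2] ∧ C.D.walkSet C.P = C.D.arcSet h ∪ C.D.arcSet h' := by
    have key : ∀ (a b : Fin C.n) (P : C.G.Walk a b), P.length = 2 → ∃ q0 q1 q2,
        ∃ h : C.G.Adj q0 q1, ∃ h' : C.G.Adj q1 q2,
        P.support = [q0, q1, q2] ∧ C.D.walkSet P = C.D.arcSet h ∪ C.D.arcSet h' := by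
      intro a b P hl
      cases P with
      | nil => simp at hl
      | cons h T =>
        cases T with
        | nil => simp at hl
        | cons h' T' =>
          cases T' with
          | nil => exact ⟨_, _, _, h, h', by simp, by rw [C.D.walkSet_cons, C.D.walkSet_single]⟩
          | cons h2 T2 => simp at hl
    exact key _ _ C.P hl
  have hPF : C.D.arcSet h ∪ C.D.arcSet h' ⊆ C.D.walkSet F := by
    rw [← hset, ← hbd]; exact C.P_boundary
  have hmem : ∀ v, v ∈ C.P.support ↔ v = q0 ∨ v = q1 ∨ v = q2 := by
    intro v; rw [hsup]; simp
  have h1F : q1 ∈ F.support := by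
    rw [← C.D.pos_mem_walkSet]
    exact hPF (Or.inl (C.D.right_mem_arcSet h))
  have hne : q0 ≠ q2 := by
    have := C.P_path.support_nodup
    rw [hsup] at this
    simp at this
    tauto
  have e0 : s(q1, q0) ∈ F.edges := by
    rw [Sym2.eq_swap]; exact edge_mem_of_arcSet C F h (subset_union_left.trans hPF)
  have e2 : s(q1, q2) ∈ F.edges := edge_mem_of_arcSet C F h' (subset_union_right.trans hPF)
  obtain ⟨R, f, hlen⟩ : ∃ R : C.G.Walk q2 q0, OFrame C q1 R ∧ F.length = R.length + 2 := by
    obtain ⟨x, y, R, f, hlen, he⟩ := exists_frame C F hF hbd h1F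
    rcases he q0 e0 with rfl | rfl <;> rcases he q2 e2 with rfl | rfl
    · exact absurd rfl hne
    · exact ⟨R.reverse, f.symm, by rw [Walk.length_reverse]; exact hlen⟩
    · exact ⟨R, f, hlen⟩
    · exact absurd rfl hne
  have m0 : q0 ∈ C.P.support := (hmem _).2 (Or.inl rfl)
  have m1 : q1 ∈ C.P.support := (hmem _).2 (Or.inr (Or.inl rfl))
  have m2 : q2 ∈ C.P.support := (hmem _).2 (Or.inr (Or.inr rfl))
  obtain ⟨a0, l0⟩ := Finset.card_eq_one.1 (C.size1 q0 m0)
  obtain ⟨a1, l1⟩ := Finset.card_eq_one.1 (C.size1 q1 m1)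
  obtain ⟨a2, l2⟩ := Finset.card_eq_one.1 (C.size1 q2 m2)
  refine ⟨q0, q1, q2, R, a0, a1, a2, ⟨f, hmem, l0, l1, l2, ?_, ?_, ?_, ?_⟩, hlen⟩
  · have := C.proper_on_P q0 m0 q1 m1 h
    rw [l0, l1] at this
    simpa using this
  · have := C.proper_on_P q1 m1 q2 m2 h'
    rw [l1, l2] at this
    simpa using this
  · intro hh
    have := C.proper_on_P q0 m0 q2 m2 hh
    rw [l0, l2] at this
    simpa using this
  · intro x x0 x1 x2
    have := C.common_neighbor q0 q1 q2 hsup x x0 x1 x2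
    rw [l0, l1, l2] at this
    convert this using 1
    ext t; simp

lemma main_aux
    (C : Config) (hmin : C.Minimal)
    {r : Fin C.n} (F : C.G.Walk r r) (hFcyc : F.IsCycle) (hFbd : C.D.BoundsOuter F) :
    C.P.length = 2 ∧
    (∀ p₀ p₁ p₂ : Fin C.n, C.P.support = [p₀, p₁, p₂] →
      ∀ x : Fin C.n, ¬ (C.G.Adj x p₀ ∧ C.G.Adj x p₁ ∧ C.G.Adj x p₂)) ∧
    6 ≤ F.length := by
  have h0 := P_len_ne_zero C hmin F hFcyc hFbd
  have h1 := P_len_ne_one C hmin F hFcyc hFbd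
  have h2 := C.P_len
  have hl : C.P.length = 2 := by omega
  obtain ⟨p0, p1, p2, R, a0, a1, a2, f, hlen⟩ := exists_pframe C F hFcyc hFbd hl
  refine ⟨hl, ?_, ?_⟩
  · rintro q0 q1 q2 hq x ⟨x0, x1, x2⟩
    have key : ∀ v, v = p0 ∨ v = p1 ∨ v = p2 → C.G.Adj x v := by
      intro v hv
      have := (f.mem v).2 hv
      rw [hq] at this
      simp at this
      rcases this with rfl | rfl | rfl <;> assumption
    exact f.no_common hmin (key p0 (by simp)) (key p1 (by simp)) (key p2 (by simp))
  · have l1 := f.len_ne_one hmin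
    have l2 := f.len_ne_two hmin
    have l3 := f.len_ne_three hmin
    have l0 : R.length ≠ 0 := fun h => f.ne (Walk.eq_of_length_eq_zero h).symm
    omega

end

/-- In a minimal counterexample configuration for the precolored-path 5-choosability
theorem, with `F` the cycle bounding the outer face: the precolored path `P` has length
exactly two, its three vertices `p₀ p₁ p₂` have no common neighbor, and `F` has length
at least 6. -/
theorem minimal_counterexample_path_and_outer_face
    (C : Config) (hmin : C.Minimal)
    {r : Fin C.n} (F : C.G.Walk r r) (hFcyc : F.IsCycle) (hFbd : C.D.BoundsOuter F) :
    C.P.length = 2 ∧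
    (∀ p₀ p₁ p₂ : Fin C.n, C.P.support = [p₀, p₁, p₂] →
      ∀ x : Fin C.n, ¬ (C.G.Adj x p₀ ∧ C.G.Adj x p₁ ∧ C.G.Adj x p₂)) ∧
    6 ≤ F.length := by
  exact main_aux C hmin F hFcyc hFbd
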